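/- arXiv:2212.12027 — 3 statements merged into one kernel-verified Lean document; each statement's English description precedes it below -/
import Mathlib

section
/- Let 𝔞 be a proper ideal of R, C a semidualizing R-module, and T = R ⋉ C the trivial extension. Then T is 𝔞T-relative Gorenstein if and only if C is 𝔞-relative Gorenstein and Ext^i_R(C/𝔞C, C) = 0 for all i ≠ cd(𝔞, R). -/
open CategoryTheory TensorProduct

noncomputable section

universe u

/-- The cohomological dimension `cd(𝔞, M)`: the largest `i` (in `ℕ∞`) such that the local
cohomology module `H^i_𝔞(M)` is nonzero. -/
noncomputable def cohDim {R : Type u} [CommRing R] (a : Ideal R)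
    (M : Type u) [AddCommGroup M] [Module R M] : ℕ∞ :=
  sSup ((fun i : ℕ => (i : ℕ∞)) ''
    {i : ℕ | Nontrivial ((localCohomology a i).obj (ModuleCat.of R M))})

/-- The grade `grade(𝔞, M)`: the least `i` (in `ℕ∞`) such that `Ext^i_R(R/𝔞, M) ≠ 0`. -/
noncomputable def relGrade {R : Type u} [CommRing R] (a : Ideal R)
    (M : Type u) [AddCommGroup M] [Module R M] : ℕ∞ :=
  sInf ((fun i : ℕ => (i : ℕ∞)) ''
    {i : ℕ | Nontrivial (((Ext R (ModuleCat.{u} R) i).obj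
      (Opposite.op (ModuleCat.of R (R ⧸ a)))).obj (ModuleCat.of R M))})

/-- `M` is `𝔞`-relative Cohen-Macaulay: `M = 𝔞M`, or `M ≠ 𝔞M` and `grade(𝔞,M) = cd(𝔞,M)`. -/
def IsRelCM {R : Type u} [CommRing R] (a : Ideal R)
    (M : Type u) [AddCommGroup M] [Module R M] : Prop :=
  a • (⊤ : Submodule R M) = ⊤ ∨
    (a • (⊤ : Submodule R M) ≠ ⊤ ∧ relGrade a M = cohDim a M)

/-- `M` is `𝔞`-relative maximal Cohen-Macaulay: `grade(𝔞,M) = cd(𝔞,R)`. -/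
def IsRelMCM {R : Type u} [CommRing R] (a : Ideal R)
    (M : Type u) [AddCommGroup M] [Module R M] : Prop :=
  relGrade a M = cohDim a R

/-- `M` is `𝔞`-relative Gorenstein: `Ext^i_R(R/𝔞, M) = 0` for all `i ≠ cd(𝔞,R)`. -/
def IsRelGorenstein {R : Type u} [CommRing R] (a : Ideal R)
    (M : Type u) [AddCommGroup M] [Module R M] : Prop :=
  ∀ i : ℕ, (i : ℕ∞) ≠ cohDim a R →
    Subsingleton (((Ext R (ModuleCat.{u} R) i).obj
      (Opposite.op (ModuleCat.of R (R ⧸ a)))).obj (ModuleCat.of R M))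

/-- `M` is `𝔞`-relative regular: `M = 𝔞M`, or `M ≠ 𝔞M` and `𝔞` is generated by a sequence of
length `cd(𝔞,R)` which is both an `M`-regular sequence and an `R`-regular sequence. -/
def IsRelRegular {R : Type u} [CommRing R] (a : Ideal R)
    (M : Type u) [AddCommGroup M] [Module R M] : Prop :=
  a • (⊤ : Submodule R M) = ⊤ ∨
    (a • (⊤ : Submodule R M) ≠ ⊤ ∧ ∃ rs : List R,
      (rs.length : ℕ∞) = cohDim a R ∧ Ideal.span {x | x ∈ rs} = a ∧
      RingTheory.Sequence.IsRegular M rs ∧ RingTheory.Sequence.IsRegular R rs)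

/-- A ring map (given as an algebra) `R → T` is pure if `N → T ⊗[R] N`, `n ↦ 1 ⊗ n`,
is injective for every `R`-module `N`. -/
def IsPureAlgebra (R T : Type u) [CommRing R] [CommRing T] [Algebra R T] : Prop :=
  ∀ (N : Type u) [AddCommGroup N] [Module R N],
    Function.Injective (fun n : N => (1 : T) ⊗ₜ[R] n)

/-- `C` is a semidualizing `R`-module: it is finitely generated, the homothety map
`R → Hom_R(C, C)` is bijective, and `Ext^i_R(C, C) = 0` for all `i > 0`. -/
def IsSemidualizing (R : Type u) [CommRing R]
    (C : Type u) [AddCommGroup C] [Module R C] : Prop :=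
  Module.Finite R C ∧ Function.Bijective (LinearMap.lsmul R C) ∧
    ∀ i : ℕ, 0 < i → Subsingleton (((Ext R (ModuleCat.{u} R) i).obj
      (Opposite.op (ModuleCat.of R C))).obj (ModuleCat.of R C))

section helpers
open Limits
variable {R : Type u} [CommRing R]


abbrev yF (Y : ModuleCat.{u} R) : ModuleCat.{u} R ⥤ (ModuleCat.{u} R)ᵒᵖ :=
  ((linearYoneda R (ModuleCat.{u} R)).obj Y).rightOp

abbrev yK {X : ModuleCat.{u} R} (P : ProjectiveResolution X) (Y : ModuleCat.{u} R) :
    HomologicalComplex (ModuleCat.{u} R)ᵒᵖ (ComplexShape.down ℕ) :=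
  ((yF Y).mapHomologicalComplex _).obj P.complex

/-- comparison of homology with old Ext -/
def yiso {X : ModuleCat.{u} R} (P : ProjectiveResolution X) (Y : ModuleCat.{u} R) (n : ℕ) :
    ((yK P Y).homology n).unop ≅ ((Ext R (ModuleCat.{u} R) n).obj (Opposite.op X)).obj Y :=
  (P.isoLeftDerivedObj (yF Y) n).unop

/-- projection from cocycles to homology -/
def yπ {X : ModuleCat.{u} R} (P : ProjectiveResolution X) (Y : ModuleCat.{u} R) (n : ℕ) :
    ((yK P Y).opcycles n).unop ⟶ ((yK P Y).homology n).unop :=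
  ((yK P Y).homologyι n).unop

/-- projection from cocycles to old Ext -/
def ycls {X : ModuleCat.{u} R} (P : ProjectiveResolution X) (Y : ModuleCat.{u} R) (n : ℕ) :
    ((yK P Y).opcycles n).unop ⟶ ((Ext R (ModuleCat.{u} R) n).obj (Opposite.op X)).obj Y :=
  yπ P Y n ≫ (yiso P Y n).hom

/-- underlying cochain -/
def yp {X : ModuleCat.{u} R} (P : ProjectiveResolution X) (Y : ModuleCat.{u} R) (n : ℕ) :
    ((yK P Y).opcycles n).unop ⟶ ModuleCat.of R (P.complex.X n ⟶ Y) :=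
  ((yK P Y).pOpcycles n).unop

lemma ycls_surj {X : ModuleCat.{u} R} (P : ProjectiveResolution X) (Y : ModuleCat.{u} R) (n : ℕ) :
    Function.Surjective (ycls P Y n) := by
  rw [← ModuleCat.epi_iff_surjective]
  have : Epi (yπ P Y n) := inferInstanceAs (Epi ((yK P Y).homologyι n).unop)
  unfold ycls
  infer_instance

lemma yp_inj {X : ModuleCat.{u} R} (P : ProjectiveResolution X) (Y : ModuleCat.{u} R) (n : ℕ) :
    Function.Injective (yp P Y n) := by
  rw [← ModuleCat.mono_iff_injective]
  exact inferInstanceAs (Mono ((yK P Y).pOpcycles n).unop)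

lemma yp_exists {X : ModuleCat.{u} R} (P : ProjectiveResolution X) (Y : ModuleCat.{u} R) (n : ℕ)
    (f : P.complex.X n ⟶ Y) : (P.complex.d (n+1) n ≫ f = 0) ↔ ∃ z, yp P Y n z = f := by
  have := ((yK P Y).opcyclesIsCokernel (n+1) n (by simp))
  let S := (ShortComplex.mk ((yK P Y).d (n+1) n) ((yK P Y).pOpcycles n)
    ((yK P Y).d_pOpcycles (n+1) n))
  have ex : S.Exact := ShortComplex.exact_of_g_is_cokernel _ this
  have ex' := ex.unop
  rw [ShortComplex.moduleCat_exact_iff] at ex'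
  constructor
  · intro h
    exact ex' f h
  · rintro ⟨z, rfl⟩
    exact ShortComplex.moduleCat_zero_apply S.unop z

lemma ycls_zero {X : ModuleCat.{u} R} (P : ProjectiveResolution X) (Y : ModuleCat.{u} R) (n : ℕ)
    (z) : ycls P Y n z = 0 ↔ ∃ g : P.complex.X (n-1) ⟶ Y, P.complex.d n (n-1) ≫ g = yp P Y n z := by
  have hn : (ComplexShape.down ℕ).next n = n - 1 := by
    cases n <;> simp
  have := ((yK P Y).homologyIsKernel n (n-1) hn)
  let S := (ShortComplex.mk ((yK P Y).homologyι n) ((yK P Y).fromOpcycles n (n-1)) (by simp))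
  have ex : S.Exact :=
    ShortComplex.exact_of_f_is_kernel _ this
  have ex' := ex.unop
  rw [ShortComplex.moduleCat_exact_iff] at ex'
  have h1 : ycls P Y n z = 0 ↔ yπ P Y n z = 0 := by
    unfold ycls
    have hi : Function.Injective (yiso P Y n).hom := by
      rw [← ModuleCat.mono_iff_injective]; infer_instance
    rw [← map_eq_zero_iff (yiso P Y n).hom.hom hi]
    rfl
  have hd : ∀ g : P.complex.X (n-1) ⟶ Y,
      yp P Y n (((yK P Y).fromOpcycles n (n-1)).unop g) = P.complex.d n (n-1) ≫ g := by
    intro g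
    have := (yK P Y).p_fromOpcycles n (n-1)
    have := congrArg Quiver.Hom.unop this
    exact congrArg (fun (φ : ModuleCat.of R (P.complex.X (n-1) ⟶ Y) ⟶ ModuleCat.of R (P.complex.X n ⟶ Y)) => φ g) this
  rw [h1]
  constructor
  · intro h
    obtain ⟨g, hg⟩ := ex' z h
    exact ⟨g, (hd g).symm.trans (congrArg _ hg)⟩
  · rintro ⟨g, hg⟩
    rw [← yp_inj P Y n ((hd g).trans hg)]
    exact ShortComplex.moduleCat_zero_apply S.unop g

lemma ycls_nat {X X' : ModuleCat.{u} R} (P : ProjectiveResolution X) (P' : ProjectiveResolution X')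
    (Y : ModuleCat.{u} R) (n : ℕ) (g : X' ⟶ X) (φ : ProjectiveResolution.Hom P' P g) (z) :
    ∃ z', yp P' Y n z' = φ.hom.f n ≫ yp P Y n z ∧
      ycls P' Y n z' = (((Ext R (ModuleCat.{u} R) n).map g.op).app Y) (ycls P Y n z) := by
  let m : yK P' Y ⟶ yK P Y := ((yF Y).mapHomologicalComplex _).map φ.hom
  let mo : ((yK P Y).opcycles n).unop ⟶ ((yK P' Y).opcycles n).unop :=
    (HomologicalComplex.opcyclesMap m n).unop
  let mh : ((yK P Y).homology n).unop ⟶ ((yK P' Y).homology n).unop :=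
    (HomologicalComplex.homologyMap m n).unop
  refine ⟨mo z, ?_, ?_⟩
  · have := HomologicalComplex.p_opcyclesMap m n
    have := congrArg Quiver.Hom.unop this
    exact congrArg (fun (ψ : ((yK P Y).opcycles n).unop ⟶ ModuleCat.of R (P'.complex.X n ⟶ Y)) => ψ z) this
  · have h1 : yπ P Y n ≫ mh = mo ≫ yπ P' Y n :=
      congrArg Quiver.Hom.unop (HomologicalComplex.homologyι_naturality m n)
    have h2 : (yiso P Y n).hom ≫ ((Ext R (ModuleCat.{u} R) n).map g.op).app Y =
        mh ≫ (yiso P' Y n).hom :=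
      congrArg Quiver.Hom.unop (ProjectiveResolution.isoLeftDerivedObj_hom_naturality g P' P φ.hom
        φ.hom_f_zero_comp_π_f_zero (yF Y) n)
    have h3 : mo ≫ ycls P' Y n = ycls P Y n ≫ ((Ext R (ModuleCat.{u} R) n).map g.op).app Y := by
      unfold ycls
      rw [Category.assoc, h2, reassoc_of% h1]
    exact congrArg (fun (ψ : ((yK P Y).opcycles n).unop ⟶
      ((Ext R (ModuleCat.{u} R) n).obj (Opposite.op X')).obj Y) => ψ z) h3

lemma extMk_zero_iff {X Y : ModuleCat.{u} R} (P : ProjectiveResolution X) (n : ℕ)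
    (f : P.complex.X n ⟶ Y) (hf : P.complex.d (n+1) n ≫ f = 0) :
    P.extMk f (n+1) rfl hf = 0 ↔ ∃ g : P.complex.X (n-1) ⟶ Y, P.complex.d n (n-1) ≫ g = f := by
  cases n with
  | succ n => exact P.extMk_eq_zero_iff _ _ _ _ _ rfl
  | zero =>
    have : (∃ g : P.complex.X (0-1) ⟶ Y, P.complex.d 0 (0-1) ≫ g = f) ↔ f = 0 := by
      have : P.complex.d 0 (0-1) = 0 := P.complex.shape _ _ (by simp)
      simp only [this, zero_comp, exists_const]
      exact ⟨Eq.symm, Eq.symm⟩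
    rw [this]
    constructor
    · intro h
      simp only [← P.extEquivCohomologyClass.apply_eq_iff_eq,
        P.extEquivCohomologyClass_extMk, P.extEquivCohomologyClass_zero,
        CochainComplex.HomComplex.CohomologyClass.mk_eq_zero_iff] at h
      rw [CochainComplex.HomComplex.Cocycle.toSingleMk_mem_coboundaries_iff _ _ _ _ _ 1 (by simp)] at h
      obtain ⟨g, hg⟩ := h
      have hz : IsZero (P.cochainComplex.X 1) := by
        apply CochainComplex.isZero_of_isStrictlyLE _ 0 1 (by simp)
      rw [hz.eq_of_src g 0, comp_zero] at hg
      rw [← cancel_epi (P.cochainComplexXIso (-(0:ℕ)) 0 rfl).hom, ← hg, comp_zero]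
    · rintro rfl
      simp

open Abelian in
/-- element-level comparison of old and new Ext -/
lemma old_to_new (X Y : ModuleCat.{u} R) (n : ℕ)
    (x : ((Ext R (ModuleCat.{u} R) n).obj (Opposite.op X)).obj Y) :
    ∃ e : Abelian.Ext X Y n, ∀ (X' : ModuleCat.{u} R) (g : X' ⟶ X),
      ((Ext R (ModuleCat.{u} R) n).map g.op).app Y x = 0 ↔ (Ext.mk₀ g).comp e (zero_add n) = 0 := by
  let P := ProjectiveResolution.of X
  obtain ⟨z, rfl⟩ := ycls_surj P Y n x
  refine ⟨P.extMk (yp P Y n z) (n+1) rfl ((yp_exists P Y n _).2 ⟨z, rfl⟩), fun X' g => ?_⟩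
  let P' := ProjectiveResolution.of X'
  let φ : ProjectiveResolution.Hom P' P g := ⟨ProjectiveResolution.lift g P' P,
    ProjectiveResolution.lift_commutes_zero g P' P⟩
  obtain ⟨z', h1, h2⟩ := ycls_nat P P' Y n g φ z
  rw [← h2, ProjectiveResolution.mk₀_comp_extMk _ _ _ _ φ, extMk_zero_iff, ycls_zero, h1]

open Abelian in
lemma new_to_old (X Y : ModuleCat.{u} R) (n : ℕ) (e : Abelian.Ext X Y n) :
    ∃ x : ((Ext R (ModuleCat.{u} R) n).obj (Opposite.op X)).obj Y, ∀ (X' : ModuleCat.{u} R) (g : X' ⟶ X),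
      ((Ext R (ModuleCat.{u} R) n).map g.op).app Y x = 0 ↔ (Ext.mk₀ g).comp e (zero_add n) = 0 := by
  let P := ProjectiveResolution.of X
  obtain ⟨f, hf, rfl⟩ := P.extMk_surjective e (n+1) rfl
  obtain ⟨z, rfl⟩ := (yp_exists P Y n _).1 hf
  refine ⟨ycls P Y n z, fun X' g => ?_⟩
  let P' := ProjectiveResolution.of X'
  let φ : ProjectiveResolution.Hom P' P g := ⟨ProjectiveResolution.lift g P' P,
    ProjectiveResolution.lift_commutes_zero g P' P⟩
  obtain ⟨z', h1, h2⟩ := ycls_nat P P' Y n g φ z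
  rw [← h2, ProjectiveResolution.mk₀_comp_extMk _ _ _ _ φ, extMk_zero_iff, ycls_zero, h1]

lemma subs_iff (X Y : ModuleCat.{u} R) (n : ℕ) :
    Subsingleton (((Ext R (ModuleCat.{u} R) n).obj (Opposite.op X)).obj Y) ↔
      Subsingleton (Abelian.Ext X Y n) := by
  constructor
  · intro h
    refine subsingleton_of_forall_eq 0 fun e => ?_
    obtain ⟨x, hx⟩ := new_to_old X Y n e
    have := (hx X (𝟙 X)).1 (Subsingleton.elim (α := ((Ext R (ModuleCat.{u} R) n).obj (Opposite.op X)).obj Y) _ _)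
    simpa using this
  · intro h
    refine subsingleton_of_forall_eq 0 fun e => ?_
    obtain ⟨x, hx⟩ := old_to_new X Y n e
    have := (hx X (𝟙 X)).2 (Subsingleton.elim _ _)
    simpa using this

/-- vanishing of local cohomology, in terms of `Abelian.Ext`. -/
def LC (a : Ideal R) (i : ℕ) (M : Type u) [AddCommGroup M] [Module R M] : Prop :=
  ∀ (t : ℕ) (e : Abelian.Ext (ModuleCat.of R (R ⧸ a ^ t)) (ModuleCat.of R M) i),
    ∃ (s : ℕ) (h : t ≤ s),
      (Abelian.Ext.mk₀ (ModuleCat.ofHom (Submodule.mapQ (a ^ s) (a ^ t) LinearMap.id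
        (Ideal.pow_le_pow_right h)))).comp e (zero_add i) = 0

lemma lc_iff (a : Ideal R) (i : ℕ) (M : Type u) [AddCommGroup M] [Module R M] :
    Subsingleton ((localCohomology a i).obj (ModuleCat.of R M)) ↔ LC a i M := by
  let D := localCohomology.diagram (localCohomology.idealPowersDiagram a) i
  let F := D ⋙ (evaluation _ _).obj (ModuleCat.of R M)
  let e : (localCohomology a i).obj (ModuleCat.of R M) ≅ colimit F :=
    colimitObjIsoColimitCompEvaluation D (ModuleCat.of R M)
  have h0 : Subsingleton ((localCohomology a i).obj (ModuleCat.of R M)) ↔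
      Subsingleton (colimit F : ModuleCat R) := e.toLinearEquiv.toEquiv.subsingleton_congr
  rw [h0]
  have : PreservesFilteredColimitsOfSize.{0, 0} (forget (ModuleCat.{u} R)) :=
    preservesFilteredColimitsOfSize_shrink.{0, u, 0, u} _
  have h1 : Subsingleton (colimit F : ModuleCat R) ↔ ∀ j, ∀ x : F.obj j, ∃ k, ∃ f : j ⟶ k, F.map f x = 0 := by
    constructor
    · intro h j x
      exact Concrete.colimit_rep_eq_zero R F j x (Subsingleton.elim _ _)
    · intro h
      refine subsingleton_of_forall_eq 0 fun y => ?_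
      obtain ⟨j, x, rfl⟩ := Concrete.colimit_exists_rep F y
      obtain ⟨k, f, hf⟩ := h j x
      rw [← colimit.w F f]
      rw [ModuleCat.comp_apply, hf, map_zero]
  rw [h1]
  constructor
  · intro h t e
    obtain ⟨x, hx⟩ := new_to_old _ _ _ e
    obtain ⟨k, f, hf⟩ := h (Opposite.op (Opposite.op t)) x
    exact ⟨k.unop.unop, f.unop.unop.down.down, (hx _ _).1 hf⟩
  · intro h j x
    obtain ⟨e, he⟩ := old_to_new _ _ _ x
    obtain ⟨s, hs, h⟩ := h j.unop.unop e
    exact ⟨Opposite.op (Opposite.op s), (homOfLE hs).op.op, (he _ _).2 h⟩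


abbrev qm (a : Ideal R) {t s : ℕ} (h : t ≤ s) :
    ModuleCat.of R (R ⧸ a ^ s) ⟶ ModuleCat.of R (R ⧸ a ^ t) :=
  ModuleCat.ofHom (Submodule.mapQ (a ^ s) (a ^ t) LinearMap.id (Ideal.pow_le_pow_right h))

lemma qm_comp (a : Ideal R) {t s r : ℕ} (h : t ≤ s) (h' : s ≤ r) :
    qm a h' ≫ qm a h = qm a (h.trans h') := by
  ext
  rfl

lemma qm_qm (a : Ideal R) {t s r : ℕ} (h : t ≤ s) (h' : s ≤ r) {Y : ModuleCat.{u} R} {i : ℕ}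
    (e : Abelian.Ext (ModuleCat.of R (R ⧸ a ^ t)) Y i) :
    (Abelian.Ext.mk₀ (qm a h')).comp ((Abelian.Ext.mk₀ (qm a h)).comp e (zero_add i)) (zero_add i) =
    (Abelian.Ext.mk₀ (qm a (h.trans h'))).comp e (zero_add i) := by
  rw [Abelian.Ext.mk₀_comp_mk₀_assoc, qm_comp]

section ses
variable {M N P : Type u} [AddCommGroup M] [Module R M] [AddCommGroup N] [Module R N]
  [AddCommGroup P] [Module R P]

lemma ses_se (f : M →ₗ[R] N) (g : N →ₗ[R] P) (hf : Function.Injective f)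
    (hfg : Function.Exact f g) (hg : Function.Surjective g) :
    (ShortComplex.mk (ModuleCat.ofHom f) (ModuleCat.ofHom g)
      (by ext x; exact hfg.apply_apply_eq_zero x)).ShortExact :=
  ModuleCat.shortComplex_shortExact _ hfg hf hg


lemma LC_mid (a : Ideal R) (f : M →ₗ[R] N) (g : N →ₗ[R] P) (hf : Function.Injective f)
    (hfg : Function.Exact f g) (hg : Function.Surjective g)
    (i : ℕ) (h1 : LC a i M) (h3 : LC a i P) : LC a i N := by
  intro t e
  obtain ⟨s, hs, h⟩ := h3 t (e.comp (Abelian.Ext.mk₀ (ModuleCat.ofHom g)) (add_zero i))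
  have hS := ses_se f g hf hfg hg
  rw [← Abelian.Ext.comp_assoc_of_third_deg_zero] at h
  obtain ⟨x, hx⟩ := Abelian.Ext.covariant_sequence_exact₂ _ hS _ h
  obtain ⟨s', hs', h'⟩ := h1 s x
  refine ⟨s', hs.trans hs', ?_⟩
  rw [← qm_qm a hs hs', ← hx]
  rw [← Abelian.Ext.comp_assoc_of_third_deg_zero, h', Abelian.Ext.zero_comp]

lemma LC_left (a : Ideal R) (f : M →ₗ[R] N) (g : N →ₗ[R] P) (hf : Function.Injective f)
    (hfg : Function.Exact f g) (hg : Function.Surjective g)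
    (i : ℕ) (h3 : LC a i P) (h2 : LC a (i+1) N) : LC a (i+1) M := by
  intro t e
  obtain ⟨s, hs, h⟩ := h2 t (e.comp (Abelian.Ext.mk₀ (ModuleCat.ofHom f)) (add_zero (i+1)))
  have hS := ses_se f g hf hfg hg
  rw [← Abelian.Ext.comp_assoc_of_third_deg_zero] at h
  obtain ⟨x, hx⟩ := Abelian.Ext.covariant_sequence_exact₁ _ hS _ h rfl
  obtain ⟨s', hs', h'⟩ := h3 s x
  refine ⟨s', hs.trans hs', ?_⟩
  rw [← qm_qm a hs hs', ← hx]
  rw [← Abelian.Ext.comp_assoc _ _ _ (zero_add i) rfl (by simp), h', Abelian.Ext.zero_comp]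

lemma LC_right (a : Ideal R) (f : M →ₗ[R] N) (g : N →ₗ[R] P) (hf : Function.Injective f)
    (hfg : Function.Exact f g) (hg : Function.Surjective g)
    (i : ℕ) (h2 : LC a i N) (h1 : LC a (i+1) M) : LC a i P := by
  intro t e
  have hS := ses_se f g hf hfg hg
  obtain ⟨s, hs, h⟩ := h1 t (e.comp hS.extClass rfl)
  rw [← Abelian.Ext.comp_assoc _ _ _ (zero_add i) rfl (by simp)] at h
  obtain ⟨x, hx⟩ := Abelian.Ext.covariant_sequence_exact₃ _ hS _ rfl h
  obtain ⟨s', hs', h'⟩ := h2 s x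
  refine ⟨s', hs.trans hs', ?_⟩
  rw [← qm_qm a hs hs', ← hx]
  rw [← Abelian.Ext.comp_assoc_of_third_deg_zero, h', Abelian.Ext.zero_comp]

end ses

lemma LC_retract (a : Ideal R) {i : ℕ} {M N : Type u} [AddCommGroup M] [Module R M] [AddCommGroup N]
    [Module R N] (f : M →ₗ[R] N) (g : N →ₗ[R] M) (h : g ∘ₗ f = LinearMap.id) (hN : LC a i N) :
    LC a i M := by
  intro t e
  obtain ⟨s, hs, h'⟩ := hN t (e.comp (Abelian.Ext.mk₀ (ModuleCat.ofHom f)) (add_zero i))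
  refine ⟨s, hs, ?_⟩
  have : e = (e.comp (Abelian.Ext.mk₀ (ModuleCat.ofHom f)) (add_zero i)).comp
      (Abelian.Ext.mk₀ (ModuleCat.ofHom g)) (add_zero i) := by
    rw [Abelian.Ext.comp_assoc_of_third_deg_zero, Abelian.Ext.mk₀_comp_mk₀, ← ModuleCat.ofHom_comp, h]
    exact (Abelian.Ext.comp_mk₀_id e).symm
  rw [this, ← Abelian.Ext.comp_assoc_of_third_deg_zero, h', Abelian.Ext.zero_comp]

lemma LC_equiv (a : Ideal R) {i : ℕ} {M N : Type u} [AddCommGroup M] [Module R M] [AddCommGroup N]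
    [Module R N] (f : M ≃ₗ[R] N) : LC a i M ↔ LC a i N :=
  ⟨LC_retract a f.symm.toLinearMap f.toLinearMap (by ext; simp),
   LC_retract a f.toLinearMap f.symm.toLinearMap (by ext; simp)⟩

lemma LC_inj (a : Ideal R) (i : ℕ) (J : Type u) [AddCommGroup J] [Module R J] [Module.Injective R J] :
    LC a (i+1) J := by
  intro t e
  have : Injective (ModuleCat.of R J) := Module.injective_object_of_injective_module R J
  exact ⟨t, le_rfl, by rw [Abelian.Ext.eq_zero_of_injective e, Abelian.Ext.comp_zero]⟩

lemma LC_prod (a : Ideal R) {i : ℕ} {M N : Type u} [AddCommGroup M] [Module R M] [AddCommGroup N]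
    [Module R N] : LC a i (M × N) ↔ LC a i M ∧ LC a i N := by
  refine ⟨fun h => ⟨LC_retract a (LinearMap.inl R M N) (LinearMap.fst R M N) (by ext; simp) h,
    LC_retract a (LinearMap.inr R M N) (LinearMap.snd R M N) (by ext; simp) h⟩, fun h => ?_⟩
  exact LC_mid a (LinearMap.inl R M N) (LinearMap.snd R M N) LinearMap.inl_injective
    (Function.Exact.inl_snd) LinearMap.snd_surjective i h.1 h.2

lemma LC_subsingleton (a : Ideal R) (i : ℕ) (M : Type u) [AddCommGroup M] [Module R M]
    [Subsingleton M] : LC a i M := by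
  intro t e
  refine ⟨t, le_rfl, ?_⟩
  rw [← Abelian.Ext.comp_mk₀_id e, (ModuleCat.isZero_of_subsingleton (ModuleCat.of R M)).eq_of_src (𝟙 _) 0]
  simp

lemma LC_pi (a : Ideal R) {i : ℕ} {M : Type u} [AddCommGroup M] [Module R M] (h : LC a i M) (n : ℕ) :
    LC a i (Fin n → M) := by
  induction n with
  | zero => exact LC_subsingleton a i _
  | succ n ih =>
    refine (LC_equiv a (Fin.consLinearEquiv R (fun _ : Fin (n+1) => M))).1 ?_
    exact (LC_prod a).2 ⟨h, ih⟩

/-- torsion -/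
def tors (a : Ideal R) (M : Type u) [AddCommGroup M] [Module R M] : Set M :=
  {m | ∃ t : ℕ, ∀ r ∈ a ^ t, r • m = 0}

/-- map from quotient -/
def qhom (a : Ideal R) {M : Type u} [AddCommGroup M] [Module R M] (t : ℕ) (m : M)
   (h : ∀ r ∈ a ^ t, r • m = 0) : ModuleCat.of R (R ⧸ a ^ t) ⟶ ModuleCat.of R M :=
  ModuleCat.ofHom (Submodule.liftQ (a ^ t) (LinearMap.toSpanSingleton R M m) (fun r hr => h r hr))

lemma qhom_apply (a : Ideal R) {M : Type u} [AddCommGroup M] [Module R M] (t : ℕ) (m : M)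
   (h : ∀ r ∈ a ^ t, r • m = 0) : (qhom a t m h) (Submodule.Quotient.mk 1 : R ⧸ a ^ t) = m := by
  change (1:R) • m = m
  simp

lemma qhom_ext (I : Ideal R) {M : ModuleCat.{u} R} (f g : ModuleCat.of R (R ⧸ I) ⟶ M)
   (h : f (Submodule.Quotient.mk 1 : R ⧸ I) = g (Submodule.Quotient.mk 1 : R ⧸ I)) : f = g := by
  refine ModuleCat.hom_ext (LinearMap.ext fun x => ?_)
  change f x = g x
  obtain ⟨x, rfl⟩ := Submodule.Quotient.mk_surjective _ x
  have : (Submodule.Quotient.mk x : R ⧸ I) = x • (Submodule.Quotient.mk 1 : R ⧸ I) := by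
    rw [← Submodule.Quotient.mk_smul]; simp
  rw [this, map_smul, map_smul]
  congr 1

lemma hom_tors (a : Ideal R) {M : Type u} [AddCommGroup M] [Module R M] (t : ℕ)
    (f : ModuleCat.of R (R ⧸ a ^ t) ⟶ ModuleCat.of R M) :
    ∀ r ∈ a ^ t, r • (f (Submodule.Quotient.mk 1 : R ⧸ a ^ t) : M) = 0 := by
  intro r hr
  have := map_smul f.hom r (Submodule.Quotient.mk 1 : R ⧸ a ^ t)
  rw [← Submodule.Quotient.mk_smul, smul_eq_mul, mul_one, (Submodule.Quotient.mk_eq_zero _).2 hr,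
    map_zero] at this
  exact this.symm

lemma LC_zero_iff (a : Ideal R) (M : Type u) [AddCommGroup M] [Module R M] :
    LC a 0 M ↔ ∀ m ∈ tors a M, m = 0 := by
  constructor
  · rintro h m ⟨t, ht⟩
    obtain ⟨s, hs, h⟩ := h t (Abelian.Ext.mk₀ (qhom a t m ht))
    rw [Abelian.Ext.mk₀_comp_mk₀, Abelian.Ext.mk₀_eq_zero_iff] at h
    have := congrArg (fun φ : ModuleCat.of R (R ⧸ a ^ s) ⟶ ModuleCat.of R M =>
      φ (Submodule.Quotient.mk 1 : R ⧸ a ^ s)) h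
    rw [← qhom_apply a t m ht]
    exact this
  · intro h t e
    refine ⟨t, le_rfl, ?_⟩
    obtain ⟨f, rfl⟩ := (Abelian.Ext.mk₀_bijective _ _).2 e
    have : f = 0 := by
      apply qhom_ext
      exact h _ ⟨t, hom_tors a t f⟩
    rw [this, Abelian.Ext.mk₀_zero, Abelian.Ext.comp_zero]

lemma LC_one_iff {M N P : Type u} [AddCommGroup M] [Module R M] [AddCommGroup N] [Module R N]
    [AddCommGroup P] [Module R P] (a : Ideal R) (f : M →ₗ[R] N) (g : N →ₗ[R] P) (hf : Function.Injective f)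
    (hfg : Function.Exact f g) (hg : Function.Surjective g) (hN : LC a 1 N) :
    LC a 1 M ↔ ∀ p ∈ tors a P, ∃ n ∈ tors a N, g n = p := by
  have hS := ses_se f g hf hfg hg
  constructor
  · rintro h p ⟨t, ht⟩
    obtain ⟨s, hs, h⟩ := h t ((Abelian.Ext.mk₀ (qhom a t p ht)).comp hS.extClass (zero_add 1))
    rw [← Abelian.Ext.comp_assoc _ _ _ (zero_add 0) rfl (by simp), Abelian.Ext.mk₀_comp_mk₀] at h
    obtain ⟨x, hx⟩ := Abelian.Ext.covariant_sequence_exact₃ _ hS _ rfl h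
    obtain ⟨x, rfl⟩ := (Abelian.Ext.mk₀_bijective _ _).2 x
    rw [Abelian.Ext.mk₀_comp_mk₀, (Abelian.Ext.mk₀_bijective _ _).1.eq_iff] at hx
    refine ⟨x (Submodule.Quotient.mk 1 : R ⧸ a ^ s), ⟨s, hom_tors a s x⟩, ?_⟩
    have := congrArg (fun φ : ModuleCat.of R (R ⧸ a ^ s) ⟶ ModuleCat.of R P =>
      φ (Submodule.Quotient.mk 1 : R ⧸ a ^ s)) hx
    refine Eq.trans this ?_
    exact qhom_apply a t p ht
  · intro h t e
    obtain ⟨s, hs, h'⟩ := hN t (e.comp (Abelian.Ext.mk₀ (ModuleCat.ofHom f)) (add_zero 1))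
    rw [← Abelian.Ext.comp_assoc_of_third_deg_zero] at h'
    obtain ⟨x, hx⟩ := Abelian.Ext.covariant_sequence_exact₁ _ hS _ h' rfl
    obtain ⟨x, rfl⟩ := (Abelian.Ext.mk₀_bijective _ _).2 x
    obtain ⟨n, ⟨r, hr⟩, hn⟩ := h _ ⟨s, hom_tors a s x⟩
    refine ⟨max s r, hs.trans (le_max_left _ _), ?_⟩
    have hk : ∀ y ∈ a ^ (max s r), y • n = 0 :=
      fun y hy => hr y (Ideal.pow_le_pow_right (le_max_right _ _) hy)
    have : qm a (le_max_left s r) ≫ x = qhom a (max s r) n hk ≫ ModuleCat.ofHom g := by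
      apply qhom_ext
      change _ = g (qhom a (max s r) n hk (Submodule.Quotient.mk 1 : R ⧸ a ^ (max s r)))
      rw [qhom_apply, hn]
      rfl
    rw [← qm_qm a hs (le_max_left s r), ← hx, ← Abelian.Ext.comp_assoc _ _ _ (zero_add 0) rfl (by simp),
      Abelian.Ext.mk₀_comp_mk₀, this, ← Abelian.Ext.mk₀_comp_mk₀,
      Abelian.Ext.comp_assoc _ _ _ (zero_add 0) (zero_add 1) (by simp)]
    have := hS.comp_extClass
    simp only at this
    rw [this, Abelian.Ext.comp_zero]


lemma exists_inj_embed (R : Type u) [CommRing R] (M : Type u) [AddCommGroup M] [Module R M] :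
    ∃ (J : Type u) (_ : AddCommGroup J) (_ : Module R J) (_ : Module.Injective R J)
      (f : M →ₗ[R] J), Function.Injective f := by
  let X := ModuleCat.of R M
  have := Injective.injective_under X
  refine ⟨(Injective.under X : ModuleCat.{u} R), inferInstance, inferInstance, ?_, (Injective.ι X).hom, ?_⟩
  · exact Module.injective_module_of_injective_object _ _
  · exact (ModuleCat.mono_iff_injective _).1 inferInstance

lemma inj_factor {K F J : Type u} [AddCommGroup K] [Module R K] [AddCommGroup F] [Module R F]
    [AddCommGroup J] [Module R J] [Module.Injective R J] (f : K →ₗ[R] F) (φ : K →ₗ[R] J)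
    (h : ∀ x, f x = 0 → φ x = 0) : ∃ ψ : F →ₗ[R] J, ∀ x, ψ (f x) = φ x := by
  have hle : LinearMap.ker f ≤ LinearMap.ker φ := fun x hx => h x hx
  obtain ⟨ψ, hψ⟩ := Module.Injective.out (R := R) (Q := J)
    ((LinearMap.ker f).liftQ f le_rfl) (by
      rw [← LinearMap.ker_eq_bot]; exact Submodule.ker_liftQ_eq_bot _ _ _ le_rfl)
    ((LinearMap.ker f).liftQ φ hle)
  exact ⟨ψ, fun x => hψ (Submodule.Quotient.mk x)⟩

lemma LC_hom_aux [IsNoetherianRing R] (a : Ideal R) (J : Type u) [AddCommGroup J] [Module R J]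
    [Module.Injective R J] (j : ℕ) : ∀ (N : Type u) [AddCommGroup N] [Module R N] [Module.Finite R N],
    LC a (j+1) (N →ₗ[R] J) := by
  induction j with
  | zero =>
    intro N _ _ _
    obtain ⟨n, p, hp⟩ := Module.Finite.exists_fin' R N
    let K := LinearMap.ker p
    have hF : LC a (0+1) ((Fin n → R) →ₗ[R] J) :=
      (LC_equiv a ((LinearMap.lsum R (fun _ : Fin n => R) R).symm ≪≫ₗ
        LinearEquiv.piCongrRight (fun _ => LinearMap.ringLmapEquivSelf R R J))).2
        (LC_pi a (LC_inj a 0 J) n)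
    refine (LC_one_iff a (LinearMap.lcomp R J p) (LinearMap.lcomp R J K.subtype) ?_ ?_ ?_ hF).2 ?_
    · intro x y h
      exact (LinearMap.cancel_right hp).1 h
    · intro φ
      constructor
      · intro h
        obtain ⟨ψ, hψ⟩ : ∃ ψ : N →ₗ[R] J, ∀ x, ψ (p x) = φ x :=
          inj_factor p φ (fun x hx => LinearMap.congr_fun h ⟨x, hx⟩)
        exact ⟨ψ, LinearMap.ext hψ⟩
      · rintro ⟨ψ, rfl⟩
        ext x
        have : p x.1 = 0 := x.2
        simp [this]
    · intro φ
      obtain ⟨ψ, hψ⟩ := inj_factor K.subtype φ (fun x hx => by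
        have : x = 0 := Subtype.ext hx
        simp [this])
      exact ⟨ψ, LinearMap.ext hψ⟩
    · rintro φ ⟨t, ht⟩
      obtain ⟨k, hk⟩ := Ideal.exists_pow_inf_eq_pow_smul a K
      have hk := hk (k + t) (by simp)
      rw [Nat.add_sub_cancel_left] at hk
      have hφ : ∀ x ∈ a ^ t • (⊤ : Submodule R K), φ x = 0 := by
        intro x hx
        induction hx using Submodule.smul_induction_on' with
        | smul r hr n hn =>
          rw [map_smul]
          exact LinearMap.congr_fun (ht r hr) n
        | add x _ y _ hx hy => rw [map_add, hx, hy, add_zero]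
      obtain ⟨ψ, hψ⟩ := inj_factor ((a ^ (k+t) • (⊤ : Submodule R (Fin n → R))).mkQ ∘ₗ K.subtype) φ (by
        intro x hx
        have hx : (x : Fin n → R) ∈ a ^ (k+t) • (⊤ : Submodule R (Fin n → R)) := by
          simpa using hx
        have hx2 : (x : Fin n → R) ∈ a ^ t • (a ^ k • ⊤ ⊓ K) := hk ▸ ⟨hx, x.2⟩
        have hx3 : (x : Fin n → R) ∈ a ^ t • K := Submodule.smul_mono le_rfl inf_le_right hx2
        apply hφ
        have : a ^ t • K = Submodule.map K.subtype (a ^ t • ⊤) := by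
          rw [Submodule.map_smul'']; simp
        rw [this] at hx3
        obtain ⟨y, hy, hxy⟩ := hx3
        have : y = x := Subtype.ext hxy
        exact this ▸ hy)
      refine ⟨ψ ∘ₗ (a ^ (k+t) • (⊤ : Submodule R (Fin n → R))).mkQ, ⟨k + t, ?_⟩, LinearMap.ext hψ⟩
      intro r hr
      ext1 
      ext
      simp only [LinearMap.coe_comp, Function.comp_apply, LinearMap.smul_apply, LinearMap.zero_apply]
      rw [← map_smul, ← map_smul, ← map_zero ψ]
      congr 1
      rw [Submodule.mkQ_apply, Submodule.Quotient.mk_eq_zero]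
      exact Submodule.smul_mem_smul hr trivial
  | succ j ih =>
    intro N _ _ _
    obtain ⟨n, p, hp⟩ := Module.Finite.exists_fin' R N
    let K := LinearMap.ker p
    have hF : LC a (j+1+1) ((Fin n → R) →ₗ[R] J) :=
      (LC_equiv a ((LinearMap.lsum R (fun _ : Fin n => R) R).symm ≪≫ₗ
        LinearEquiv.piCongrRight (fun _ => LinearMap.ringLmapEquivSelf R R J))).2
        (LC_pi a (LC_inj a (j+1) J) n)
    refine (LC_left a (LinearMap.lcomp R J p) (LinearMap.lcomp R J K.subtype) ?_ ?_ ?_ _ (ih _) hF)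
    · intro x y h
      exact (LinearMap.cancel_right hp).1 h
    · intro φ
      constructor
      · intro h
        obtain ⟨ψ, hψ⟩ : ∃ ψ : N →ₗ[R] J, ∀ x, ψ (p x) = φ x :=
          inj_factor p φ (fun x hx => LinearMap.congr_fun h ⟨x, hx⟩)
        exact ⟨ψ, LinearMap.ext hψ⟩
      · rintro ⟨ψ, rfl⟩
        ext x
        have : p x.1 = 0 := x.2
        simp [this]
    · intro φ
      obtain ⟨ψ, hψ⟩ := inj_factor K.subtype φ (fun x hx => by
        have : x = 0 := Subtype.ext hx
        simp [this])
      exact ⟨ψ, LinearMap.ext hψ⟩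

/-- coinduced module -/
def Coind (R T J : Type u) [CommRing R] [CommRing T] [Algebra R T] [AddCommGroup J] [Module R J] :
    Type u := T →ₗ[R] J

namespace Coind
variable (R T J : Type u) [CommRing R] [CommRing T] [Algebra R T] [AddCommGroup J] [Module R J]

instance : AddCommGroup (Coind R T J) := inferInstanceAs (AddCommGroup (T →ₗ[R] J))
instance : Module R (Coind R T J) := inferInstanceAs (Module R (T →ₗ[R] J))
instance : SMul T (Coind R T J) := ⟨fun t f => LinearMap.comp (f : T →ₗ[R] J) (LinearMap.mulLeft R t)⟩

variable {R T J}
/-- constructor -/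
def mk (f : T →ₗ[R] J) : Coind R T J := f
/-- projection -/
def fn (f : Coind R T J) : T →ₗ[R] J := f

@[ext] lemma ext {f g : Coind R T J} (h : ∀ s, f.fn s = g.fn s) : f = g := LinearMap.ext h
@[simp] lemma fn_mk (f : T →ₗ[R] J) : (mk f).fn = f := rfl
@[simp] lemma smul_fn (t : T) (f : Coind R T J) (s : T) : (t • f).fn s = f.fn (t * s) := rfl
@[simp] lemma rsmul_fn (t : R) (f : Coind R T J) (s : T) : (t • f).fn s = t • f.fn s := rfl
@[simp] lemma add_fn (f g : Coind R T J) (s : T) : (f + g).fn s = f.fn s + g.fn s := rfl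
@[simp] lemma zero_fn (s : T) : (0 : Coind R T J).fn s = 0 := rfl

instance : Module T (Coind R T J) where
  one_smul f := by ext; simp
  mul_smul x y f := by
    ext s; simp only [smul_fn]; congr 1; ring
  smul_zero _ := by ext; simp
  smul_add _ _ _ := by ext; simp
  add_smul _ _ _ := by ext; simp [add_mul]
  zero_smul _ := by ext; simp

instance : IsScalarTower R T (Coind R T J) where
  smul_assoc r t f := by ext s; simp

/-- adjunction -/
def lift {M : Type u} [AddCommGroup M] [Module R M] [Module T M] [IsScalarTower R T M]
    (f : M →ₗ[R] J) : M →ₗ[T] Coind R T J where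
  toFun m := mk (f ∘ₗ (LinearMap.toSpanSingleton T M m).restrictScalars R)
  map_add' x y := by ext; simp
  map_smul' x y := by ext; simp [smul_smul, mul_comm]

lemma lift_fn {M : Type u} [AddCommGroup M] [Module R M] [Module T M] [IsScalarTower R T M]
    (f : M →ₗ[R] J) (m : M) (s : T) : (lift f m).fn s = f (s • m) := rfl

/-- counit -/
def ev : Coind R T J →ₗ[R] J where
  toFun f := f.fn 1
  map_add' _ _ := rfl
  map_smul' _ _ := rfl

lemma injective [Module.Injective R J] : Module.Injective T (Coind R T J) where
  out X Y _ _ _ _ f hf g := by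
    let _ : Module R X := Module.compHom X (algebraMap R T)
    let _ : Module R Y := Module.compHom Y (algebraMap R T)
    have : IsScalarTower R T X := IsScalarTower.of_algebraMap_smul (fun _ _ => rfl)
    have : IsScalarTower R T Y := IsScalarTower.of_algebraMap_smul (fun _ _ => rfl)
    obtain ⟨h, hh⟩ := Module.Injective.out (R := R) (Q := J) (f.restrictScalars R) hf
      (ev ∘ₗ g.restrictScalars R)
    refine ⟨lift h, fun x => ?_⟩
    ext s
    rw [lift_fn, ← map_smul]
    refine (hh (s • x)).trans ?_
    change (g (s • x)).fn 1 = _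
    simp

end Coind

lemma LC_coind [IsNoetherianRing R] (a : Ideal R) (j : ℕ) (T J : Type u) [CommRing T] [Algebra R T]
    [Module.Finite R T] [AddCommGroup J] [Module R J] [Module.Injective R J] :
    LC a (j+1) (Coind R T J) := LC_hom_aux a J j T

lemma LC_inj_restrict [IsNoetherianRing R] (a : Ideal R) (j : ℕ) (T I : Type u) [CommRing T] [Algebra R T]
    [Module.Finite R T] [AddCommGroup I] [Module R I] [Module T I] [IsScalarTower R T I]
    [Module.Injective T I] : LC a (j+1) I := by
  obtain ⟨J, _, _, _, ι, hι⟩ := exists_inj_embed R I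
  have hinj : Function.Injective (Coind.lift (T := T) ι) := by
    intro x y h
    apply hι
    simpa [Coind.lift_fn] using congrArg (fun f => f.fn (1:T)) h
  obtain ⟨r, hr⟩ := Module.Injective.out (R := T) (Q := I) _ hinj LinearMap.id
  exact LC_retract a ((Coind.lift (T := T) ι).restrictScalars R) (r.restrictScalars R)
    (LinearMap.ext hr) (LC_coind a j T J)

lemma tors_map (a : Ideal R) (T M : Type u) [CommRing T] [Algebra R T]
    [AddCommGroup M] [Module R M] [Module T M] [IsScalarTower R T M] :
    tors (a.map (algebraMap R T)) M = tors a M := by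
  ext m
  constructor
  · rintro ⟨t, ht⟩
    refine ⟨t, fun r hr => ?_⟩
    rw [← algebraMap_smul T r m]
    apply ht
    rw [← Ideal.map_pow]
    exact Ideal.mem_map_of_mem _ hr
  · rintro ⟨t, ht⟩
    refine ⟨t, fun r hr => ?_⟩
    rw [← Ideal.map_pow] at hr
    have : a ^ t ≤ Ideal.comap (algebraMap R T) (LinearMap.ker (LinearMap.toSpanSingleton T M m)) := by
      intro r hr
      simp [algebraMap_smul, ht r hr]
    have := Ideal.map_le_iff_le_comap.2 this hr
    simpa using this

/-- dimension shifting -/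
lemma LC_shift (a : Ideal R) {M N P : Type u} [AddCommGroup M] [Module R M] [AddCommGroup N] [Module R N]
    [AddCommGroup P] [Module R P] (f : M →ₗ[R] N) (g : N →ₗ[R] P) (hf : Function.Injective f)
    (hfg : Function.Exact f g) (hg : Function.Surjective g) (hN : ∀ j, LC a (j+1) N) (i : ℕ) :
    LC a (i+2) M ↔ LC a (i+1) P :=
  ⟨fun h => LC_right a f g hf hfg hg (i+1) (hN i) h,
   fun h => LC_left a f g hf hfg hg (i+1) h (hN (i+1))⟩

lemma LC_map [IsNoetherianRing R] (a : Ideal R) (T : Type u) [CommRing T] [Algebra R T]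
    [Module.Finite R T] (i : ℕ) : ∀ (M : Type u) [AddCommGroup M] [Module R M] [Module T M]
    [IsScalarTower R T M], LC (a.map (algebraMap R T)) i M ↔ LC a i M := by
  induction i with
  | zero =>
    intro M _ _ _ _
    rw [LC_zero_iff, LC_zero_iff, tors_map]
  | succ i ih =>
    intro M _ _ _ _
    obtain ⟨I, _, _, _, ι, hι⟩ := exists_inj_embed T M
    let _ : Module R I := Module.compHom I (algebraMap R T)
    have : IsScalarTower R T I := IsScalarTower.of_algebraMap_smul (fun _ _ => rfl)
    let P := I ⧸ LinearMap.range ι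
    let g : I →ₗ[T] P := (LinearMap.range ι).mkQ
    have hg : Function.Surjective g := Submodule.mkQ_surjective _
    have hfg : Function.Exact ι g := LinearMap.exact_map_mkQ_range ι
    cases i with
    | zero =>
      rw [zero_add, LC_one_iff (a.map (algebraMap R T)) ι g hι hfg hg (LC_inj _ 0 I),
        LC_one_iff a (ι.restrictScalars R) (g.restrictScalars R) hι hfg hg (LC_inj_restrict a 0 T I),
        tors_map, tors_map]
      rfl
    | succ i =>
      rw [LC_shift (a.map (algebraMap R T)) ι g hι hfg hg (fun j => LC_inj _ j I),
        LC_shift a (ι.restrictScalars R) (g.restrictScalars R) hι hfg hg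
          (fun j => LC_inj_restrict a j T I), ih]


lemma ext_tors [IsNoetherianRing R] (a : Ideal R) {F J : Type u} [AddCommGroup F] [Module R F]
    [Module.Finite R F] [AddCommGroup J] [Module R J] [Module.Injective R J] (K : Submodule R F)
    (φ : K →ₗ[R] J) (t : ℕ) (ht : ∀ r ∈ a ^ t, r • φ = 0) :
    ∃ (ψ : F →ₗ[R] J) (s : ℕ), (∀ r ∈ a ^ s, r • ψ = 0) ∧ ∀ x : K, ψ x = φ x := by
  obtain ⟨k, hk⟩ := Ideal.exists_pow_inf_eq_pow_smul a K
  have hk := hk (k + t) (by simp)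
  rw [Nat.add_sub_cancel_left] at hk
  have hφ : ∀ x ∈ a ^ t • (⊤ : Submodule R K), φ x = 0 := by
    intro x hx
    induction hx using Submodule.smul_induction_on' with
    | smul r hr n hn =>
      rw [map_smul]
      exact LinearMap.congr_fun (ht r hr) n
    | add x _ y _ hx hy => rw [map_add, hx, hy, add_zero]
  obtain ⟨ψ, hψ⟩ := inj_factor ((a ^ (k+t) • (⊤ : Submodule R F)).mkQ ∘ₗ K.subtype) φ (by
    intro x hx
    have hx : (x : F) ∈ a ^ (k+t) • (⊤ : Submodule R F) := by
      simpa using hx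
    have hx2 : (x : F) ∈ a ^ t • (a ^ k • ⊤ ⊓ K) := hk ▸ ⟨hx, x.2⟩
    have hx3 : (x : F) ∈ a ^ t • K := Submodule.smul_mono le_rfl inf_le_right hx2
    apply hφ
    have : a ^ t • K = Submodule.map K.subtype (a ^ t • ⊤) := by
      rw [Submodule.map_smul'']; simp
    rw [this] at hx3
    obtain ⟨y, hy, hxy⟩ := hx3
    have : y = x := Subtype.ext hxy
    exact this ▸ hy)
  refine ⟨ψ ∘ₗ (a ^ (k+t) • (⊤ : Submodule R F)).mkQ, k + t, ?_, hψ⟩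
  intro r hr
  ext y
  simp only [LinearMap.coe_comp, Function.comp_apply, LinearMap.smul_apply, LinearMap.zero_apply]
  rw [← map_smul, ← map_smul, ← map_zero ψ]
  congr 1
  rw [Submodule.mkQ_apply, Submodule.Quotient.mk_eq_zero]
  exact Submodule.smul_mem_smul hr trivial

/-- torsion submodule -/
def Gam (a : Ideal R) (M : Type u) [AddCommGroup M] [Module R M] : Submodule R M where
  carrier := tors a M
  zero_mem' := ⟨0, by simp⟩
  add_mem' := by
    rintro x y ⟨t, ht⟩ ⟨s, hs⟩
    refine ⟨max t s, fun r hr => ?_⟩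
    rw [smul_add, ht r (Ideal.pow_le_pow_right (le_max_left _ _) hr),
      hs r (Ideal.pow_le_pow_right (le_max_right _ _) hr), add_zero]
  smul_mem' := by
    rintro c x ⟨t, ht⟩
    refine ⟨t, fun r hr => ?_⟩
    rw [smul_comm, ht r hr, smul_zero]

lemma Gam_fg (a : Ideal R) {M K : Type u} [AddCommGroup M] [Module R M] [AddCommGroup K] [Module R K]
    [Module.Finite R K] (φ : K →ₗ[R] M) (h : ∀ x, φ x ∈ tors a M) :
    ∃ t : ℕ, ∀ r ∈ a ^ t, r • φ = 0 := by
  obtain ⟨S, hS⟩ := Module.Finite.fg_top (R := R) (M := K)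
  choose f hf using h
  refine ⟨S.sup f, fun r hr => ?_⟩
  apply LinearMap.ext_on hS
  intro x hx
  simp only [LinearMap.smul_apply, LinearMap.zero_apply]
  exact hf x r (Ideal.pow_le_pow_right (Finset.le_sup hx) hr)

lemma Gam_inj [IsNoetherianRing R] (a : Ideal R) (J : Type u) [AddCommGroup J] [Module R J]
    [Module.Injective R J] : Module.Injective R (Gam a J) := by
  apply Module.Baer.injective
  intro I g
  obtain ⟨t, ht⟩ := Gam_fg a ((Gam a J).subtype ∘ₗ g) (fun x => (g x).2)
  obtain ⟨ψ, s, hs, hψ⟩ := ext_tors a I ((Gam a J).subtype ∘ₗ g) t ht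
  refine ⟨ψ.codRestrict (Gam a J) (fun c => ⟨s, fun r hr => LinearMap.congr_fun (hs r hr) c⟩), ?_⟩
  intro x hx
  exact Subtype.ext (hψ ⟨x, hx⟩)

lemma tors_sup (b c : Ideal R) (N : Type u) [AddCommGroup N] [Module R N]
    (hN : ∀ n : N, n ∈ tors c N) : tors (b ⊔ c) N = tors b N := by
  ext n
  constructor
  · rintro ⟨t, ht⟩
    exact ⟨t, fun r hr => ht r (Ideal.pow_right_mono le_sup_left t hr)⟩
  · rintro ⟨t, ht⟩
    obtain ⟨s, hs⟩ := hN n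
    refine ⟨t + s, fun r hr => ?_⟩
    obtain ⟨y, hy, z, hz, rfl⟩ := Submodule.mem_sup.1 (Ideal.sup_pow_add_le_pow_sup_pow hr)
    rw [add_smul, ht y hy, hs z hz, add_zero]

lemma LC_sup [IsNoetherianRing R] (b c : Ideal R) (i : ℕ) :
    ∀ (M : Type u) [AddCommGroup M] [Module R M], (∀ n : M, n ∈ tors c M) →
    (LC (b ⊔ c) i M ↔ LC b i M) := by
  induction i with
  | zero =>
    intro M _ _ hM
    rw [LC_zero_iff, LC_zero_iff, tors_sup _ _ _ hM]
  | succ i ih =>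
    intro M _ _ hM
    obtain ⟨J, _, _, _, ι', hι'⟩ := exists_inj_embed R M
    let I := Gam c J
    have : Module.Injective R I := Gam_inj c J
    let ι : M →ₗ[R] I := ι'.codRestrict _ (fun m => by
      obtain ⟨t, ht⟩ := hM m
      exact ⟨t, fun r hr => by rw [← map_smul, ht r hr, map_zero]⟩)
    have hι : Function.Injective ι := by
      intro x y h
      exact hι' (congrArg Subtype.val h)
    let P := I ⧸ LinearMap.range ι
    let g : I →ₗ[R] P := (LinearMap.range ι).mkQ
    have hg : Function.Surjective g := Submodule.mkQ_surjective _
    have hfg : Function.Exact ι g := LinearMap.exact_map_mkQ_range ι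
    have hI : ∀ n : I, n ∈ tors c I := by
      rintro ⟨n, t, ht⟩
      exact ⟨t, fun r hr => Subtype.ext (ht r hr)⟩
    have hP : ∀ n : P, n ∈ tors c P := by
      intro n
      obtain ⟨n, rfl⟩ := hg n
      obtain ⟨t, ht⟩ := hI n
      exact ⟨t, fun r hr => by rw [← map_smul, ht r hr, map_zero]⟩
    cases i with
    | zero =>
      rw [zero_add, LC_one_iff (b ⊔ c) ι g hι hfg hg (LC_inj _ 0 I),
        LC_one_iff b ι g hι hfg hg (LC_inj _ 0 I), tors_sup _ _ _ hI, tors_sup _ _ _ hP]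
    | succ i =>
      rw [LC_shift (b ⊔ c) ι g hι hfg hg (fun j => LC_inj _ j I),
        LC_shift b ι g hι hfg hg (fun j => LC_inj _ j I), ih P hP]

lemma LC_unit (a : Ideal R) (x : R) (hx : x ∈ a) (i : ℕ) (N : Type u) [AddCommGroup N] [Module R N]
    (hu : IsUnit (algebraMap R (Module.End R N) x)) : LC a i N := by
  intro t e
  refine ⟨t, le_rfl, ?_⟩
  have hu := hu.pow t
  rw [← map_pow] at hu
  obtain ⟨v, hv⟩ := hu.exists_right_inv
  have h1 : e = x ^ t • (e.comp (Abelian.Ext.mk₀ (ModuleCat.ofHom v)) (add_zero i)) := by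
    rw [← Abelian.Ext.comp_smul, ← Abelian.Ext.mk₀_smul]
    have : x ^ t • ModuleCat.ofHom v = 𝟙 (ModuleCat.of R N) := by
      refine ModuleCat.hom_ext (LinearMap.ext fun n => ?_)
      exact LinearMap.congr_fun hv n
    rw [this, Abelian.Ext.comp_mk₀_id]
  have h2 : e = 0 := by
    rw [h1]
    generalize e.comp (Abelian.Ext.mk₀ (ModuleCat.ofHom v)) (add_zero i) = e'
    have h3 : x ^ t • 𝟙 (ModuleCat.of R (R ⧸ a ^ t)) = 0 := by
      refine ModuleCat.hom_ext (LinearMap.ext fun n => ?_)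
      change x ^ t • n = 0
      obtain ⟨n, rfl⟩ := Submodule.Quotient.mk_surjective _ n
      rw [← Submodule.Quotient.mk_smul, Submodule.Quotient.mk_eq_zero]
      exact Ideal.mul_mem_right _ _ (Ideal.pow_mem_pow hx t)
    rw [← Abelian.Ext.mk₀_id_comp e', ← Abelian.Ext.smul_comp, ← Abelian.Ext.mk₀_smul, h3,
      Abelian.Ext.mk₀_zero, Abelian.Ext.zero_comp]
  rw [h2, Abelian.Ext.comp_zero]

lemma mem_tors_span (x : R) {M : Type u} [AddCommGroup M] [Module R M] {m : M} {k : ℕ}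
    (h : x ^ k • m = 0) : m ∈ tors (Ideal.span {x}) M := by
  refine ⟨k, fun r hr => ?_⟩
  rw [Ideal.span_singleton_pow, Ideal.mem_span_singleton'] at hr
  obtain ⟨y, rfl⟩ := hr
  rw [mul_smul, h, smul_zero]

lemma LC_bound_step [IsNoetherianRing R] (b : Ideal R) (x : R) (n : ℕ)
    (hb : ∀ i, n < i → ∀ (M : Type u) [AddCommGroup M] [Module R M], LC b i M) (i : ℕ) (hi : n + 1 < i)
    (M : Type u) [AddCommGroup M] [Module R M] : LC (b ⊔ Ideal.span {x}) i M := by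
  let S := Submonoid.powers x
  let Mx := LocalizedModule S M
  let f : M →ₗ[R] Mx := LocalizedModule.mkLinearMap S M
  obtain ⟨i, rfl⟩ : ∃ j, i = j + 1 := ⟨i - 1, by omega⟩
  have hker : LC (b ⊔ Ideal.span {x}) (i+1) (LinearMap.ker f) := by
    rw [LC_sup]
    · exact hb _ (by omega) _
    · rintro ⟨m, hm⟩
      obtain ⟨⟨_, k, rfl⟩, hk⟩ := (IsLocalizedModule.eq_zero_iff S f).1 hm
      exact mem_tors_span x (k := k) (Subtype.ext hk)
  have hQ : LC (b ⊔ Ideal.span {x}) i (Mx ⧸ LinearMap.range f) := by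
    rw [LC_sup]
    · exact hb _ (by omega) _
    · intro q
      obtain ⟨y, rfl⟩ := Submodule.Quotient.mk_surjective _ q
      obtain ⟨⟨m, ⟨_, k, rfl⟩⟩, hk⟩ := IsLocalizedModule.surj S f y
      refine mem_tors_span x (k := k) ?_
      rw [← Submodule.Quotient.mk_smul, Submodule.Quotient.mk_eq_zero]
      exact ⟨m, hk.symm⟩
  have hMx : LC (b ⊔ Ideal.span {x}) (i+1) Mx :=
    LC_unit _ x (Ideal.mem_sup_right (Ideal.mem_span_singleton_self x)) _ _
      (IsLocalizedModule.map_units f (⟨x, Submonoid.mem_powers x⟩ : S))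
  have hr : LC (b ⊔ Ideal.span {x}) (i+1) (LinearMap.range f) :=
    LC_left _ (LinearMap.range f).subtype (LinearMap.range f).mkQ
      (Submodule.injective_subtype _) (LinearMap.exact_subtype_mkQ _)
      (Submodule.mkQ_surjective _) _ hQ hMx
  refine LC_mid _ (LinearMap.ker f).subtype f.rangeRestrict (Submodule.injective_subtype _)
    ?_ f.surjective_rangeRestrict _ hker hr
  intro y
  constructor
  · intro h
    exact ⟨⟨y, congrArg Subtype.val h⟩, rfl⟩
  · rintro ⟨y, rfl⟩
    exact Subtype.ext y.2

lemma LC_bot (i : ℕ) (M : Type u) [AddCommGroup M] [Module R M] : LC (⊥ : Ideal R) (i+1) M := by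
  intro t e
  refine ⟨t+1, by omega, ?_⟩
  have h : (⊥ : Ideal R) ^ (t+1) = ⊥ := by
    rw [pow_succ, Ideal.mul_bot]
  have : Module.Projective R (R ⧸ (⊥ : Ideal R) ^ (t+1)) :=
    Module.Projective.of_equiv (Submodule.quotEquivOfEqBot _ h).symm
  have : Projective (ModuleCat.of R (R ⧸ (⊥ : Ideal R) ^ (t+1))) :=
    (IsProjective.iff_projective _).1 this
  exact Abelian.Ext.eq_zero_of_projective _

lemma LC_bound [IsNoetherianRing R] (a : Ideal R) :
    ∃ n : ℕ, ∀ i, n < i → ∀ (M : Type u) [AddCommGroup M] [Module R M], LC a i M := by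
  classical
  obtain ⟨s, rfl⟩ := IsNoetherian.noetherian a
  induction s using Finset.induction_on with
  | empty =>
    refine ⟨0, fun i hi M _ _ => ?_⟩
    obtain ⟨i, rfl⟩ : ∃ j, i = j + 1 := ⟨i - 1, by omega⟩
    rw [Finset.coe_empty, Submodule.span_empty]
    exact LC_bot i M
  | insert x s _ ih =>
    obtain ⟨n, hn⟩ := ih
    refine ⟨n + 1, fun i hi M _ _ => ?_⟩
    rw [Finset.coe_insert, Submodule.span_insert, sup_comm]
    exact LC_bound_step _ x n hn i hi M

lemma LC_fg [IsNoetherianRing R] (a : Ideal R) (n : ℕ) (h : ∀ i, n ≤ i → LC a i R) (i : ℕ) (hi : n ≤ i)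
    (M : Type u) [AddCommGroup M] [Module R M] [Module.Finite R M] : LC a i M := by
  obtain ⟨N, hN⟩ := LC_bound a
  have key : ∀ k i, n ≤ i → N < i + k → ∀ (M : Type u) [AddCommGroup M] [Module R M]
      [Module.Finite R M], LC a i M := by
    intro k
    induction k with
    | zero => intro i _ h2 M _ _ _; exact hN i h2 M
    | succ k ih =>
      intro i h1 h2 M _ _ _
      obtain ⟨m, p, hp⟩ := Module.Finite.exists_fin' R M
      exact LC_right a (LinearMap.ker p).subtype p (Submodule.injective_subtype _)
        (LinearMap.exact_subtype_ker_map p) hp i (LC_pi a (h i h1) m)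
        (ih (i+1) (by omega) (by omega) _)
  exact key (N+1) i hi (by omega) M


/-- vanishing of Ext -/
abbrev EV (R : Type u) [CommRing R] (X Y : Type u) [AddCommGroup X] [Module R X] [AddCommGroup Y]
    [Module R Y] (i : ℕ) : Prop :=
  Subsingleton (Abelian.Ext (ModuleCat.of R X) (ModuleCat.of R Y) i)

section
variable {X X' Y Y' : Type u} [AddCommGroup X] [Module R X] [AddCommGroup Y] [Module R Y]
  [AddCommGroup X'] [Module R X'] [AddCommGroup Y'] [Module R Y']

lemma EV_zero_iff : EV R X Y 0 ↔ ∀ f : X →ₗ[R] Y, f = 0 := by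
  constructor
  · intro h f
    have := Subsingleton.elim (Abelian.Ext.mk₀ (ModuleCat.ofHom f)) 0
    rw [Abelian.Ext.mk₀_eq_zero_iff] at this
    exact congrArg ModuleCat.Hom.hom this
  · intro h
    refine subsingleton_of_forall_eq 0 fun e => ?_
    obtain ⟨f, rfl⟩ := (Abelian.Ext.mk₀_bijective _ _).2 e
    rw [Abelian.Ext.mk₀_eq_zero_iff]
    exact ModuleCat.hom_ext (h f.hom)

lemma EV_retract_left {i : ℕ} (f : X →ₗ[R] X') (g : X' →ₗ[R] X) (h : g ∘ₗ f = LinearMap.id)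
    (hX : EV R X' Y i) : EV R X Y i := by
  refine subsingleton_of_forall_eq 0 fun e => ?_
  have : e = (Abelian.Ext.mk₀ (ModuleCat.ofHom f)).comp
      ((Abelian.Ext.mk₀ (ModuleCat.ofHom g)).comp e (zero_add i)) (zero_add i) := by
    rw [Abelian.Ext.mk₀_comp_mk₀_assoc, ← ModuleCat.ofHom_comp, h]
    exact (Abelian.Ext.mk₀_id_comp e).symm
  rw [this, Subsingleton.elim ((Abelian.Ext.mk₀ (ModuleCat.ofHom g)).comp e (zero_add i)) 0,
    Abelian.Ext.comp_zero]

lemma EV_retract_right {i : ℕ} (f : Y →ₗ[R] Y') (g : Y' →ₗ[R] Y) (h : g ∘ₗ f = LinearMap.id)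
    (hX : EV R X Y' i) : EV R X Y i := by
  refine subsingleton_of_forall_eq 0 fun e => ?_
  have : e = (e.comp (Abelian.Ext.mk₀ (ModuleCat.ofHom f)) (add_zero i)).comp
      (Abelian.Ext.mk₀ (ModuleCat.ofHom g)) (add_zero i) := by
    rw [Abelian.Ext.comp_assoc_of_third_deg_zero, Abelian.Ext.mk₀_comp_mk₀, ← ModuleCat.ofHom_comp, h]
    exact (Abelian.Ext.comp_mk₀_id e).symm
  rw [this, Subsingleton.elim (e.comp (Abelian.Ext.mk₀ (ModuleCat.ofHom f)) (add_zero i)) 0,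
    Abelian.Ext.zero_comp]

lemma EV_equiv_left {i : ℕ} (f : X ≃ₗ[R] X') : EV R X Y i ↔ EV R X' Y i :=
  ⟨EV_retract_left f.symm.toLinearMap f.toLinearMap (by ext; simp),
   EV_retract_left f.toLinearMap f.symm.toLinearMap (by ext; simp)⟩

lemma EV_equiv_right {i : ℕ} (f : Y ≃ₗ[R] Y') : EV R X Y i ↔ EV R X Y' i :=
  ⟨EV_retract_right f.symm.toLinearMap f.toLinearMap (by ext; simp),
   EV_retract_right f.toLinearMap f.symm.toLinearMap (by ext; simp)⟩

lemma EV_prod {i : ℕ} : EV R (X × X') Y i ↔ EV R X Y i ∧ EV R X' Y i := by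
  refine ⟨fun h => ⟨EV_retract_left (LinearMap.inl R X X') (LinearMap.fst R X X') (by ext; simp) h,
    EV_retract_left (LinearMap.inr R X X') (LinearMap.snd R X X') (by ext; simp) h⟩, ?_⟩
  rintro ⟨h1, h2⟩
  refine subsingleton_of_forall_eq 0 fun e => ?_
  have hid : ModuleCat.ofHom (LinearMap.fst R X X') ≫ ModuleCat.ofHom (LinearMap.inl R X X') +
      ModuleCat.ofHom (LinearMap.snd R X X') ≫ ModuleCat.ofHom (LinearMap.inr R X X') =
      𝟙 (ModuleCat.of R (X × X')) := by
    refine ModuleCat.hom_ext (LinearMap.ext fun p => ?_)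
    change ((p.1, (0 : X')) + ((0 : X), p.2) : X × X') = p
    simp
  rw [← Abelian.Ext.mk₀_id_comp e, ← hid, Abelian.Ext.mk₀_add, Abelian.Ext.add_comp,
    ← Abelian.Ext.mk₀_comp_mk₀_assoc, ← Abelian.Ext.mk₀_comp_mk₀_assoc,
    Subsingleton.elim ((Abelian.Ext.mk₀ (ModuleCat.ofHom (LinearMap.inl R X X'))).comp e (zero_add i)) 0,
    Subsingleton.elim ((Abelian.Ext.mk₀ (ModuleCat.ofHom (LinearMap.inr R X X'))).comp e (zero_add i)) 0]
  simp
end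

lemma EV_inj {X J : Type u} [AddCommGroup X] [Module R X] [AddCommGroup J] [Module R J]
    [Module.Injective R J] (i : ℕ) : EV R X J (i+1) := by
  have : Injective (ModuleCat.of R J) := Module.injective_object_of_injective_module R J
  exact Abelian.Ext.subsingleton_of_injective _ _ _

section
variable {X M N P : Type u} [AddCommGroup X] [Module R X] [AddCommGroup M] [Module R M]
  [AddCommGroup N] [Module R N] [AddCommGroup P] [Module R P]

lemma EV_one_iff (f : M →ₗ[R] N) (g : N →ₗ[R] P) (hf : Function.Injective f)
    (hfg : Function.Exact f g) (hg : Function.Surjective g)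
    (hN : EV R X N 1) :
    EV R X M 1 ↔ ∀ p : X →ₗ[R] P, ∃ n : X →ₗ[R] N, g ∘ₗ n = p := by
  have hS := ses_se f g hf hfg hg
  constructor
  · intro h p
    obtain ⟨x, hx⟩ := Abelian.Ext.covariant_sequence_exact₃ (ModuleCat.of R X) hS
      (Abelian.Ext.mk₀ (ModuleCat.ofHom p)) rfl (Subsingleton.elim (h := h) _ _)
    obtain ⟨x, rfl⟩ := (Abelian.Ext.mk₀_bijective _ _).2 x
    rw [Abelian.Ext.mk₀_comp_mk₀, (Abelian.Ext.mk₀_bijective _ _).1.eq_iff] at hx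
    exact ⟨x.hom, congrArg ModuleCat.Hom.hom hx⟩
  · intro h
    refine subsingleton_of_forall_eq 0 fun e => ?_
    obtain ⟨x, hx⟩ := Abelian.Ext.covariant_sequence_exact₁ _ hS e (Subsingleton.elim (h := hN) _ _) rfl
    obtain ⟨x, rfl⟩ := (Abelian.Ext.mk₀_bijective _ _).2 x
    obtain ⟨n, hn⟩ := h x.hom
    have : x = ModuleCat.ofHom n ≫ ModuleCat.ofHom g := ModuleCat.hom_ext hn.symm
    rw [← hx, this, ← Abelian.Ext.mk₀_comp_mk₀,
      Abelian.Ext.comp_assoc _ _ _ (zero_add 0) (zero_add 1) (by simp)]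
    have := hS.comp_extClass
    simp only at this
    rw [this, Abelian.Ext.comp_zero]

lemma EV_shift (f : M →ₗ[R] N) (g : N →ₗ[R] P) (hf : Function.Injective f)
    (hfg : Function.Exact f g) (hg : Function.Surjective g)
    (i : ℕ) (hN : EV R X N (i+1)) (hN' : EV R X N (i+2)) :
    EV R X M (i+2) ↔ EV R X P (i+1) := by
  have hS := ses_se f g hf hfg hg
  constructor
  · intro h
    refine subsingleton_of_forall_eq 0 fun e => ?_
    obtain ⟨x, hx⟩ := Abelian.Ext.covariant_sequence_exact₃ _ hS e rfl (Subsingleton.elim (h := h) _ _)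
    rw [← hx, Subsingleton.elim (h := hN) x 0, Abelian.Ext.zero_comp]
  · intro h
    refine subsingleton_of_forall_eq 0 fun e => ?_
    obtain ⟨x, hx⟩ := Abelian.Ext.covariant_sequence_exact₁ _ hS e (Subsingleton.elim (h := hN') _ _) rfl
    rw [← hx, Subsingleton.elim (h := h) x 0, Abelian.Ext.zero_comp]
end

namespace Coind
variable {T D D' : Type u} [CommRing T] [Algebra R T] [AddCommGroup D] [Module R D]
  [AddCommGroup D'] [Module R D']

/-- functoriality -/
def map (T : Type u) [CommRing T] [Algebra R T] (f : D →ₗ[R] D') : Coind R T D →ₗ[T] Coind R T D' where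
  toFun g := mk (f ∘ₗ g.fn)
  map_add' _ _ := by ext; simp
  map_smul' _ _ := by ext; simp

lemma map_fn (f : D →ₗ[R] D') (x : Coind R T D) (s : T) : (map T f x).fn s = f (x.fn s) := rfl
end Coind

lemma EV_coind (T L : Type u) [CommRing T] [Algebra R T] [AddCommGroup L] [Module R L] [Module T L]
    [IsScalarTower R T L] (i : ℕ) : ∀ (D : Type u) [AddCommGroup D] [Module R D],
    (∀ j, EV R T D (j+1)) → (EV T L (Coind R T D) i ↔ EV R L D i) := by
  induction i with
  | zero =>
    intro D _ _ _
    rw [EV_zero_iff, EV_zero_iff]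
    constructor
    · intro h f
      ext x
      have := congrArg (fun φ : L →ₗ[T] Coind R T D => (φ x).fn 1) (h (Coind.lift f))
      simpa [Coind.lift_fn] using this
    · intro h f
      ext x s
      have := LinearMap.congr_fun (h (Coind.ev ∘ₗ f.restrictScalars R)) (s • x)
      have h2 : (f (s • x)).fn 1 = 0 := this
      simpa using h2
  | succ i ih =>
    intro D _ _ hD
    obtain ⟨J, _, _, _, ι, hι⟩ := exists_inj_embed R D
    let P := J ⧸ LinearMap.range ι
    let g : J →ₗ[R] P := (LinearMap.range ι).mkQ
    have hg : Function.Surjective g := Submodule.mkQ_surjective _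
    have hfg : Function.Exact ι g := LinearMap.exact_map_mkQ_range ι
    have hlift := (EV_one_iff (X := T) ι g hι hfg hg (EV_inj 0)).1 (hD 0)
    have hP : ∀ j, EV R T P (j+1) := fun j =>
      (EV_shift ι g hι hfg hg j (EV_inj j) (EV_inj (j+1))).1 (hD (j+1))
    have : Module.Injective T (Coind R T J) := Coind.injective
    have hι' : Function.Injective (Coind.map T ι) := by
      intro x y h
      ext s
      exact hι (congrArg (fun φ => φ.fn s) h)
    have hg' : Function.Surjective (Coind.map T g) := by
      intro p
      obtain ⟨n, hn⟩ := hlift p.fn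
      exact ⟨Coind.mk n, hn⟩
    have hfg' : Function.Exact (Coind.map T ι) (Coind.map T g) := by
      intro y
      constructor
      · intro h
        have h1 : ∀ s, ∃ d, ι d = y.fn s := fun s =>
          (hfg _).1 (congrArg (fun φ => φ.fn s) h)
        choose d hd using h1
        refine ⟨Coind.mk ⟨⟨d, fun x y => hι ?_⟩, fun x y => hι ?_⟩, ?_⟩
        · simp [hd]
        · simp [hd]
        · ext s
          exact hd s
      · rintro ⟨x, rfl⟩
        ext s
        exact hfg.apply_apply_eq_zero _
    cases i with
    | zero =>
      rw [zero_add, EV_one_iff _ _ hι' hfg' hg' (EV_inj 0), EV_one_iff _ _ hι hfg hg (EV_inj 0)]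
      constructor
      · intro h p
        obtain ⟨n, hn⟩ := h (Coind.lift p)
        refine ⟨Coind.ev ∘ₗ n.restrictScalars R, ?_⟩
        ext x
        have := congrArg (fun φ : L →ₗ[T] Coind R T P => (φ x).fn 1) hn
        simp only [Coind.lift_fn, one_smul] at this
        exact this
      · intro h p
        obtain ⟨n, hn⟩ := h (Coind.ev ∘ₗ p.restrictScalars R)
        refine ⟨Coind.lift n, ?_⟩
        ext x s
        refine (LinearMap.congr_fun hn (s • x)).trans ?_
        change (p (s • x)).fn 1 = _
        simp
    | succ i =>
      rw [EV_shift _ _ hι' hfg' hg' i (EV_inj i) (EV_inj (i+1)),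
        EV_shift _ _ hι hfg hg i (EV_inj i) (EV_inj (i+1)), ih P hP]

lemma cohDim_set (a : Ideal R) (M : Type u) [AddCommGroup M] [Module R M] (i : ℕ) :
    Nontrivial ((localCohomology a i).obj (ModuleCat.of R M)) ↔ ¬ LC a i M := by
  rw [← lc_iff, not_subsingleton_iff_nontrivial]

lemma cohDim_map [IsNoetherianRing R] (a : Ideal R) (T C : Type u) [CommRing T] [Algebra R T]
    [AddCommGroup C] [Module R C] [Module.Finite R C] [Module.Finite R T] (e : T ≃ₗ[R] R × C) :
    cohDim (a.map (algebraMap R T)) T = cohDim a R := by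
  unfold cohDim
  simp only [cohDim_set]
  have hT : ∀ i, LC (a.map (algebraMap R T)) i T ↔ LC a i R ∧ LC a i C := fun i => by
    rw [LC_map, LC_equiv a e, LC_prod]
  apply le_antisymm
  · apply sSup_le
    rintro _ ⟨i, hi, rfl⟩
    have : ¬ ∀ j, i ≤ j → LC a j R := fun h =>
      hi ((hT i).2 ⟨h i le_rfl, LC_fg a i h i le_rfl C⟩)
    push Not at this
    obtain ⟨j, hj, h⟩ := this
    refine le_trans ?_ (le_sSup ⟨j, h, rfl⟩)
    exact Nat.cast_le.2 hj
  · apply sSup_le_sSup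
    apply Set.image_mono
    intro i hi h
    exact hi ((hT i).1 h).1

section triv
variable (R) (C : Type u) [AddCommGroup C] [Module R C] [Module Rᵐᵒᵖ C] [IsCentralScalar R C]

/-- underlying product -/
def trivEquiv : TrivSqZeroExt R C ≃ₗ[R] R × C where
  toFun t := (t.fst, t.snd)
  invFun p := TrivSqZeroExt.inl p.1 + TrivSqZeroExt.inr p.2
  map_add' _ _ := rfl
  map_smul' _ _ := rfl
  left_inv t := TrivSqZeroExt.inl_fst_add_inr_snd_eq t
  right_inv p := by simp

lemma coind_bij (h : Function.Bijective (LinearMap.lsmul R C)) :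
    Function.Bijective (Coind.lift (R := R) (T := TrivSqZeroExt R C) (TrivSqZeroExt.sndHom R C)) := by
  constructor
  · rw [injective_iff_map_eq_zero]
    intro t ht
    have h1 : ∀ s : TrivSqZeroExt R C, (s * t).snd = 0 := fun s =>
      congrArg (fun φ => φ.fn s) ht
    have h2 : t.snd = 0 := by simpa using h1 1
    have h3 : t.fst = 0 := by
      apply h.1
      ext c
      have := h1 (TrivSqZeroExt.inr c)
      simpa using this
    ext
    · exact h3
    · exact h2
  · intro f
    obtain ⟨r, hr⟩ := h.2 (f.fn ∘ₗ TrivSqZeroExt.inrHom R C)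
    refine ⟨TrivSqZeroExt.inl r + TrivSqZeroExt.inr (f.fn 1), ?_⟩
    ext s
    rw [Coind.lift_fn]
    have h4 := LinearMap.congr_fun hr s.snd
    have h5 : f.fn s = s.fst • f.fn 1 + f.fn (TrivSqZeroExt.inr s.snd) := by
      rw [← map_smul, ← map_add]
      congr 1
      ext <;> simp
    rw [h5]
    simp only [LinearMap.lsmul_apply] at h4
    change r • s.snd = f.fn (TrivSqZeroExt.inr s.snd) at h4
    rw [← h4]
    simp

/-- quotient -/
def trivQuot (a : Ideal R) : (TrivSqZeroExt R C ⧸ a.map (algebraMap R (TrivSqZeroExt R C))) ≃ₗ[R]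
    (R ⧸ a) × (C ⧸ (a • (⊤ : Submodule R C))) := by
  let φ : TrivSqZeroExt R C →ₗ[R] (R ⧸ a) × (C ⧸ (a • (⊤ : Submodule R C))) :=
    (LinearMap.prodMap (Submodule.mkQ a) (Submodule.mkQ _)) ∘ₗ (trivEquiv R C).toLinearMap
  have hs : Function.Surjective φ := by
    refine Function.Surjective.comp ?_ (trivEquiv R C).surjective
    exact Function.Surjective.prodMap (Submodule.mkQ_surjective _) (Submodule.mkQ_surjective _)
  have hk : (a.map (algebraMap R (TrivSqZeroExt R C))).restrictScalars R = LinearMap.ker φ := by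
    rw [← Ideal.smul_top_eq_map]
    apply le_antisymm
    · rw [Submodule.smul_le]
      intro r hr t _
      have : φ t ∈ (⊤ : Submodule R _) := trivial
      rw [LinearMap.mem_ker, map_smul]
      have h1 : ∀ x : R ⧸ a, r • x = 0 := by
        intro x
        obtain ⟨x, rfl⟩ := Submodule.Quotient.mk_surjective _ x
        rw [← Submodule.Quotient.mk_smul, Submodule.Quotient.mk_eq_zero]
        exact Ideal.mul_mem_right _ _ hr
      have h2 : ∀ x : C ⧸ (a • (⊤ : Submodule R C)), r • x = 0 := by
        intro x
        obtain ⟨x, rfl⟩ := Submodule.Quotient.mk_surjective _ x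
        rw [← Submodule.Quotient.mk_smul, Submodule.Quotient.mk_eq_zero]
        exact Submodule.smul_mem_smul hr trivial
      exact Prod.ext (h1 _) (h2 _)
    · intro t ht
      have h1 : t.fst ∈ a := (Submodule.Quotient.mk_eq_zero a).1 (congrArg Prod.fst ht)
      have h2 : t.snd ∈ a • (⊤ : Submodule R C) :=
        (Submodule.Quotient.mk_eq_zero _).1 (congrArg Prod.snd ht)
      rw [← TrivSqZeroExt.inl_fst_add_inr_snd_eq t]
      apply Submodule.add_mem
      · have : (TrivSqZeroExt.inl t.fst : TrivSqZeroExt R C) = t.fst • 1 := by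
          ext <;> simp
        rw [this]
        exact Submodule.smul_mem_smul h1 trivial
      · have h3 := Submodule.mem_map_of_mem (f := TrivSqZeroExt.inrHom R C) h2
        rw [Submodule.map_smul''] at h3
        exact Submodule.smul_mono le_rfl le_top h3
  exact (Submodule.Quotient.restrictScalarsEquiv R _).symm ≪≫ₗ
    Submodule.quotEquivOfEq _ _ hk ≪≫ₗ φ.quotKerEquivOfSurjective hs
end triv



end helpers

theorem stmt11 {R : Type u} [CommRing R] [IsNoetherianRing R]
    (a : Ideal R) (ha : a ≠ ⊤)
    (C : Type u) [AddCommGroup C] [Module R C] [Module Rᵐᵒᵖ C] [IsCentralScalar R C] (hC : IsSemidualizing R C) :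
    IsRelGorenstein (a.map (algebraMap R (TrivSqZeroExt R C))) (TrivSqZeroExt R C) ↔
      (IsRelGorenstein a C ∧ ∀ i : ℕ, (i : ℕ∞) ≠ cohDim a R →
        Subsingleton (((Ext R (ModuleCat.{u} R) i).obj
          (Opposite.op (ModuleCat.of R (C ⧸ (a • (⊤ : Submodule R C)))))).obj
          (ModuleCat.of R C))) := by
  obtain ⟨hfin, hbij, hext⟩ := hC
  have : Module.Finite R (TrivSqZeroExt R C) := Module.Finite.equiv (trivEquiv R C).symm
  have hTC : ∀ j, EV R (TrivSqZeroExt R C) C (j+1) := by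
    intro j
    rw [EV_equiv_left (trivEquiv R C), EV_prod]
    refine ⟨?_, (subs_iff _ _ _).1 (hext (j+1) (by omega))⟩
    have : Projective (ModuleCat.of R R) := (IsProjective.iff_projective _).1 inferInstance
    exact Abelian.Ext.subsingleton_of_projective _ _ _
  let eT := LinearEquiv.ofBijective _ (coind_bij R C hbij)
  unfold IsRelGorenstein
  rw [cohDim_map a (TrivSqZeroExt R C) C (trivEquiv R C)]
  simp only [subs_iff]
  have key : ∀ i, EV (TrivSqZeroExt R C)
      (TrivSqZeroExt R C ⧸ a.map (algebraMap R (TrivSqZeroExt R C))) (TrivSqZeroExt R C) i ↔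
      EV R (R ⧸ a) C i ∧ EV R (C ⧸ (a • (⊤ : Submodule R C))) C i := by
    intro i
    rw [EV_equiv_right eT, EV_coind _ _ i C hTC, EV_equiv_left (trivQuot R C a), EV_prod]
  constructor
  · intro h
    exact ⟨fun i hi => ((key i).1 (h i hi)).1, fun i hi => ((key i).1 (h i hi)).2⟩
  · rintro ⟨h1, h2⟩ i hi
    exact (key i).2 ⟨h1 i hi, h2 i hi⟩

end
end

section
/- Let f : R → T be a flat ring homomorphism, 𝔞 a proper ideal of R, and M a finitely generated R-module with T ⊗_R M ≠ (𝔞T)(T ⊗_R M). If M is 𝔞-relative Cohen-Macaulay, then cd(𝔞T, T ⊗_R M) = cd(𝔞, M); if M is 𝔞-relative maximal Cohen-Macaulay, then cd(𝔞T, T) = cd(𝔞, R). -/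
open CategoryTheory TensorProduct

noncomputable section

universe u

namespace FBC
open Limits

section compare
variable {R : Type u} [CommRing R]

/-- the functor whose left derived functors give `Ext` -/
abbrev yo (Y : ModuleCat.{u} R) : ModuleCat.{u} R ⥤ (ModuleCat.{u} R)ᵒᵖ :=
  ((linearYoneda R (ModuleCat.{u} R)).obj Y).rightOp

abbrev kc (Y : ModuleCat.{u} R) (P : ChainComplex (ModuleCat.{u} R) ℕ) :
    ChainComplex (ModuleCat.{u} R)ᵒᵖ ℕ :=
  ((yo Y).mapHomologicalComplex _).obj P

abbrev OldExt (X Y : ModuleCat.{u} R) (n : ℕ) : ModuleCat.{u} R :=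
  ((_root_.Ext R (ModuleCat.{u} R) n).obj (Opposite.op X)).obj Y

abbrev oldMap {X X' : ModuleCat.{u} R} (g : X' ⟶ X) (Y : ModuleCat.{u} R) (n : ℕ) :
    OldExt X Y n ⟶ OldExt X' Y n :=
  ((_root_.Ext R (ModuleCat.{u} R) n).map g.op).app Y

/-- map from the cocycles to `OldExt`. -/
def toOld {X : ModuleCat.{u} R} (P : ProjectiveResolution X) (Y : ModuleCat.{u} R) (n : ℕ) :
    ((kc Y P.complex).opcycles n).unop ⟶ OldExt X Y n :=
  ((P.isoLeftDerivedObj (yo Y) n).hom ≫ (kc Y P.complex).homologyι n).unop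

def toHom {X : ModuleCat.{u} R} (P : ProjectiveResolution X) (Y : ModuleCat.{u} R) (n : ℕ) :
    ((kc Y P.complex).opcycles n).unop ⟶ ModuleCat.of R (P.complex.X n ⟶ Y) :=
  ((kc Y P.complex).pOpcycles n).unop

lemma toOld_surj {X : ModuleCat.{u} R} (P : ProjectiveResolution X) (Y : ModuleCat.{u} R) (n : ℕ) :
    Function.Surjective (toOld P Y n) := by
  have h0 : Mono ((kc Y P.complex).homologyι n) := inferInstance
  have h1 : Mono ((P.isoLeftDerivedObj (yo Y) n).hom ≫ (kc Y P.complex).homologyι n) :=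
    mono_comp' inferInstance h0
  have h2 : Epi (toOld P Y n) := unop_epi_of_mono _
  exact (ModuleCat.epi_iff_surjective _).1 h2

lemma toHom_inj {X : ModuleCat.{u} R} (P : ProjectiveResolution X) (Y : ModuleCat.{u} R) (n : ℕ) :
    Function.Injective (toHom P Y n) := by
  have : Mono ((kc Y P.complex).pOpcycles n).unop := unop_mono_of_epi _
  exact (ModuleCat.mono_iff_injective _).1 this

lemma toHom_exists {X : ModuleCat.{u} R} (P : ProjectiveResolution X) (Y : ModuleCat.{u} R) (n : ℕ)
    (f : P.complex.X n ⟶ Y) (hf : P.complex.d (n+1) n ≫ f = 0) : ∃ z, toHom P Y n z = f := by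
  have h := (ShortComplex.exact_of_g_is_cokernel (ShortComplex.mk _ _
    ((kc Y P.complex).d_pOpcycles (n+1) n))
    ((kc Y P.complex).opcyclesIsCokernel (n+1) n (by simp))).unop
  rw [ShortComplex.ShortExact.moduleCat_exact_iff_function_exact] at h
  exact (h f).1 hf

lemma toHom_cocycle {X : ModuleCat.{u} R} (P : ProjectiveResolution X) (Y : ModuleCat.{u} R)
    (n : ℕ) (z) : P.complex.d (n+1) n ≫ toHom P Y n z = 0 := by
  have h := congrArg Quiver.Hom.unop ((kc Y P.complex).d_pOpcycles (n+1) n)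
  exact congrArg (fun q => q.hom z) h

lemma toOld_eq_zero {X : ModuleCat.{u} R} (P : ProjectiveResolution X) (Y : ModuleCat.{u} R)
    (n : ℕ) (z) : toOld P Y (n+1) z = 0 ↔ ∃ g, P.complex.d (n+1) n ≫ g = toHom P Y (n+1) z := by
  have h := (ShortComplex.exact_of_f_is_kernel (ShortComplex.mk _ _
    ((kc Y P.complex).homologyι_comp_fromOpcycles (n+1) n))
    ((kc Y P.complex).homologyIsKernel (n+1) n (by simp))).unop
  rw [ShortComplex.ShortExact.moduleCat_exact_iff_function_exact] at h
  have h1 : toOld P Y (n+1) z = 0 ↔ ((kc Y P.complex).homologyι (n+1)).unop z = 0 := by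
    have : toOld P Y (n+1) = ((kc Y P.complex).homologyι (n+1)).unop ≫
      (P.isoLeftDerivedObj (yo Y) (n+1)).hom.unop := rfl
    rw [this]
    have hi : Function.Injective ((P.isoLeftDerivedObj (yo Y) (n+1)).hom.unop) := by
      rw [← ModuleCat.mono_iff_injective]; infer_instance
    exact map_eq_zero_iff _ hi
  have h3 : ∀ g, toHom P Y (n+1) (((kc Y P.complex).fromOpcycles (n+1) n).unop g) =
      P.complex.d (n+1) n ≫ g := by
    intro g
    exact congrArg (fun q => q.unop.hom g) ((kc Y P.complex).p_fromOpcycles (n+1) n)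
  rw [h1]
  refine (h z).trans ?_
  constructor
  · rintro ⟨g, hg⟩
    exact ⟨g, by rw [← hg]; exact (h3 g).symm⟩
  · rintro ⟨g, hg⟩
    exact ⟨g, toHom_inj P Y _ ((h3 g).trans hg)⟩

lemma toOld_eq_zero_zero {X : ModuleCat.{u} R} (P : ProjectiveResolution X) (Y : ModuleCat.{u} R)
    (z) : toOld P Y 0 z = 0 ↔ toHom P Y 0 z = 0 := by
  have hi : Function.Injective (toOld P Y 0) := by
    have : IsIso ((kc Y P.complex).homologyι 0) :=
      (kc Y P.complex).isIso_homologyι 0 _ rfl (by simp)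
    have h0 : Epi ((kc Y P.complex).homologyι 0) := inferInstance
    have h1 : Epi ((P.isoLeftDerivedObj (yo Y) 0).hom ≫ (kc Y P.complex).homologyι 0) :=
      epi_comp' inferInstance h0
    have h2 : Mono (toOld P Y 0) := unop_mono_of_epi _
    exact (ModuleCat.mono_iff_injective _).1 h2
  rw [map_eq_zero_iff _ hi, map_eq_zero_iff _ (toHom_inj P Y 0)]

lemma oldMap_toOld {X X' : ModuleCat.{u} R} (P : ProjectiveResolution X)
    (P' : ProjectiveResolution X') (g : X' ⟶ X) (φ : ProjectiveResolution.Hom P' P g)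
    (Y : ModuleCat.{u} R) (n : ℕ) (z) :
    ∃ z', toHom P' Y n z' = φ.hom.f n ≫ toHom P Y n z ∧
      oldMap g Y n (toOld P Y n z) = toOld P' Y n z' := by
  let ψ := ((yo Y).mapHomologicalComplex _).map φ.hom
  refine ⟨(HomologicalComplex.opcyclesMap ψ n).unop z, ?_, ?_⟩
  · exact congrArg (fun q => q.unop.hom z) (HomologicalComplex.p_opcyclesMap ψ n)
  · have h1 := ProjectiveResolution.isoLeftDerivedObj_hom_naturality g P' P φ.hom
      φ.hom_f_zero_comp_π_f_zero (yo Y) n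
    have h2 := HomologicalComplex.homologyι_naturality ψ n
    have h3 : (Functor.leftDerived (yo Y) n).map g ≫ (P.isoLeftDerivedObj (yo Y) n).hom ≫
      (kc Y P.complex).homologyι n = ((P'.isoLeftDerivedObj (yo Y) n).hom ≫
      (kc Y P'.complex).homologyι n) ≫ HomologicalComplex.opcyclesMap ψ n := by
      refine (Category.assoc _ _ _).symm.trans ?_
      refine (congrArg (fun q => q ≫ (kc Y P.complex).homologyι n) h1).trans ?_
      refine (Category.assoc _ _ _).trans ?_
      refine Eq.trans ?_ (Category.assoc _ _ _).symm
      exact congrArg (fun q => (P'.isoLeftDerivedObj (yo Y) n).hom ≫ q) h2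
    exact congrArg (fun q => q.unop.hom z) h3

lemma extMk_zero_iff {X : ModuleCat.{u} R} (P : ProjectiveResolution X) (Y : ModuleCat.{u} R)
    (f : P.complex.X 0 ⟶ Y) (hf : P.complex.d 1 0 ≫ f = 0) :
    P.extMk f 1 rfl hf = 0 ↔ f = 0 := by
  constructor
  · intro h
    rw [← P.extEquivCohomologyClass.apply_eq_iff_eq,
      ProjectiveResolution.extEquivCohomologyClass_extMk,
      ProjectiveResolution.extEquivCohomologyClass_zero,
      CochainComplex.HomComplex.CohomologyClass.mk_eq_zero_iff,
      CochainComplex.HomComplex.Cocycle.toSingleMk_mem_coboundaries_iff _ _ _ _ _ 1 (by simp)] at h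
    obtain ⟨g, hg⟩ := h
    have : IsZero (P.cochainComplex.X 1) := P.cochainComplex.isZero_of_isStrictlyLE 0 1 (by simp)
    rw [this.eq_of_src g 0, comp_zero] at hg
    rw [← cancel_epi (P.cochainComplexXIso (-0) 0 rfl).hom]
    simpa using hg.symm
  · rintro rfl; simp

/-- Relation between old and new Ext classes. -/
def Rel {X Y : ModuleCat.{u} R} {n : ℕ} (x : OldExt X Y n) (α : Abelian.Ext X Y n) : Prop :=
  ∃ z, toOld (projectiveResolution X) Y n z = x ∧
    (projectiveResolution X).extMk (toHom _ Y n z) (n+1) rfl (toHom_cocycle _ _ _ _) = α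

lemma Rel.exists_right {X Y : ModuleCat.{u} R} {n : ℕ} (x : OldExt X Y n) :
    ∃ α : Abelian.Ext X Y n, Rel x α := by
  obtain ⟨z, hz⟩ := toOld_surj _ Y n x
  exact ⟨_, z, hz, rfl⟩

lemma Rel.exists_left {X Y : ModuleCat.{u} R} {n : ℕ} (α : Abelian.Ext X Y n) :
    ∃ x : OldExt X Y n, Rel x α := by
  obtain ⟨f, hf, rfl⟩ := (projectiveResolution X).extMk_surjective α (n+1) rfl
  obtain ⟨z, hz⟩ := toHom_exists _ Y n f hf
  exact ⟨_, z, rfl, by simp [hz]⟩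

lemma Rel.zero_iff {X Y : ModuleCat.{u} R} {n : ℕ} {x : OldExt X Y n} {α : Abelian.Ext X Y n}
    (h : Rel x α) : x = 0 ↔ α = 0 := by
  obtain ⟨z, rfl, rfl⟩ := h
  cases n with
  | zero => rw [toOld_eq_zero_zero, extMk_zero_iff]
  | succ n => rw [toOld_eq_zero, ProjectiveResolution.extMk_eq_zero_iff _ _ _ _ _ n rfl]

lemma Rel.map {X X' Y : ModuleCat.{u} R} {n : ℕ} {x : OldExt X Y n} {α : Abelian.Ext X Y n}
    (h : Rel x α) (g : X' ⟶ X) :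
    Rel (oldMap g Y n x) ((Abelian.Ext.mk₀ g).comp α (zero_add n)) := by
  obtain ⟨z, rfl, rfl⟩ := h
  let φ : ProjectiveResolution.Hom (projectiveResolution X') (projectiveResolution X) g :=
    ⟨ProjectiveResolution.lift g _ _, ProjectiveResolution.lift_commutes_zero g _ _⟩
  obtain ⟨z', h1, h2⟩ := oldMap_toOld _ _ g φ Y n z
  refine ⟨z', h2.symm, ?_⟩
  rw [ProjectiveResolution.mk₀_comp_extMk _ _ _ _ φ]
  simp [h1]

lemma old_nontrivial_iff (X Y : ModuleCat.{u} R) (n : ℕ) :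
    Nontrivial (OldExt X Y n) ↔ Nontrivial (Abelian.Ext X Y n) := by
  rw [nontrivial_iff_exists_ne 0, nontrivial_iff_exists_ne 0]
  constructor
  · rintro ⟨x, hx⟩
    obtain ⟨α, h⟩ := Rel.exists_right x
    exact ⟨α, fun h' => hx (h.zero_iff.2 h')⟩
  · rintro ⟨α, hx⟩
    obtain ⟨x, h⟩ := Rel.exists_left α
    exact ⟨x, fun h' => hx (h.zero_iff.1 h')⟩

/-- the quotient map -/
abbrev qm {I J : Ideal R} (h : I ≤ J) : ModuleCat.of R (R ⧸ I) ⟶ ModuleCat.of R (R ⧸ J) :=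
  ModuleCat.ofHom (Submodule.mapQ _ _ LinearMap.id h)

def LCVanish (a : Ideal R) (i : ℕ) (M : ModuleCat.{u} R) : Prop :=
  ∀ (n : ℕ) (α : Abelian.Ext (ModuleCat.of R (R ⧸ a ^ n)) M i), ∃ (m : ℕ) (h : n ≤ m),
    (Abelian.Ext.mk₀ (qm (Ideal.pow_le_pow_right h))).comp α (zero_add i) = 0

lemma colim_subsingleton {J : Type} [SmallCategory J] [IsFiltered J] (D : J ⥤ ModuleCat.{u} R)
    (c : Cocone D) (hc : IsColimit c) :
    Subsingleton c.pt ↔ ∀ (j : J) (x : D.obj j), ∃ (k : J) (f : j ⟶ k), D.map f x = 0 := by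
  have : PreservesFilteredColimitsOfSize.{0, 0} (forget (ModuleCat.{u} R)) :=
    preservesFilteredColimitsOfSize_shrink.{0, u, 0, u} _
  constructor
  · intro hs j x
    have h0 : c.ι.app j x = c.ι.app j 0 := hs.elim _ _
    obtain ⟨k, f, g, hfg⟩ := Concrete.isColimit_exists_of_rep_eq D hc x 0 h0
    exact ⟨k, f, by rw [hfg]; exact map_zero _⟩
  · intro h
    refine subsingleton_of_forall_eq 0 fun y => ?_
    obtain ⟨j, x, rfl⟩ := Concrete.isColimit_exists_rep D hc y
    obtain ⟨k, f, h0⟩ := h j x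
    have h1 := congrArg (fun q => q.hom x) (c.w f)
    refine h1.symm.trans ?_
    exact (congrArg (c.ι.app k).hom h0).trans (map_zero _)

lemma lc_nontrivial_iff (a : Ideal R) (i : ℕ) (M : ModuleCat.{u} R) :
    Nontrivial ((localCohomology a i).obj M) ↔ ¬ LCVanish a i M := by
  let D := localCohomology.diagram (localCohomology.idealPowersDiagram a) i
  have hD : HasColimit D := localCohomology.hasColimitDiagram _ _
  have key := colim_subsingleton (D ⋙ (evaluation _ _).obj M)
    (((evaluation _ _).obj M).mapCocone (colimit.cocone D))
    (isColimitOfPreserves _ (colimit.isColimit D))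
  have e : (((evaluation _ _).obj M).mapCocone (colimit.cocone D)).pt =
    (localCohomology a i).obj M := rfl
  rw [e] at key
  rw [← not_subsingleton_iff_nontrivial, key, not_iff_not]
  constructor
  · intro h n α
    obtain ⟨x, hx⟩ := Rel.exists_left α
    obtain ⟨k, f, hf⟩ := h (Opposite.op (Opposite.op n)) x
    refine ⟨k.unop.unop, f.unop.unop.le, ?_⟩
    rw [← (hx.map _).zero_iff]
    exact hf
  · intro h j x
    obtain ⟨α, hα⟩ := Rel.exists_right (X := ModuleCat.of R (R ⧸ a ^ j.unop.unop)) (Y := M) x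
    obtain ⟨m, hm, h0⟩ := h _ α
    rw [← (hα.map _).zero_iff] at h0
    exact ⟨Opposite.op (Opposite.op m), Quiver.Hom.op (Quiver.Hom.op (homOfLE hm)), h0⟩

end compare
end FBC

namespace FBC
open Limits Pointwise

section grade
variable {R : Type u} [CommRing R]

lemma shortExact_kernel {X Y : ModuleCat.{u} R} (f : X ⟶ Y) (hf : Function.Surjective f.hom) :
    (LinearMap.shortComplexKer f.hom).ShortExact := LinearMap.shortExact_shortComplexKer hf

/-- finiteness of the grade -/
lemma grade_finite [IsNoetherianRing R] (a : Ideal R) (M : Type u) [AddCommGroup M] [Module R M]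
    [Module.Finite R M] (hM : a • (⊤ : Submodule R M) ≠ ⊤) :
    ∃ i, Nontrivial (Abelian.Ext (ModuleCat.of R (R ⧸ a)) (ModuleCat.of R M) i) := by
  by_contra! hcon
  let S : Set (Submodule R M) := {N | a • (⊤ : Submodule R M) ⊔ N ≠ ⊤ ∧
    ∀ i, Subsingleton (Abelian.Ext (ModuleCat.of R (R ⧸ a)) (ModuleCat.of R (M ⧸ N)) i)}
  have hS : S.Nonempty := by
    refine ⟨⊥, by simpa using hM, fun i => ?_⟩
    have e : ModuleCat.of R (M ⧸ (⊥ : Submodule R M)) ≅ ModuleCat.of R M :=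
      (Submodule.quotEquivOfEqBot _ rfl).toModuleIso
    have := hcon i
    refine subsingleton_of_forall_eq 0 fun α => ?_
    have h1 : α.comp (Abelian.Ext.mk₀ e.hom) (add_zero i) = 0 := Subsingleton.elim _ _
    have h2 := congrArg (fun β => β.comp (Abelian.Ext.mk₀ e.inv) (add_zero i)) h1
    simpa using h2
  obtain ⟨N, ⟨hN1, hN2⟩, hmax⟩ := WellFounded.has_min
    (wellFounded_gt (α := Submodule R M)) S hS
  have h0 : Subsingleton (ModuleCat.of R (R ⧸ a) ⟶ ModuleCat.of R (M ⧸ N)) :=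
    Abelian.Ext.addEquiv₀.subsingleton_congr.mp (hN2 0)
  have h0' : Subsingleton ((R ⧸ a) →ₗ[R] (M ⧸ N)) :=
    (ModuleCat.homAddEquiv (M := ModuleCat.of R (R ⧸ a)) (N := ModuleCat.of R (M ⧸ N))).symm.subsingleton
  obtain ⟨x, hxa, hx⟩ := IsSMulRegular.subsingleton_linearMap_iff.mp h0'
  rw [Ideal.annihilator_quotient] at hxa
  let p : M →ₗ[R] QuotSMulTop x (M ⧸ N) := (Submodule.mkQ _).comp N.mkQ
  have hp : Function.Surjective p :=
    (Submodule.mkQ_surjective _).comp (Submodule.mkQ_surjective _)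
  have hp0 : ∀ m, p m = 0 ↔ ∃ m', m - x • m' ∈ N := by
    intro m
    have : p m = 0 ↔ N.mkQ m ∈ x • (⊤ : Submodule R (M ⧸ N)) := Submodule.Quotient.mk_eq_zero _
    rw [this, Submodule.mem_smul_pointwise_iff_exists]
    constructor
    · rintro ⟨y, -, hy⟩
      obtain ⟨m', rfl⟩ := N.mkQ_surjective y
      refine ⟨m', ?_⟩
      rw [← N.ker_mkQ, LinearMap.mem_ker, map_sub, map_smul, hy, sub_self]
    · rintro ⟨m', hm'⟩
      refine ⟨N.mkQ m', trivial, ?_⟩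
      rw [← N.ker_mkQ, LinearMap.mem_ker, map_sub, map_smul, sub_eq_zero] at hm'
      exact hm'.symm
  have hle : N ≤ LinearMap.ker p := fun m hm => (hp0 m).2 ⟨0, by simpa using hm⟩
  have hmem : LinearMap.ker p ∈ S := by
    constructor
    · intro h
      apply hN1
      refine eq_top_iff.2 (h.ge.trans (sup_le le_sup_left ?_))
      intro m hm
      obtain ⟨m', hm'⟩ := (hp0 m).1 hm
      rw [← add_sub_cancel (x • m') m]
      exact Submodule.add_mem_sup (Submodule.smul_mem_smul hxa trivial) hm'
    · intro i
      let e : ModuleCat.of R (M ⧸ LinearMap.ker p) ≅ ModuleCat.of R (QuotSMulTop x (M ⧸ N)) :=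
        (p.quotKerEquivOfSurjective hp).toModuleIso
      have : Subsingleton (Abelian.Ext (ModuleCat.of R (R ⧸ a))
          (ModuleCat.of R (QuotSMulTop x (M ⧸ N))) i) := by
        have zero1 := AddCommGrpCat.isZero_of_iff_subsingleton.mpr (hN2 i)
        have zero2 := AddCommGrpCat.isZero_of_iff_subsingleton.mpr (hN2 (i+1))
        exact AddCommGrpCat.subsingleton_of_isZero <| ShortComplex.Exact.isZero_of_both_zeros
          ((Abelian.Ext.covariant_sequence_exact₃' _
            (IsSMulRegular.smulShortComplex_shortExact (M := ModuleCat.of R (M ⧸ N)) hx)) i (i + 1) rfl)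
          (zero1.eq_zero_of_src _) (zero2.eq_zero_of_tgt _)
      refine subsingleton_of_forall_eq 0 fun α => ?_
      have h1 : α.comp (Abelian.Ext.mk₀ e.hom) (add_zero i) = 0 := Subsingleton.elim _ _
      have h2 := congrArg (fun β => β.comp (Abelian.Ext.mk₀ e.inv) (add_zero i)) h1
      simpa using h2
  have heq : LinearMap.ker p ≤ N := by
    by_contra h
    exact hmax _ hmem (lt_of_le_not_ge hle h)
  apply hN1
  rw [eq_top_iff]
  refine le_trans ?_ le_sup_right
  intro m _
  have h1 : x • m ∈ N := heq ((hp0 _).2 ⟨m, by simp⟩)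
  have h2 : x • N.mkQ m = x • (0 : M ⧸ N) := by
    rw [smul_zero, ← map_smul, ← LinearMap.mem_ker, N.ker_mkQ]; exact h1
  rw [← N.ker_mkQ]
  exact hx h2

lemma not_lcVanish_of_grade [IsNoetherianRing R] (a : Ideal R) (M : Type u) [AddCommGroup M]
    [Module R M] [Module.Finite R M] (hM : a • (⊤ : Submodule R M) ≠ ⊤) (g : ℕ)
    (hg : ∀ i < g, Subsingleton (Abelian.Ext (ModuleCat.of R (R ⧸ a)) (ModuleCat.of R M) i))
    (hn : Nontrivial (Abelian.Ext (ModuleCat.of R (R ⧸ a)) (ModuleCat.of R M) g)) :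
    ¬ LCVanish a g (ModuleCat.of R M) := by
  intro hv
  have hn1 : Nontrivial (Abelian.Ext (ModuleCat.of R (R ⧸ a ^ 1)) (ModuleCat.of R M) g) := by
    rwa [pow_one]
  obtain ⟨α, hα⟩ := exists_ne (0 : Abelian.Ext (ModuleCat.of R (R ⧸ a ^ 1)) (ModuleCat.of R M) g)
  obtain ⟨m, hm, h0⟩ := hv 1 α
  apply hα
  have hsurj : Function.Surjective (qm (Ideal.pow_le_pow_right (I := a) hm)).hom := by
    intro y
    obtain ⟨r, rfl⟩ := Ideal.Quotient.mk_surjective y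
    exact ⟨Ideal.Quotient.mk _ r, rfl⟩
  cases g with
  | zero =>
    have : Epi (qm (Ideal.pow_le_pow_right (I := a) hm)) := (ModuleCat.epi_iff_surjective _).2 hsurj
    apply Abelian.Ext.precomp_mk₀_injective_of_epi _ (qm (Ideal.pow_le_pow_right (I := a) hm))
    simpa using h0
  | succ g =>
    have hse := shortExact_kernel _ hsurj
    obtain ⟨β, rfl⟩ := Abelian.Ext.contravariant_sequence_exact₃ hse _ α h0 (add_comm 1 g)
    have : Subsingleton (Abelian.Ext (LinearMap.shortComplexKer
      (qm (Ideal.pow_le_pow_right (I := a) hm)).hom).X₁ (ModuleCat.of R M) g) := by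
      obtain ⟨rs, hl, hmem, hreg⟩ := ModuleCat.exists_isRegular_of_exists_subsingleton_ext a (g+1)
        (ModuleCat.of R M) hM.lt_top (ModuleCat.of R (R ⧸ a))
        (by change Module.support R (R ⧸ a) = _
            rw [Module.support_eq_zeroLocus, Ideal.annihilator_quotient]) hg
      refine ModuleCat.subsingleton_ext_of_exists_isRegular a _ ?_ _ hM.lt_top rs hmem hreg g
        (by omega)
      have h1 : Module.support R (LinearMap.shortComplexKer
        (qm (Ideal.pow_le_pow_right (I := a) hm)).hom).X₁ ⊆ Module.support R (R ⧸ a ^ m) :=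
        Module.support_subset_of_injective (Submodule.subtype _) Subtype.val_injective
      refine h1.trans ?_
      rw [Module.support_eq_zeroLocus, Ideal.annihilator_quotient]
      rw [PrimeSpectrum.zeroLocus_pow _ (by omega)]
    rw [Subsingleton.elim β 0, Abelian.Ext.comp_zero]

end grade
end FBC

namespace FBC
open Limits

section basechange
variable (R T : Type u) [CommRing R] [CommRing T] [Algebra R T]

/-- base change functor -/
def BC : ModuleCat.{u} R ⥤ ModuleCat.{u} T where
  obj M := ModuleCat.of T (T ⊗[R] M)
  map f := ModuleCat.ofHom (f.hom.baseChange T)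
  map_id M := by
    ext : 1
    exact LinearMap.baseChange_id
  map_comp f g := by
    ext : 1
    exact LinearMap.baseChange_comp f.hom g.hom

instance : (BC R T).Additive where
  map_add {X Y f g} := by
    ext : 1
    exact LinearMap.baseChange_add f.hom g.hom

lemma BC_exact [Module.Flat R T] (S : ShortComplex (ModuleCat.{u} R)) (h : S.Exact) :
    (S.map (BC R T)).Exact := by
  rw [CategoryTheory.ShortComplex.ShortExact.moduleCat_exact_iff_function_exact] at h ⊢
  exact Module.Flat.lTensor_exact T h

instance [Module.Flat R T] : PreservesFiniteLimits (BC R T) :=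
  by
  have := ((CategoryTheory.Functor.exact_tfae (BC R T)).out 1 3).mp (BC_exact R T)
  exact this.1

instance [Module.Flat R T] : PreservesFiniteColimits (BC R T) :=
  by
  have := ((CategoryTheory.Functor.exact_tfae (BC R T)).out 1 3).mp (BC_exact R T)
  exact this.2

variable {R}

lemma span_map_eq_top [IsNoetherianRing R] [Module.Flat R T] (i : ℕ) (X Y : ModuleCat.{u} R)
    [Module.Finite R X] :
    Submodule.span T (Set.range (fun α : Abelian.Ext X Y i => α.mapExactFunctor (BC R T))) = ⊤ := by
  induction i generalizing X with
  | zero =>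
    have : Module.FinitePresentation R X := Module.finitePresentation_of_finite R X
    have hb := Module.FinitePresentation.isBaseChange_map R X Y T
    let Q : Submodule T (Abelian.Ext (ModuleCat.of T (T ⊗[R] X)) (ModuleCat.of T (T ⊗[R] Y)) 0) :=
      Submodule.span T (Set.range (fun α : Abelian.Ext X Y 0 => α.mapExactFunctor (BC R T)))
    let L : ((T ⊗[R] X) →ₗ[T] (T ⊗[R] Y)) ≃ₗ[T]
        Abelian.Ext (ModuleCat.of T (T ⊗[R] X)) (ModuleCat.of T (T ⊗[R] Y)) 0 :=
      (ModuleCat.homLinearEquiv (S := T) (M := ModuleCat.of T (T ⊗[R] X))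
        (N := ModuleCat.of T (T ⊗[R] Y))).symm ≪≫ₗ Abelian.Ext.linearEquiv₀.symm
    have key : ∀ ψ, L ψ ∈ Q := by
      intro ψ
      refine hb.inductionOn ψ (fun ψ => L ψ ∈ Q) ?_ ?_ ?_ ?_
      · rw [map_zero]; exact Q.zero_mem
      · intro m
        apply Submodule.subset_span
        refine ⟨Abelian.Ext.mk₀ (ModuleCat.ofHom m), ?_⟩
        simp only [Abelian.Ext.mapExactFunctor_mk₀]
        rfl
      · intro s n h
        rw [map_smul]; exact Q.smul_mem s h
      · intro x y hx hy
        rw [map_add]; exact Q.add_mem hx hy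
    change Q = ⊤
    rw [eq_top_iff]
    intro α _
    rw [← L.apply_symm_apply α]
    exact key _
  | succ n ih =>
    obtain ⟨P, _, _, _, _, f, surjf⟩ := Module.exists_finite_presentation R X
    have hS := LinearMap.shortExact_shortComplexKer surjf
    have hS' := hS.map_of_exact (BC R T)
    have : Projective (f.shortComplexKer.map (BC R T)).X₂ := by
      have : Module.Free T (f.shortComplexKer.map (BC R T)).X₂ :=
        inferInstanceAs (Module.Free T (T ⊗[R] P))
      infer_instance
    have hsurj := precomp_extClass_surjective_of_projective_X₂ ((BC R T).obj Y) hS' n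
    have hK : Module.Finite R f.shortComplexKer.X₁ :=
      inferInstanceAs (Module.Finite R (LinearMap.ker f))
    have ih' := ih f.shortComplexKer.X₁
    let Q : Submodule T (Abelian.Ext (f.shortComplexKer.map (BC R T)).X₃ ((BC R T).obj Y) (n+1)) :=
      Submodule.span T (Set.range (fun α : Abelian.Ext X Y (n+1) => α.mapExactFunctor (BC R T)))
    let Q' : Submodule T (Abelian.Ext (f.shortComplexKer.map (BC R T)).X₁ ((BC R T).obj Y) n) :=
      Submodule.span T (Set.range (fun α : Abelian.Ext f.shortComplexKer.X₁ Y n =>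
        α.mapExactFunctor (BC R T)))
    let L := hS'.extClass.precompOfLinear T ((BC R T).obj Y) (add_comm 1 n)
    have key : Q' ≤ Q.comap L := by
      refine Submodule.span_le.2 ?_
      rintro _ ⟨γ, rfl⟩
      apply Submodule.subset_span
      refine ⟨hS.extClass.comp γ (add_comm 1 n), ?_⟩
      simp only [Abelian.Ext.mapExactFunctor_comp, Abelian.Ext.mapExactFunctor_extClass]
      rfl
    change Q = ⊤
    rw [eq_top_iff]
    intro α _
    obtain ⟨β, rfl⟩ := hsurj α
    have h1 : β ∈ Q' := by
      change Q' = ⊤ at ih'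
      rw [ih']; trivial
    exact key h1

/-- `T ⊗ R/I ≅ T/IT` -/
def qiso (I : Ideal R) :
    (BC R T).obj (ModuleCat.of R (R ⧸ I)) ≅ ModuleCat.of T (T ⧸ I.map (algebraMap R T)) :=
  (Algebra.TensorProduct.quotIdealMapEquivTensorQuot T I).toLinearEquiv.symm.toModuleIso

lemma qiso_nat {I J : Ideal R} (h : I ≤ J) :
    (BC R T).map (qm h) ≫ (qiso T J).hom = (qiso T I).hom ≫ qm (Ideal.map_mono h) := by
  ext : 1
  refine TensorProduct.AlgebraTensorModule.curry_injective (LinearMap.ext fun t => LinearMap.ext fun x => ?_)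
  obtain ⟨r, rfl⟩ := Ideal.Quotient.mk_surjective x
  rfl

lemma lcVanish_iff (a : Ideal R) (i : ℕ) (M : ModuleCat.{u} R) : LCVanish a i M ↔
  ∀ n (α : Abelian.Ext (ModuleCat.of R (R ⧸ a^n)) M i), ∃ m, ∃ h : n ≤ m, 
    (Abelian.Ext.mk₀ (qm (Ideal.pow_le_pow_right h))).comp α (zero_add i) = 0 := Iff.rfl

lemma mk₀_comp_eq_zero_trans {X Y Z W : ModuleCat.{u} R} {i : ℕ} {f : X ⟶ Y} {g : Y ⟶ Z} {h : X ⟶ Z}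
    (e : f ≫ g = h)
    {α : Abelian.Ext Z W i} (h0 : (Abelian.Ext.mk₀ g).comp α (zero_add i) = 0) :
    (Abelian.Ext.mk₀ h).comp α (zero_add i) = 0 := by
  rw [← e, ← Abelian.Ext.mk₀_comp_mk₀_assoc, h0, Abelian.Ext.comp_zero]

lemma qm_comp {I J K : Ideal R} (h : I ≤ J) (h' : J ≤ K) : qm h ≫ qm h' = qm (h.trans h') := by
  ext : 1
  refine LinearMap.ext fun x => ?_
  obtain ⟨r, rfl⟩ := Ideal.Quotient.mk_surjective x
  rfl

lemma lcVanish_baseChange [IsNoetherianRing R] [Module.Flat R T] (a : Ideal R) (i : ℕ)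
    (M : ModuleCat.{u} R) (h : LCVanish a i M) :
    LCVanish (a.map (algebraMap R T)) i ((BC R T).obj M) := by
  have key : ∀ n (α : Abelian.Ext ((BC R T).obj (ModuleCat.of R (R ⧸ a^n))) ((BC R T).obj M) i),
      ∃ m, ∃ h : n ≤ m, (Abelian.Ext.mk₀ ((BC R T).map (qm (Ideal.pow_le_pow_right h)))).comp α
        (zero_add i) = 0 := by
    intro n α
    have hα : α ∈ Submodule.span T (Set.range (fun α : Abelian.Ext (ModuleCat.of R (R ⧸ a^n)) M i => α.mapExactFunctor (BC R T))) := by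
      rw [span_map_eq_top]; trivial
    induction hα using Submodule.span_induction with
    | mem x hx =>
      obtain ⟨β, rfl⟩ := hx
      obtain ⟨m, hm, h0⟩ := h n β
      refine ⟨m, hm, ?_⟩
      simp only
      rw [← Abelian.Ext.mapExactFunctor_mk₀, ← Abelian.Ext.mapExactFunctor_comp, h0,
        Abelian.Ext.mapExactFunctor_zero]
    | zero => exact ⟨n, le_rfl, Abelian.Ext.comp_zero _ _ _ _ _⟩
    | add x y _ _ hx hy =>
      obtain ⟨m, hm, h1⟩ := hx
      obtain ⟨m', hm', h2⟩ := hy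
      refine ⟨max m m', hm.trans (le_max_left _ _), ?_⟩
      rw [Abelian.Ext.comp_add]
      rw [mk₀_comp_eq_zero_trans (f := (BC R T).map (qm (Ideal.pow_le_pow_right (le_max_left m m'))))
        (by rw [← Functor.map_comp, qm_comp]) h1]
      rw [mk₀_comp_eq_zero_trans (f := (BC R T).map (qm (Ideal.pow_le_pow_right (le_max_right m m'))))
        (by rw [← Functor.map_comp, qm_comp]) h2, add_zero]
    | smul t x _ hx =>
      obtain ⟨m, hm, h1⟩ := hx
      exact ⟨m, hm, by rw [Abelian.Ext.comp_smul, h1, smul_zero]⟩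
  have hpow : ∀ n, (a.map (algebraMap R T))^n = (a^n).map (algebraMap R T) := fun n => (Ideal.map_pow _ _ _).symm
  have key2 : ∀ n, ∀ J : Ideal T, J = (a^n).map (algebraMap R T) → ∀ (α : Abelian.Ext (ModuleCat.of T (T ⧸ J)) ((BC R T).obj M) i),
      ∃ m, ∃ h : n ≤ m, ∀ K : Ideal T, K = (a^m).map (algebraMap R T) → ∀ hK : K ≤ J,
        (Abelian.Ext.mk₀ (qm hK)).comp α (zero_add i) = 0 := by
    rintro n J rfl α
    obtain ⟨m, hm, h0⟩ := key n ((Abelian.Ext.mk₀ (qiso T (a^n)).hom).comp α (zero_add i))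
    refine ⟨m, hm, ?_⟩
    rintro K rfl hK
    rw [Abelian.Ext.mk₀_comp_mk₀_assoc, qiso_nat] at h0
    have h1 := mk₀_comp_eq_zero_trans (f := (qiso T (a^m)).inv) rfl h0
    simpa using h1
  intro n α
  obtain ⟨m, hm, h0⟩ := key2 n _ (hpow n) α
  exact ⟨m, hm, h0 _ (hpow m) _⟩

lemma lcVanish_iso {a : Ideal R} {i : ℕ} {M N : ModuleCat.{u} R} (e : M ≅ N) (h : LCVanish a i M) :
    LCVanish a i N := by
  intro n α
  obtain ⟨m, hm, h0⟩ := h n (α.comp (Abelian.Ext.mk₀ e.inv) (add_zero i))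
  refine ⟨m, hm, ?_⟩
  have h2 := congrArg (fun β => β.comp (Abelian.Ext.mk₀ e.hom) (add_zero i)) h0
  simpa using h2

end basechange
end FBC

namespace FBC
open Limits

section upper
variable {R : Type u} [CommRing R]

lemma pv_step {S : ℕ → ShortComplex (ModuleCat.{u} R)} (hS : ∀ n, (S n).ShortExact)
    (φ : ∀ {n m : ℕ}, n ≤ m → (S m ⟶ S n))
    (hcomp : ∀ {n m k : ℕ} (h : n ≤ m) (h' : m ≤ k), (φ h').τ₃ ≫ (φ h).τ₃ = (φ (h.trans h')).τ₃)
    (i : ℕ) (N : ModuleCat.{u} R)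
    (h2 : ∀ n (α : Abelian.Ext (S n).X₂ N (i+1)), ∃ m, ∃ h : n ≤ m,
      (Abelian.Ext.mk₀ (φ h).τ₂).comp α (zero_add _) = 0)
    (h1 : ∀ n (α : Abelian.Ext (S n).X₁ N i), ∃ m, ∃ h : n ≤ m,
      (Abelian.Ext.mk₀ (φ h).τ₁).comp α (zero_add _) = 0)
    (n : ℕ) (α : Abelian.Ext (S n).X₃ N (i+1)) : ∃ m, ∃ h : n ≤ m,
      (Abelian.Ext.mk₀ (φ h).τ₃).comp α (zero_add _) = 0 := by
  obtain ⟨m, hm, h0⟩ := h2 n ((Abelian.Ext.mk₀ (S n).g).comp α (zero_add _))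
  rw [Abelian.Ext.mk₀_comp_mk₀_assoc, (φ hm).comm₂₃, ← Abelian.Ext.mk₀_comp_mk₀_assoc] at h0
  obtain ⟨β, hβ⟩ := Abelian.Ext.contravariant_sequence_exact₃ (hS m) _ _ h0 (add_comm 1 i)
  obtain ⟨k, hk, h3⟩ := h1 m β
  refine ⟨k, hm.trans hk, ?_⟩
  rw [← hcomp hm hk, ← Abelian.Ext.mk₀_comp_mk₀_assoc, ← hβ,
    ← Abelian.Ext.comp_assoc (a₁₂ := 1) _ _ _ (zero_add 1) (add_comm 1 i) (by omega),
    ← ShortComplex.ShortExact.extClass_naturality (hS k) (hS m) (φ hk),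
    Abelian.Ext.comp_assoc (a₂₃ := i) _ _ _ (add_zero 1) (zero_add i) (by omega), h3,
    Abelian.Ext.comp_zero]

/-- multiplication by `y` from `R/I` to `R/J` -/
abbrev qmul {I J : Ideal R} (y : R) (h : ∀ r ∈ I, y * r ∈ J) :
    ModuleCat.of R (R ⧸ I) ⟶ ModuleCat.of R (R ⧸ J) :=
  ModuleCat.ofHom (Submodule.mapQ I J (LinearMap.lsmul R R y) h)

lemma quot_hom_ext {I : Ideal R} {X : ModuleCat.{u} R} {f g : ModuleCat.of R (R ⧸ I) ⟶ X}
    (h : ∀ r : R, f.hom (Ideal.Quotient.mk I r) = g.hom (Ideal.Quotient.mk I r)) : f = g := by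
  ext : 1
  refine LinearMap.ext fun x => ?_
  obtain ⟨r, rfl⟩ := Ideal.Quotient.mk_surjective x
  exact h r

lemma qmul_mk {I J : Ideal R} (y : R) (h : ∀ r ∈ I, y * r ∈ J) (r : R) :
    (qmul y h).hom (Ideal.Quotient.mk I r) = Ideal.Quotient.mk J (y * r) := rfl

lemma qm_mk {I J : Ideal R} (h : I ≤ J) (r : R) :
    (qm h).hom (Ideal.Quotient.mk I r) = Ideal.Quotient.mk J r := rfl

section
variable (b : ℕ → Ideal R) (x : R)

/-- colon ideal -/
def colon (n : ℕ) : Ideal R := Submodule.comap (LinearMap.lsmul R R (x^n)) (b n)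

lemma mem_colon (n : ℕ) (r : R) : r ∈ colon b x n ↔ x^n * r ∈ b n := Iff.rfl

variable {b}

lemma le_colon (n : ℕ) : b n ≤ colon b x n := fun r hr => (b n).mul_mem_left _ hr

lemma colon_trans (hb : Antitone b) {n m : ℕ} (h : n ≤ m) :
    ∀ r ∈ colon b x m, x^(m-n) * r ∈ colon b x n := by
  intro r hr
  rw [mem_colon, ← mul_assoc, ← pow_add, Nat.add_sub_cancel' h]
  exact hb h hr

lemma b_trans (hb : Antitone b) {n m : ℕ} (h : n ≤ m) : ∀ r ∈ b m, x^(m-n) * r ∈ b n :=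
  fun _ hr => (b n).mul_mem_left _ (hb h hr)

variable (b) in
/-- first sequence -/
def S1 (n : ℕ) : ShortComplex (ModuleCat.{u} R) where
  X₁ := ModuleCat.of R (R ⧸ colon b x n)
  X₂ := ModuleCat.of R (R ⧸ b n)
  X₃ := ModuleCat.of R (R ⧸ (b n ⊔ Ideal.span {x^n}))
  f := qmul (x^n) (fun _ h => h)
  g := qm le_sup_left
  zero := by
    apply quot_hom_ext
    intro r
    refine Ideal.Quotient.eq_zero_iff_mem.2 (Ideal.mem_sup_right ?_)
    exact Ideal.mul_mem_right _ _ (Ideal.mem_span_singleton_self _)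

lemma S1_exact (n : ℕ) : (S1 b x n).ShortExact where
  exact := by
    rw [ShortComplex.ShortExact.moduleCat_exact_iff_function_exact]
    intro y
    constructor
    · intro hy
      obtain ⟨r, rfl⟩ := Ideal.Quotient.mk_surjective y
      have hy' : r ∈ b n ⊔ Ideal.span {x^n} := Ideal.Quotient.eq_zero_iff_mem.1 hy
      obtain ⟨s, hs, t, ht, rfl⟩ := Submodule.mem_sup.1 hy'
      obtain ⟨t, rfl⟩ := Ideal.mem_span_singleton.1 ht
      refine ⟨Ideal.Quotient.mk _ t, ?_⟩
      refine Eq.trans (b := Ideal.Quotient.mk (b n) (x^n * t)) rfl ?_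
      refine Ideal.Quotient.eq.2 ?_
      simpa using hs
    · rintro ⟨z, rfl⟩
      exact congrArg (fun f => f.hom z) (S1 b x n).zero
  mono_f := by
    rw [ModuleCat.mono_iff_injective]
    rw [injective_iff_map_eq_zero]
    intro y hy
    obtain ⟨r, rfl⟩ := Ideal.Quotient.mk_surjective y
    exact Ideal.Quotient.eq_zero_iff_mem.2 ((Ideal.Quotient.eq_zero_iff_mem (I := b n)).1 hy)
  epi_g := by
    rw [ModuleCat.epi_iff_surjective]
    intro y
    obtain ⟨r, rfl⟩ := Ideal.Quotient.mk_surjective y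
    exact ⟨Ideal.Quotient.mk _ r, rfl⟩

lemma c_mono (hb : Antitone b) {n m : ℕ} (h : n ≤ m) :
    b m ⊔ Ideal.span {x^m} ≤ b n ⊔ Ideal.span {x^n} :=
  sup_le_sup (hb h) (by rw [Ideal.span_singleton_le_span_singleton]; exact pow_dvd_pow x h)

/-- transition -/
def φ1 (hb : Antitone b) {n m : ℕ} (h : n ≤ m) : S1 b x m ⟶ S1 b x n where
  τ₁ := qmul (x^(m-n)) (colon_trans x hb h)
  τ₂ := qm (hb h)
  τ₃ := qm (c_mono x hb h)
  comm₁₂ := by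
    apply quot_hom_ext
    intro r
    refine Eq.trans (b := Ideal.Quotient.mk (b n) (x^n * (x^(m-n) * r))) rfl ?_
    refine Eq.trans ?_ (rfl : Ideal.Quotient.mk (b n) (x^m * r) = _)
    rw [← mul_assoc, ← pow_add, Nat.add_sub_cancel' h]
  comm₂₃ := by
    apply quot_hom_ext
    intro r
    rfl

variable (b) in
/-- second sequence -/
abbrev S2 (n : ℕ) : ShortComplex (ModuleCat.{u} R) :=
  LinearMap.shortComplexKer (qm (le_colon (b := b) x n)).hom

lemma S2_exact (n : ℕ) : (S2 b x n).ShortExact := by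
  apply LinearMap.shortExact_shortComplexKer
  intro y
  obtain ⟨r, rfl⟩ := Ideal.Quotient.mk_surjective y
  exact ⟨Ideal.Quotient.mk _ r, rfl⟩

lemma S2_comm (hb : Antitone b) {n m : ℕ} (h : n ≤ m) :
    qmul (x^(m-n)) (b_trans x hb h) ≫ qm (le_colon x n) =
      qm (le_colon x m) ≫ qmul (x^(m-n)) (colon_trans x hb h) := by
  apply quot_hom_ext
  intro r
  rfl

/-- transition -/
def φ2 (hb : Antitone b) {n m : ℕ} (h : n ≤ m) : S2 b x m ⟶ S2 b x n where
  τ₁ := ModuleCat.ofHom (LinearMap.restrict (qmul (x^(m-n)) (b_trans x hb h)).hom (by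
    intro y hy
    have h1 : (qm (le_colon (b := b) x m)).hom y = 0 := hy
    have h2 := congrArg (fun f => f.hom y) (S2_comm x hb h)
    refine h2.trans ?_
    refine (congrArg (qmul (x^(m-n)) (colon_trans x hb h)).hom h1).trans (map_zero _)))
  τ₂ := qmul (x^(m-n)) (b_trans x hb h)
  τ₃ := qmul (x^(m-n)) (colon_trans x hb h)
  comm₁₂ := by
    ext : 1
    rfl
  comm₂₃ := S2_comm x hb h

lemma φ2_zero [IsNoetherianRing R] (hb : Antitone b) (n : ℕ) :
    ∃ m, ∃ h : n ≤ m, (φ2 x hb h).τ₁ = 0 := by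
  let I : ℕ →o Ideal R :=
    { toFun := fun k => Submodule.comap (LinearMap.lsmul R R (x^k)) (b n)
      monotone' := by
        intro k l hkl r hr
        have hr' : x^k * r ∈ b n := hr
        change x^l * r ∈ b n
        rw [← Nat.sub_add_cancel hkl, pow_add, mul_assoc]
        exact (b n).mul_mem_left _ hr' }
  obtain ⟨k, hk⟩ := monotone_stabilizes_iff_noetherian.2 ‹IsNoetherianRing R› I
  refine ⟨n + k, Nat.le_add_right _ _, ?_⟩
  ext : 1
  refine LinearMap.ext fun y => ?_
  obtain ⟨y, hy⟩ := y
  apply Subtype.ext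
  obtain ⟨r, rfl⟩ := Ideal.Quotient.mk_surjective y
  have h1 : r ∈ colon b x (n+k) := Ideal.Quotient.eq_zero_iff_mem.1 hy
  have h2 : r ∈ I (n+k) := hb (Nat.le_add_right n k) h1
  rw [← hk (n+k) (by omega)] at h2
  have h3 : x^k * r ∈ b n := h2
  refine Ideal.Quotient.eq_zero_iff_mem.2 ?_
  change x^(n+k-n) * r ∈ b n
  rwa [Nat.add_sub_cancel_left]

lemma pv_cons [IsNoetherianRing R] (hb : Antitone b) (N : ModuleCat.{u} R) (i : ℕ)
    (H : ∀ j, i < j → ∀ n (α : Abelian.Ext (ModuleCat.of R (R ⧸ b n)) N j), ∃ m, ∃ h : n ≤ m,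
      (Abelian.Ext.mk₀ (qm (hb h))).comp α (zero_add _) = 0) :
    ∀ j, i + 1 < j → ∀ n (α : Abelian.Ext (ModuleCat.of R (R ⧸ (b n ⊔ Ideal.span {x^n}))) N j),
      ∃ m, ∃ h : n ≤ m, (Abelian.Ext.mk₀ (qm (c_mono x hb h))).comp α (zero_add _) = 0 := by
  intro j hj
  obtain ⟨j, rfl⟩ : ∃ k, j = k + 1 + 1 := ⟨j - 2, by omega⟩
  refine pv_step (S1_exact x) (φ1 x hb) ?_ (j+1) N (H (j+1+1) (by omega)) ?_
  · intro n m k h h'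
    apply quot_hom_ext
    intro r
    rfl
  refine pv_step (S2_exact x) (φ2 x hb) ?_ j N ?_ ?_
  · intro n m k h h'
    apply quot_hom_ext
    intro r
    refine Eq.trans (b := Ideal.Quotient.mk (colon b x n) (x^(m-n) * (x^(k-m) * r))) rfl ?_
    refine Eq.trans ?_ (rfl : Ideal.Quotient.mk (colon b x n) (x^(k-n) * r) = _)
    rw [← mul_assoc, ← pow_add]
    congr 3
    omega
  · intro n α
    obtain ⟨m, hm, h0⟩ := H (j+1) (by omega) n α
    refine ⟨m, hm, ?_⟩
    refine mk₀_comp_eq_zero_trans (f := qmul (x^(m-n)) (fun r hr => (b m).mul_mem_left _ hr)) ?_ h0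
    apply quot_hom_ext
    intro r
    rfl
  · intro n α
    obtain ⟨m, hm, h0⟩ := φ2_zero x hb n
    refine ⟨m, hm, ?_⟩
    rw [h0, Abelian.Ext.mk₀_zero, Abelian.Ext.zero_comp]

end

/-- ideal generated by `n`-th powers -/
def pw : List R → ℕ → Ideal R
  | [], _ => ⊥
  | x :: l, n => pw l n ⊔ Ideal.span {x^n}

lemma pw_anti (l : List R) : Antitone (pw l) := by
  induction l with
  | nil => intro n m _; exact le_rfl
  | cons x l ih => intro n m h; exact c_mono x ih h

lemma pw_pv [IsNoetherianRing R] (N : ModuleCat.{u} R) (l : List R) :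
    ∀ j, l.length < j → ∀ n (α : Abelian.Ext (ModuleCat.of R (R ⧸ pw l n)) N j), ∃ m, ∃ h : n ≤ m,
      (Abelian.Ext.mk₀ (qm (pw_anti l h))).comp α (zero_add _) = 0 := by
  induction l with
  | nil =>
    intro j hj n α
    refine ⟨n, le_rfl, ?_⟩
    obtain ⟨j, rfl⟩ : ∃ k, j = k + 1 := ⟨j - 1, by simp at hj; omega⟩
    have : Module.Free R (R ⧸ (pw ([] : List R) n)) :=
      Module.Free.of_equiv (Submodule.quotEquivOfEqBot (⊥ : Ideal R) rfl).symm
    have : Projective (ModuleCat.of R (R ⧸ (pw ([] : List R) n))) := inferInstance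
    rw [Abelian.Ext.eq_zero_of_projective α, Abelian.Ext.comp_zero]
  | cons x l ih => exact pv_cons x (pw_anti l) N l.length ih

lemma pw_le (a : Ideal R) (l : List R) (h : ∀ x ∈ l, x ∈ a) (n : ℕ) : pw l n ≤ a ^ n := by
  induction l with
  | nil => exact bot_le
  | cons x l ih =>
    refine sup_le (ih fun y hy => h y (List.mem_cons_of_mem _ hy)) ?_
    rw [Ideal.span_singleton_le_iff_mem]
    exact Ideal.pow_mem_pow (h x List.mem_cons_self) n

lemma pow_mem_pw (l : List R) (x : R) (h : x ∈ l) (n : ℕ) : x ^ n ∈ pw l n := by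
  induction l with
  | nil => simp at h
  | cons y l ih =>
    rcases List.mem_cons.1 h with rfl | h
    · exact Ideal.mem_sup_right (Ideal.mem_span_singleton_self _)
    · exact Ideal.mem_sup_left (ih h)

lemma exists_bound [IsNoetherianRing R] (a : Ideal R) :
    ∃ r, ∀ i, r < i → ∀ N : ModuleCat.{u} R, LCVanish a i N := by
  have hfg : a.FG := IsNoetherian.noetherian a
  obtain ⟨s, rfl⟩ := hfg
  refine ⟨s.toList.length, fun i hi N => ?_⟩
  intro n α
  set a := Submodule.span R (s : Set R) with ha
  have hle : ∀ n, pw s.toList n ≤ a ^ n := pw_le a _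
    (fun x hx => Submodule.subset_span (by simpa using hx))
  obtain ⟨m, hm, h0⟩ := pw_pv N s.toList i hi n
    ((Abelian.Ext.mk₀ (qm (hle n))).comp α (zero_add i))
  obtain ⟨k, hk⟩ : ∃ k, a ^ k ≤ pw s.toList m := by
    refine Ideal.exists_pow_le_of_le_radical_of_fg ?_ (IsNoetherian.noetherian a)
    refine Submodule.span_le.2 fun x hx => ?_
    exact ⟨m, pow_mem_pw _ x (by simpa using hx) m⟩
  refine ⟨n + k, Nat.le_add_right _ _, ?_⟩
  rw [Abelian.Ext.mk₀_comp_mk₀_assoc] at h0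
  refine mk₀_comp_eq_zero_trans
    (f := qm ((Ideal.pow_le_pow_right (Nat.le_add_left k n)).trans hk)) ?_ h0
  apply quot_hom_ext
  intro r
  rfl

end upper
end FBC

namespace FBC
open Limits

section fg
variable {R : Type u} [CommRing R]

lemma kill_mono {a : Ideal R} {i n m k : ℕ} {N : ModuleCat.{u} R}
    {α : Abelian.Ext (ModuleCat.of R (R ⧸ a^n)) N i} (hm : n ≤ m) (hk : m ≤ k)
    (h : (Abelian.Ext.mk₀ (qm (Ideal.pow_le_pow_right hm))).comp α (zero_add i) = 0) :
    (Abelian.Ext.mk₀ (qm (Ideal.pow_le_pow_right (hm.trans hk)))).comp α (zero_add i) = 0 :=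
  mk₀_comp_eq_zero_trans (f := qm (Ideal.pow_le_pow_right hk)) (qm_comp _ _) h

lemma lcVanish_pi {a : Ideal R} {i : ℕ} (h : LCVanish a i (ModuleCat.of R R)) (k : ℕ) :
    LCVanish a i (ModuleCat.of R (Fin k → R)) := by
  intro n α
  let p (j : Fin k) : ModuleCat.of R (Fin k → R) ⟶ ModuleCat.of R R :=
    ModuleCat.ofHom (LinearMap.proj j)
  let s (j : Fin k) : ModuleCat.of R R ⟶ ModuleCat.of R (Fin k → R) :=
    ModuleCat.ofHom (LinearMap.single R (fun _ => R) j)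
  have hid : 𝟙 (ModuleCat.of R (Fin k → R)) = ∑ j, p j ≫ s j := by
    ext : 1
    refine LinearMap.ext fun v => ?_
    rw [ModuleCat.hom_sum, LinearMap.sum_apply]
    exact (Finset.univ_sum_single v).symm
  choose m hm h0 using fun j => h n (α.comp (Abelian.Ext.mk₀ (p j)) (add_zero i))
  have hle : n ≤ n + ∑ j, m j := Nat.le_add_right _ _
  refine ⟨n + ∑ j, m j, hle, ?_⟩
  have hα : α = ∑ j, (α.comp (Abelian.Ext.mk₀ (p j)) (add_zero i)).comp
      (Abelian.Ext.mk₀ (s j)) (add_zero i) := by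
    conv_lhs => rw [← Abelian.Ext.comp_mk₀_id α, hid, Abelian.Ext.mk₀_sum, Abelian.Ext.comp_sum]
    refine Finset.sum_congr rfl fun j _ => ?_
    rw [Abelian.Ext.comp_assoc_of_third_deg_zero, Abelian.Ext.mk₀_comp_mk₀]
  rw [hα, Abelian.Ext.comp_sum]
  refine Finset.sum_eq_zero fun j _ => ?_
  have h1 : m j ≤ n + ∑ j, m j :=
    (Finset.single_le_sum (fun _ _ => Nat.zero_le _) (Finset.mem_univ j)).trans (Nat.le_add_left _ _)
  rw [← Abelian.Ext.comp_assoc_of_third_deg_zero, kill_mono (hm j) h1 (h0 j), Abelian.Ext.zero_comp]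

lemma lcVanish_fg [IsNoetherianRing R] {a : Ideal R} {g r : ℕ}
    (hr : ∀ i, r < i → ∀ N : ModuleCat.{u} R, LCVanish a i N)
    (hT : ∀ i, g ≤ i → LCVanish a i (ModuleCat.of R R)) :
    ∀ i, g ≤ i → ∀ (N : Type u) [AddCommGroup N] [Module R N] [Module.Finite R N],
      LCVanish a i (ModuleCat.of R N) := by
  suffices H : ∀ k i, g ≤ i → r < i + k → ∀ (N : Type u) [AddCommGroup N] [Module R N]
      [Module.Finite R N], LCVanish a i (ModuleCat.of R N) from
    fun i hi => H (r + 1) i hi (by omega)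
  intro k
  induction k with
  | zero => intro i _ h N _ _ _; exact hr i h _
  | succ k ih =>
    intro i hi h N _ _ _
    obtain ⟨c, f, hf⟩ := Module.Finite.exists_fin' R N
    have hS := LinearMap.shortExact_shortComplexKer hf
    intro n α
    obtain ⟨m, hm, h0⟩ := ih (i+1) (by omega) (by omega) (LinearMap.ker f) n
      (α.comp hS.extClass rfl)
    rw [← Abelian.Ext.comp_assoc (a₁₂ := i) _ _ _ (zero_add i) rfl (by omega)] at h0
    obtain ⟨β, hβ⟩ := Abelian.Ext.covariant_sequence_exact₃ _ hS _ rfl h0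
    obtain ⟨m', hm', h1⟩ := lcVanish_pi (hT i hi) c m β
    refine ⟨m', hm.trans hm', ?_⟩
    rw [← qm_comp (Ideal.pow_le_pow_right hm') (Ideal.pow_le_pow_right hm),
      ← Abelian.Ext.mk₀_comp_mk₀_assoc, ← hβ, ← Abelian.Ext.comp_assoc_of_third_deg_zero, h1,
      Abelian.Ext.zero_comp]

end fg
end FBC

namespace FBC
open Limits

section final
variable {R : Type u} [CommRing R]

lemma relGrade_spec [IsNoetherianRing R] (a : Ideal R) (M : Type u) [AddCommGroup M] [Module R M]
    [Module.Finite R M] (hM : a • (⊤ : Submodule R M) ≠ ⊤) : ∃ g : ℕ, relGrade a M = g ∧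
    (∀ i < g, Subsingleton (Abelian.Ext (ModuleCat.of R (R ⧸ a)) (ModuleCat.of R M) i)) ∧
    Nontrivial (Abelian.Ext (ModuleCat.of R (R ⧸ a)) (ModuleCat.of R M) g) := by
  classical
  have hex := grade_finite a M hM
  refine ⟨Nat.find hex, ?_, ?_, Nat.find_spec hex⟩
  · apply le_antisymm
    · exact sInf_le ⟨_, (old_nontrivial_iff _ _ _).2 (Nat.find_spec hex), rfl⟩
    · refine le_sInf ?_
      rintro _ ⟨i, hi, rfl⟩
      exact Nat.cast_le.2 (Nat.find_min' hex ((old_nontrivial_iff _ _ _).1 hi))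
  · intro i hi
    exact not_nontrivial_iff_subsingleton.1 (Nat.find_min hex hi)

lemma lcVanish_of_cohDim_lt (a : Ideal R) (M : Type u) [AddCommGroup M] [Module R M] (i : ℕ)
    (h : cohDim a M < i) : LCVanish a i (ModuleCat.of R M) := by
  by_contra hc
  rw [← lc_nontrivial_iff] at hc
  exact absurd (le_sSup ⟨i, hc, rfl⟩ : (i : ℕ∞) ≤ cohDim a M) (not_le.2 h)

lemma cohDim_le (a : Ideal R) (M : Type u) [AddCommGroup M] [Module R M] (g : ℕ)
    (h : ∀ i, g < i → LCVanish a i (ModuleCat.of R M)) : cohDim a M ≤ g := by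
  refine sSup_le ?_
  rintro _ ⟨i, hi, rfl⟩
  by_contra hc
  have hc' : g < i := by simpa using hc
  exact (lc_nontrivial_iff _ _ _).1 hi (h i hc')

lemma le_cohDim (a : Ideal R) (M : Type u) [AddCommGroup M] [Module R M] (g : ℕ)
    (h : ¬ LCVanish a g (ModuleCat.of R M)) : (g : ℕ∞) ≤ cohDim a M :=
  le_sSup ⟨g, (lc_nontrivial_iff _ _ _).2 h, rfl⟩

lemma ext_baseChange_zero (T : Type u) [CommRing T] [Algebra R T] [IsNoetherianRing R]
    [Module.Flat R T] (a : Ideal R) (M : ModuleCat.{u} R) (i : ℕ)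
    (h : Subsingleton (Abelian.Ext (ModuleCat.of R (R ⧸ a)) M i)) :
    Subsingleton (Abelian.Ext (ModuleCat.of T (T ⧸ a.map (algebraMap R T))) ((BC R T).obj M) i) := by
  refine subsingleton_of_forall_eq 0 fun α => ?_
  have h1 : ∀ β : Abelian.Ext ((BC R T).obj (ModuleCat.of R (R ⧸ a))) ((BC R T).obj M) i, β = 0 := by
    intro β
    have hβ : β ∈ (⊤ : Submodule T _) := trivial
    rw [← span_map_eq_top T i (ModuleCat.of R (R ⧸ a)) M] at hβ
    have : (Set.range (fun α : Abelian.Ext (ModuleCat.of R (R ⧸ a)) M i =>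
        α.mapExactFunctor (BC R T))) ⊆ {0} := by
      rintro _ ⟨γ, rfl⟩
      simp [Subsingleton.elim γ 0]
    have h2 := Submodule.span_mono (R := T) this hβ
    simpa using h2
  have h2 := mk₀_comp_eq_zero_trans (f := (qiso T a).inv) rfl
    (h1 ((Abelian.Ext.mk₀ (qiso T a).hom).comp α (zero_add i)))
  simpa using h2

lemma smul_top_ne (T : Type u) [CommRing T] [Algebra R T] (a : Ideal R)
    (M : Type u) [AddCommGroup M] [Module R M]
    (hTM : (a.map (algebraMap R T)) • (⊤ : Submodule T (T ⊗[R] M)) ≠ ⊤) :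
    a • (⊤ : Submodule R M) ≠ ⊤ := by
  intro h
  apply hTM
  rw [eq_top_iff]
  intro z _
  induction z using TensorProduct.induction_on with
  | zero => exact Submodule.zero_mem _
  | add x y hx hy => exact Submodule.add_mem _ (hx trivial) (hy trivial)
  | tmul t m =>
    have hm : m ∈ a • (⊤ : Submodule R M) := h.ge trivial
    induction hm using Submodule.smul_induction_on' with
    | smul r hr n hn =>
      have : t ⊗ₜ[R] (r • n) = algebraMap R T r • (t ⊗ₜ[R] n) := by
        rw [TensorProduct.tmul_smul, algebraMap_smul]
      rw [this]
      exact Submodule.smul_mem_smul (Ideal.mem_map_of_mem _ hr) trivial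
    | add x _ y _ hx hy =>
      rw [TensorProduct.tmul_add]
      exact Submodule.add_mem _ (hx trivial) (hy trivial)

end final
end FBC

theorem stmt12 {R T : Type u} [CommRing R] [CommRing T] [Algebra R T]
    [IsNoetherianRing R] [IsNoetherianRing T] [Module.Flat R T]
    (a : Ideal R) (ha : a ≠ ⊤)
    (M : Type u) [AddCommGroup M] [Module R M] [Module.Finite R M]
    (hTM : (a.map (algebraMap R T)) • (⊤ : Submodule T (T ⊗[R] M)) ≠ ⊤) :
    (IsRelCM a M → cohDim (a.map (algebraMap R T)) (T ⊗[R] M) = cohDim a M) ∧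
      (IsRelMCM a M → cohDim (a.map (algebraMap R T)) T = cohDim a R) := by
  have hM := FBC.smul_top_ne T a M hTM
  obtain ⟨g, hg, hlt, hn⟩ := FBC.relGrade_spec a M hM
  obtain ⟨g', hg', hlt', hn'⟩ := FBC.relGrade_spec (a.map (algebraMap R T)) (T ⊗[R] M) hTM
  have hnv := FBC.not_lcVanish_of_grade _ _ hTM g' hlt' hn'
  have hgg : g ≤ g' := by
    by_contra! hc
    have := FBC.ext_baseChange_zero T a (ModuleCat.of R M) g' (hlt g' hc)
    exact not_nontrivial_iff_subsingleton.2 this hn'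
  constructor
  · intro h
    have hcd : cohDim a M = g := by
      rcases h with h | h
      · exact absurd h hM
      · rw [← h.2, hg]
    rw [hcd]
    apply le_antisymm
    · apply FBC.cohDim_le
      intro i hi
      exact FBC.lcVanish_baseChange T a i (ModuleCat.of R M)
        (FBC.lcVanish_of_cohDim_lt a M i (by rw [hcd]; exact_mod_cast hi))
    · exact le_trans (by exact_mod_cast hgg) (FBC.le_cohDim _ _ g' hnv)
  · intro h
    have hcd : cohDim a R = g := by rw [← hg]; exact h.symm
    rw [hcd]
    apply le_antisymm
    · apply FBC.cohDim_le
      intro i hi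
      refine FBC.lcVanish_iso (M := (FBC.BC R T).obj (ModuleCat.of R R))
        (TensorProduct.AlgebraTensorModule.rid R T T).toModuleIso ?_
      exact FBC.lcVanish_baseChange T a i (ModuleCat.of R R)
        (FBC.lcVanish_of_cohDim_lt a R i (by rw [hcd]; exact_mod_cast hi))
    · by_contra! hc
      obtain ⟨r, hr⟩ := FBC.exists_bound (a.map (algebraMap R T))
      refine hnv (FBC.lcVanish_fg hr (g := g) (fun i hi => ?_) g' hgg (T ⊗[R] M))
      exact FBC.lcVanish_of_cohDim_lt _ T i (hc.trans_le (by exact_mod_cast hi))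

end
end

section
/- Let f : R → T be a flat ring homomorphism, M a finitely generated R-module, and 𝔞 an ideal of R with 𝔞T ≠ T. If M is 𝔞-relative Cohen-Macaulay, then T ⊗_R M is 𝔞T-relative Cohen-Macaulay. -/
open CategoryTheory TensorProduct

noncomputable section

universe u

namespace RelCM

section Opp
variable {R : Type u} [CommRing R] (K : ChainComplex (ModuleCat.{u} R)ᵒᵖ ℕ) (n : ℕ)

lemma opp_surj : Function.Surjective (K.homologyι n).unop := by
  rw [← ModuleCat.epi_iff_surjective]; infer_instance

lemma opp_inj : Function.Injective (K.pOpcycles n).unop := by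
  rw [← ModuleCat.mono_iff_injective]; infer_instance

lemma opp_zero_iff (z : (K.opcycles n).unop) :
    (K.homologyι n).unop z = 0 ↔ ∃ g : (K.X ((ComplexShape.down ℕ).next n)).unop,
      (K.d n ((ComplexShape.down ℕ).next n)).unop g = (K.pOpcycles n).unop z := by
  have h1 : (ShortComplex.mk _ _ (K.homologyι_comp_fromOpcycles n
    ((ComplexShape.down ℕ).next n))).Exact := 
    ShortComplex.exact_of_f_is_kernel _ (K.homologyIsKernel n _ rfl)
  have h2 := h1.unop
  rw [ShortComplex.moduleCat_exact_iff] at h2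
  have h3 : ∀ g, (K.d n ((ComplexShape.down ℕ).next n)).unop g =
      (K.pOpcycles n).unop ((K.fromOpcycles n ((ComplexShape.down ℕ).next n)).unop g) := by
    intro g
    rw [← K.p_fromOpcycles]
    rfl
  constructor
  · intro hz
    obtain ⟨g, hg⟩ := h2 z hz
    exact ⟨g, (h3 g).trans (congrArg _ hg)⟩
  · rintro ⟨g, hg⟩
    rw [h3] at hg
    rw [← opp_inj K n hg]
    have := K.homologyι_comp_fromOpcycles n ((ComplexShape.down ℕ).next n)
    exact congrArg (fun f => f.unop g) this

lemma opp_cycle (z : (K.opcycles n).unop) :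
    (K.d (n+1) n).unop ((K.pOpcycles n).unop z) = 0 := by
  have := K.d_pOpcycles (n+1) n
  exact congrArg (fun f => f.unop z) this

lemma opp_lift (f : (K.X n).unop) (hf : (K.d (n+1) n).unop f = 0) :
    ∃ z, (K.pOpcycles n).unop z = f := by
  have h1 : (ShortComplex.mk _ _ (K.d_pOpcycles (n+1) n)).Exact := 
    ShortComplex.exact_of_g_is_cokernel _ (K.opcyclesIsCokernel (n+1) n (by simp))
  have h2 := h1.unop
  rw [ShortComplex.moduleCat_exact_iff] at h2
  exact h2 f hf
end Opp

section Bridge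
variable {R : Type u} [CommRing R]

instance hasExtInst : HasExt.{u} (ModuleCat.{u} R) := hasExt_of_enoughProjectives _

abbrev OldExt (X Y : ModuleCat.{u} R) (n : ℕ) : ModuleCat.{u} R :=
  ((Ext R (ModuleCat.{u} R) n).obj (Opposite.op X)).obj Y

abbrev yon (Y : ModuleCat.{u} R) : ModuleCat.{u} R ⥤ (ModuleCat.{u} R)ᵒᵖ :=
  ((linearYoneda R (ModuleCat.{u} R)).obj Y).rightOp

abbrev cpx (Y : ModuleCat.{u} R) {X : ModuleCat.{u} R} (P : ProjectiveResolution X) :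
    ChainComplex (ModuleCat.{u} R)ᵒᵖ ℕ :=
  ((yon Y).mapHomologicalComplex _).obj P.complex

def oldOf (Y : ModuleCat.{u} R) {X : ModuleCat.{u} R} (P : ProjectiveResolution X) (n : ℕ)
    (z : ((cpx Y P).opcycles n).unop) : OldExt X Y n :=
  ((P.isoLeftDerivedObj (yon Y) n).hom.unop).hom (((cpx Y P).homologyι n).unop.hom z)

def cocyc (Y : ModuleCat.{u} R) {X : ModuleCat.{u} R} (P : ProjectiveResolution X) (n : ℕ)
    (z : ((cpx Y P).opcycles n).unop) : P.complex.X n ⟶ Y :=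
  ((cpx Y P).pOpcycles n).unop.hom z

lemma cocyc_d (Y : ModuleCat.{u} R) {X : ModuleCat.{u} R} (P : ProjectiveResolution X) (n : ℕ)
    (z : ((cpx Y P).opcycles n).unop) : P.complex.d (n+1) n ≫ cocyc Y P n z = 0 :=
  opp_cycle (cpx Y P) n z

lemma cocyc_surj (Y : ModuleCat.{u} R) {X : ModuleCat.{u} R} (P : ProjectiveResolution X) (n : ℕ)
    (f : P.complex.X n ⟶ Y) (hf : P.complex.d (n+1) n ≫ f = 0) : ∃ z, cocyc Y P n z = f :=
  opp_lift (cpx Y P) n f hf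

lemma oldOf_surj (Y : ModuleCat.{u} R) {X : ModuleCat.{u} R} (P : ProjectiveResolution X) (n : ℕ)
    (e : OldExt X Y n) : ∃ z, oldOf Y P n z = e := by
  have : Function.Surjective (P.isoLeftDerivedObj (yon Y) n).hom.unop := by
    rw [← ModuleCat.epi_iff_surjective]; infer_instance
  obtain ⟨y, rfl⟩ := this e
  obtain ⟨z, rfl⟩ := opp_surj (cpx Y P) n y
  exact ⟨z, rfl⟩

lemma oldOf_zero_iff (Y : ModuleCat.{u} R) {X : ModuleCat.{u} R} (P : ProjectiveResolution X) (n : ℕ)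
    (z : ((cpx Y P).opcycles n).unop) : oldOf Y P n z = 0 ↔
      ∃ g : P.complex.X ((ComplexShape.down ℕ).next n) ⟶ Y,
        P.complex.d n _ ≫ g = cocyc Y P n z := by
  have : Function.Injective (P.isoLeftDerivedObj (yon Y) n).hom.unop := by
    rw [← ModuleCat.mono_iff_injective]; infer_instance
  refine Iff.trans ?_ (opp_zero_iff (cpx Y P) n z)
  exact map_eq_zero_iff (P.isoLeftDerivedObj (yon Y) n).hom.unop.hom this

lemma oldOf_map (Y : ModuleCat.{u} R) {X X' : ModuleCat.{u} R} (P : ProjectiveResolution X)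
    (P' : ProjectiveResolution X') (f : X' ⟶ X) (φ : ProjectiveResolution.Hom P' P f) (n : ℕ)
    (z : ((cpx Y P).opcycles n).unop) :
    ∃ z', ((Ext R (ModuleCat.{u} R) n).map f.op).app Y (oldOf Y P n z) = oldOf Y P' n z' ∧
      cocyc Y P' n z' = φ.hom.f n ≫ cocyc Y P n z := by
  refine ⟨(HomologicalComplex.opcyclesMap
    (((yon Y).mapHomologicalComplex _).map φ.hom) n).unop z, ?_, ?_⟩
  · have h1 := P'.isoLeftDerivedObj_hom_naturality f P φ.hom
      (by simpa using φ.hom_f_zero_comp_π_f_zero) (yon Y) n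
    have h2 := HomologicalComplex.homologyι_naturality 
      (((yon Y).mapHomologicalComplex (ComplexShape.down ℕ)).map φ.hom) n
    have h3 : ((yon Y).leftDerived n).map f ≫ (P.isoLeftDerivedObj (yon Y) n).hom ≫
      (cpx Y P).homologyι n = (P'.isoLeftDerivedObj (yon Y) n).hom ≫
      (cpx Y P').homologyι n ≫ HomologicalComplex.opcyclesMap
        (((yon Y).mapHomologicalComplex _).map φ.hom) n := by
      refine (Category.assoc _ _ _).symm.trans ((congrArg (fun q => q ≫ (cpx Y P).homologyι n) h1).trans ?_)
      refine (Category.assoc _ _ _).trans ?_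
      exact congrArg (fun q => (P'.isoLeftDerivedObj (yon Y) n).hom ≫ q) h2
    exact congrArg (fun f => f.unop z) h3
  · have h2 := HomologicalComplex.p_opcyclesMap
      (((yon Y).mapHomologicalComplex (ComplexShape.down ℕ)).map φ.hom) n
    exact congrArg (fun f => f.unop z) h2

lemma extMk_zero_iff' (Y : ModuleCat.{u} R) {X : ModuleCat.{u} R} (P : ProjectiveResolution X)
    (n : ℕ) (f : P.complex.X n ⟶ Y) (hf : P.complex.d (n+1) n ≫ f = 0) :
    P.extMk f (n+1) rfl hf = 0 ↔ 
      ∃ g : P.complex.X ((ComplexShape.down ℕ).next n) ⟶ Y, P.complex.d n _ ≫ g = f := by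
  cases n with
  | succ n => 
    rw [P.extMk_eq_zero_iff _ _ _ _ n rfl, ChainComplex.next_nat_succ]
  | zero =>
    constructor
    · intro h
      rw [← P.extEquivCohomologyClass.apply_eq_iff_eq,
        ProjectiveResolution.extEquivCohomologyClass_extMk,
        ProjectiveResolution.extEquivCohomologyClass_zero,
        CochainComplex.HomComplex.CohomologyClass.mk_eq_zero_iff,
        CochainComplex.HomComplex.Cocycle.toSingleMk_mem_coboundaries_iff _ _ _ _ _ 1 (by simp)] at h
      obtain ⟨g, hg⟩ := h
      have hz : g = 0 := (CochainComplex.isZero_of_isStrictlyLE P.cochainComplex 0 1).eq_of_src _ _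
      rw [hz, Limits.comp_zero] at hg
      have : f = 0 := by
        rw [← cancel_epi (P.cochainComplexXIso (-(0:ℕ)) 0 rfl).hom, ← hg, Limits.comp_zero]
      exact ⟨0, by simp [this]⟩
    · rintro ⟨g, rfl⟩
      simp

def Rel {X Y : ModuleCat.{u} R} {n : ℕ} (e : OldExt X Y n) (e' : Abelian.Ext.{u} X Y n) : Prop :=
  ∃ z, e = oldOf Y (projectiveResolution X) n z ∧ 
    e' = (projectiveResolution X).extMk (cocyc Y (projectiveResolution X) n z) (n+1) rfl
      (cocyc_d _ _ _ _)

lemma Rel.exists_right {X Y : ModuleCat.{u} R} {n : ℕ} (e : OldExt X Y n) : ∃ e', Rel e e' := by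
  obtain ⟨z, rfl⟩ := oldOf_surj Y (projectiveResolution X) n e
  exact ⟨_, z, rfl, rfl⟩

lemma Rel.exists_left {X Y : ModuleCat.{u} R} {n : ℕ} (e' : Abelian.Ext.{u} X Y n) :
    ∃ e : OldExt X Y n, Rel e e' := by
  obtain ⟨f, hf, rfl⟩ := (projectiveResolution X).extMk_surjective e' (n+1) rfl
  obtain ⟨z, rfl⟩ := cocyc_surj Y (projectiveResolution X) n f hf
  exact ⟨_, z, rfl, rfl⟩

lemma Rel.zero_iff {X Y : ModuleCat.{u} R} {n : ℕ} {e : OldExt X Y n}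
    {e' : Abelian.Ext.{u} X Y n} (h : Rel e e') : e = 0 ↔ e' = 0 := by
  obtain ⟨z, rfl, rfl⟩ := h
  rw [oldOf_zero_iff, extMk_zero_iff']

lemma Rel.map {X X' Y : ModuleCat.{u} R} {n : ℕ} {e : OldExt X Y n}
    {e' : Abelian.Ext.{u} X Y n} (h : Rel e e') (f : X' ⟶ X) :
    Rel (((Ext R (ModuleCat.{u} R) n).map f.op).app Y e) 
      ((Abelian.Ext.mk₀ f).comp e' (zero_add _)) := by
  obtain ⟨z, rfl, rfl⟩ := h
  let φ : ProjectiveResolution.Hom (projectiveResolution X') (projectiveResolution X) f :=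
    ⟨ProjectiveResolution.lift f _ _, by
      rw [← HomologicalComplex.comp_f, ProjectiveResolution.lift_commutes]; rfl⟩
  obtain ⟨z', h1, h2⟩ := oldOf_map Y _ _ f φ n z
  refine ⟨z', h1, ?_⟩
  rw [ProjectiveResolution.mk₀_comp_extMk _ _ _ _ φ]
  congr 1
  exact h2.symm

end Bridge
end RelCM

namespace RelCM

section Colim
variable {S : Type u} [CommRing S] (b : Ideal S)

abbrev Q (n : ℕ) : ModuleCat.{u} S := ModuleCat.of S (S ⧸ b ^ n)

def tr {n m : ℕ} (h : n ≤ m) : Q b m ⟶ Q b n :=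
  (localCohomology.ringModIdeals (localCohomology.idealPowersDiagram b)).map (homOfLE h).op

lemma tr_mk {n m : ℕ} (h : n ≤ m) (x : S) :
    (tr b h).hom (Ideal.Quotient.mk _ x) = Ideal.Quotient.mk _ x := rfl

def V (N : Type u) [AddCommGroup N] [Module S N] (i : ℕ) : Prop :=
  ∀ n (e : Abelian.Ext.{u} (Q b n) (ModuleCat.of S N) i), ∃ m, ∃ h : n ≤ m,
    (Abelian.Ext.mk₀ (tr b h)).comp e (zero_add _) = 0

def G (N : Type u) [AddCommGroup N] [Module S N] (i : ℕ) : Prop :=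
  ∀ (e : Abelian.Ext.{u} (ModuleCat.of S (S ⧸ b)) (ModuleCat.of S N) i), e = 0

lemma G_iff (N : Type u) [AddCommGroup N] [Module S N] (i : ℕ) :
    Nontrivial (((Ext S (ModuleCat.{u} S) i).obj
      (Opposite.op (ModuleCat.of S (S ⧸ b)))).obj (ModuleCat.of S N)) ↔ ¬ G b N i := by
  rw [← not_subsingleton_iff_nontrivial, not_iff_not]
  constructor
  · intro h e
    obtain ⟨e', he⟩ := Rel.exists_left e
    exact he.zero_iff.1 (Subsingleton.elim _ _)
  · intro h
    refine subsingleton_of_forall_eq 0 fun e => ?_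
    obtain ⟨e', he⟩ := Rel.exists_right e
    exact he.zero_iff.2 (h _)

lemma V_iff (N : Type u) [AddCommGroup N] [Module S N] (i : ℕ) :
    Nontrivial ((localCohomology b i).obj (ModuleCat.of S N)) ↔ ¬ V b N i := by
  rw [← not_subsingleton_iff_nontrivial, not_iff_not]
  let D := localCohomology.diagram (localCohomology.idealPowersDiagram b) i
  let D' := D ⋙ (evaluation _ _).obj (ModuleCat.of S N)
  have e : (localCohomology b i).obj (ModuleCat.of S N) ≅ Limits.colimit D' :=
    Limits.colimitObjIsoColimitCompEvaluation D (ModuleCat.of S N)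
  have : Limits.PreservesFilteredColimitsOfSize.{0,0} (forget (ModuleCat.{u} S)) :=
    Limits.preservesFilteredColimitsOfSize_shrink.{0,u,0,u} _
  rw [e.toLinearEquiv.toEquiv.subsingleton_congr]
  constructor
  · intro h n x'
    obtain ⟨x, hx⟩ := Rel.exists_left x'
    have h0 : Limits.colimit.ι D' (Opposite.op (Opposite.op n)) x = 0 := Subsingleton.elim _ _
    obtain ⟨j, f, hf⟩ := Limits.Concrete.colimit_rep_eq_zero S D' _ _ h0
    exact ⟨j.unop.unop, f.unop.unop.down.down, ((hx.map (tr b f.unop.unop.down.down)).zero_iff.1 hf)⟩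
  · intro h
    refine subsingleton_of_forall_eq 0 fun x => ?_
    obtain ⟨j, y, rfl⟩ := Limits.Concrete.colimit_exists_rep D' x
    obtain ⟨y', hy⟩ := Rel.exists_right (X := Q b j.unop.unop) (Y := ModuleCat.of S N) (n := i) y
    obtain ⟨m, hm, h0⟩ := h _ y'
    have h1 := (hy.map (tr b hm)).zero_iff.2 h0
    have h2 := Limits.colimit.w D' (j' := j) (j := Opposite.op (Opposite.op m)) (homOfLE hm).op.op
    have h3 : Limits.colimit.ι D' j y =
      Limits.colimit.ι D' (Opposite.op (Opposite.op m)) (D'.map (homOfLE hm).op.op y) := by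
      rw [← h2]; rfl
    rw [h3]
    exact (congrArg _ h1).trans (map_zero (Limits.colimit.ι D' (Opposite.op (Opposite.op m))).hom)
end Colim
end RelCM

namespace RelCM

section Rees
open Pointwise
variable {S : Type u} [CommRing S] [IsNoetherianRing S] {b : Ideal S}
  {N : Type u} [AddCommGroup N] [Module S N] [Module.Finite S N]

lemma G_congr {N' : Type u} [AddCommGroup N'] [Module S N'] (e : (S ⧸ b) ≃ₗ[S] N') {i : ℕ}
    (h : G b N i) (x : Abelian.Ext.{u} (ModuleCat.of S N') (ModuleCat.of S N) i) : x = 0 := by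
  have h1 := h ((Abelian.Ext.mk₀ (ModuleCat.ofHom e.toLinearMap)).comp x (zero_add _))
  have h2 := congrArg (fun y => (Abelian.Ext.mk₀ (ModuleCat.ofHom e.symm.toLinearMap)).comp y
    (zero_add _)) h1
  simp only [Abelian.Ext.mk₀_comp_mk₀_assoc, Abelian.Ext.comp_zero] at h2
  rw [← h2, ← ModuleCat.ofHom_comp, LinearEquiv.comp_symm]
  exact (Abelian.Ext.mk₀_id_comp x).symm

lemma ext_vanish (hb : b • (⊤ : Submodule S N) ≠ ⊤) {n : ℕ} (h : ∀ j < n, G b N j)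
    (X : ModuleCat.{u} S) [Module.Finite S X] (m : ℕ) (hX : b ^ m ≤ Module.annihilator S X)
    (j : ℕ) (hj : j < n) (e : Abelian.Ext.{u} X (ModuleCat.of S N) j) : e = 0 := by
  have tf := ModuleCat.exists_isRegular_tfae b n (ModuleCat.of S N) (lt_top_iff_ne_top.2 hb)
  have h2 := (tf.out 1 3).1 (by
    intro i hi
    refine subsingleton_of_forall_eq 0 fun x => ?_
    exact G_congr (Shrink.linearEquiv S _).symm (h i hi) x)
  obtain ⟨rs, hl, hm, hr⟩ := h2
  have := ModuleCat.subsingleton_ext_of_exists_isRegular b X (by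
    rw [Module.support_eq_zeroLocus]
    rw [PrimeSpectrum.zeroLocus_subset_zeroLocus_iff]
    intro x hx
    exact ⟨m, hX (Ideal.pow_mem_pow hx m)⟩) (ModuleCat.of S N) (lt_top_iff_ne_top.2 hb) rs hm hr j
    (by omega)
  exact Subsingleton.elim _ _

lemma V_of_G (hb : b • (⊤ : Submodule S N) ≠ ⊤) {i : ℕ} (h : ∀ j ≤ i, G b N j) : V b N i := by
  intro n e
  refine ⟨n, le_rfl, ?_⟩
  have : Module.Finite S (Q b n) := inferInstanceAs (Module.Finite S (S ⧸ b ^ n))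
  have : e = 0 := ext_vanish (n := i + 1) hb (fun j hj => h j (by omega)) (Q b n) n
    (Ideal.annihilator_quotient (I := b ^ n)).ge i (by omega) e
  rw [this, Abelian.Ext.comp_zero]

lemma G_of_V (hb : b • (⊤ : Submodule S N) ≠ ⊤) {i : ℕ} (h : ∀ j < i, G b N j) (hV : V b N i) :
    G b N i := by
  suffices H : ∀ e : Abelian.Ext.{u} (Q b 1) (ModuleCat.of S N) i, e = 0 by
    exact G_congr (b := b ^ 1) (Submodule.quotEquivOfEq _ _ (pow_one b)) H
  intro e
  obtain ⟨m, hm, h0⟩ := hV 1 e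
  have hepi : Epi (tr b hm) := by
    rw [ModuleCat.epi_iff_surjective]
    intro x
    obtain ⟨y, rfl⟩ := Ideal.Quotient.mk_surjective x
    exact ⟨Ideal.Quotient.mk _ y, rfl⟩
  rcases i with _ | i
  · exact Abelian.Ext.precomp_mk₀_injective_of_epi (ModuleCat.of S N) (tr b hm)
      (h0.trans (Abelian.Ext.comp_zero _ _ _ _ (zero_add 0)).symm)
  · let f := (tr b hm).hom
    have hS : (ModuleCat.shortComplexOfCompEqZero (LinearMap.ker f).subtype f
      (by ext x; exact x.2)).ShortExact :=
      { exact := ModuleCat.shortComplex_exact _ (by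
          rw [LinearMap.exact_iff]; simp)
        mono_f := by rw [ModuleCat.mono_iff_injective]; exact Subtype.val_injective
        epi_g := hepi }
    obtain ⟨x, hx⟩ := Abelian.Ext.contravariant_sequence_exact₃ hS _ e h0 (n₀ := i) (by omega)
    have : Module.Finite S (Q b m) := inferInstanceAs (Module.Finite S (S ⧸ b ^ m))
    rw [← hx, ext_vanish hb h (ModuleCat.of S (LinearMap.ker f)) m ?_ i (by omega) x,
      Abelian.Ext.comp_zero]
    refine le_trans (Ideal.annihilator_quotient (I := b ^ m)).ge ?_
    exact LinearMap.annihilator_le_of_injective (LinearMap.ker f).subtype Subtype.val_injective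

lemma smul_top_aux (hG : ∀ (K : Submodule S N) (N' : Type u) [AddCommGroup N'] [Module S N']
    [Module.Finite S N'] (φ : N →ₗ[S] N'), Function.Surjective φ → LinearMap.ker φ = K →
    (∀ i, G b N' i) → b • (⊤ : Submodule S N') = ⊤) (h : ∀ i, G b N i) :
    b • (⊤ : Submodule S N) = ⊤ :=
  hG _ N LinearMap.id Function.surjective_id rfl h

lemma smul_top_of_G (h : ∀ i, G b N i) : b • (⊤ : Submodule S N) = ⊤ := by
  refine smul_top_aux (fun K => ?_) h
  induction K using WellFoundedGT.induction with
  | ind K ih =>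
  intro N' _ _ _ φ hφ hK hG
  have h0 : Subsingleton ((S ⧸ b) →ₗ[S] N') := by
    refine subsingleton_of_forall_eq 0 fun f => ?_
    have := hG 0 (Abelian.Ext.mk₀ (ModuleCat.ofHom f))
    rw [Abelian.Ext.mk₀_eq_zero_iff] at this
    exact congrArg ModuleCat.Hom.hom this
  obtain ⟨x, hx, hreg⟩ := IsSMulRegular.subsingleton_linearMap_iff.mp h0
  rw [Ideal.annihilator_quotient] at hx
  have hG' : ∀ i, G b (QuotSMulTop x N') i := by
    intro i e
    have hS := IsSMulRegular.smulShortComplex_shortExact (M := ModuleCat.of S N') hreg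
    obtain ⟨y, hy⟩ := Abelian.Ext.covariant_sequence_exact₃ _ hS e rfl (hG (i+1) _)
    rw [← hy]
    have hy0 : y = 0 := hG i y
    subst hy0
    apply Abelian.Ext.zero_comp (C := ModuleCat.{u} S)
  let p := (x • (⊤ : Submodule S N')).mkQ
  have hle : K ≤ LinearMap.ker (p ∘ₗ φ) := by
    rw [← hK]; exact LinearMap.ker_le_ker_comp φ p
  have hxb : x • (⊤ : Submodule S N') ≤ b • ⊤ := by
    rw [← Submodule.ideal_span_singleton_smul]
    exact Submodule.smul_mono_left ((Ideal.span_singleton_le_iff_mem b).mpr hx)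
  rcases hle.lt_or_eq with hlt | heq
  · have h1 := ih _ hlt (QuotSMulTop x N') (p ∘ₗ φ)
      ((Submodule.mkQ_surjective _).comp hφ) rfl hG'
    have h2 := congrArg (Submodule.comap p) h1
    rw [Submodule.comap_smul_top_of_surjective b _ (Submodule.mkQ_surjective _)] at h2
    simpa [p, hxb] using h2
  · have : ∀ n : N', n = 0 := by
      intro n
      apply hreg
      simp only [smul_zero]
      obtain ⟨n, rfl⟩ := hφ n
      have hm : x • n ∈ LinearMap.ker (p ∘ₗ φ) := by
        simp only [LinearMap.mem_ker, LinearMap.comp_apply, map_smul, p]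
        rw [← map_smul, Submodule.mkQ_apply, Submodule.Quotient.mk_eq_zero]
        exact Submodule.smul_mem_pointwise_smul _ _ _ trivial
      rw [← heq, ← hK] at hm
      simpa using hm
    rw [eq_top_iff]
    intro n _
    rw [this n]; exact zero_mem _
end Rees
end RelCM

namespace RelCM

section BC
variable (R T : Type u) [CommRing R] [CommRing T] [Algebra R T]

def F : ModuleCat.{u} R ⥤ ModuleCat.{u} T where
  obj X := ModuleCat.of T (T ⊗[R] X)
  map f := ModuleCat.ofHom (f.hom.baseChange T)
  map_id X := by ext; simp
  map_comp f g := by ext; simp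

instance : (F R T).Additive where
  map_add {X Y f g} := by
    apply ModuleCat.hom_ext
    exact LinearMap.baseChange_add f.hom g.hom

lemma F_exact [Module.Flat R T] (S : ShortComplex (ModuleCat.{u} R)) (hS : S.Exact) :
    (S.map (F R T)).Exact := by
  rw [ShortComplex.ShortExact.moduleCat_exact_iff_function_exact] at hS ⊢
  exact Module.Flat.lTensor_exact T hS

instance [Module.Flat R T] : Limits.PreservesFiniteLimits (F R T) :=
  have h : Limits.PreservesFiniteLimits (F R T) ∧ Limits.PreservesFiniteColimits (F R T) :=
    ((F R T).exact_tfae.out 1 3).1 (F_exact R T)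
  h.1

instance [Module.Flat R T] : Limits.PreservesFiniteColimits (F R T) :=
  have h : Limits.PreservesFiniteLimits (F R T) ∧ Limits.PreservesFiniteColimits (F R T) :=
    ((F R T).exact_tfae.out 1 3).1 (F_exact R T)
  h.2

variable {R}
lemma F_span [Module.Flat R T] [IsNoetherianRing R] (M : ModuleCat.{u} R) (i : ℕ) :
    ∀ (X : ModuleCat.{u} R) [Module.Finite R X]
      (e : Abelian.Ext.{u} ((F R T).obj X) ((F R T).obj M) i),
      e ∈ Submodule.span T (Set.range (fun x : Abelian.Ext.{u} X M i =>
        x.mapExactFunctor (F R T))) := by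
  induction i with
  | zero =>
    intro X _ e
    obtain ⟨f, rfl⟩ := (Abelian.Ext.mk₀_bijective _ _).2 e
    have : Module.FinitePresentation R X := Module.finitePresentation_of_finite R X
    have hb := Module.FinitePresentation.isBaseChange_map (R := R) (M := X) (N := M) T
    have hf : f.hom ∈ Submodule.span T (Set.range (LinearMap.baseChangeHom R T X M)) := by
      refine hb.inductionOn f.hom (fun g => g ∈ Submodule.span T
        (Set.range (LinearMap.baseChangeHom R T X M))) (zero_mem _)
        (fun m => Submodule.subset_span ⟨m, rfl⟩) (fun s n h => Submodule.smul_mem _ _ h)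
        (fun x y hx hy => add_mem hx hy)
    have key : ∀ g : T ⊗[R] X →ₗ[T] T ⊗[R] M,
        g ∈ Submodule.span T (Set.range (LinearMap.baseChangeHom R T X M)) →
        Abelian.Ext.mk₀ (X := (F R T).obj X) (Y := (F R T).obj M) (ModuleCat.ofHom g) ∈
        Submodule.span T (Set.range (fun x : Abelian.Ext.{u} X M 0 =>
        x.mapExactFunctor (F R T))) := by
      intro g hg
      induction hg using Submodule.span_induction with
      | mem g hg =>
        obtain ⟨y, rfl⟩ := hg
        refine Submodule.subset_span ⟨Abelian.Ext.mk₀ (ModuleCat.ofHom y), ?_⟩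
        exact Abelian.Ext.mapExactFunctor_mk₀ (F R T) (ModuleCat.ofHom y)
      | zero =>
        have : (ModuleCat.ofHom 0 : (F R T).obj X ⟶ (F R T).obj M) = 0 := rfl
        erw [this, Abelian.Ext.mk₀_zero]; exact zero_mem _
      | add x y _ _ hx hy =>
        have : (ModuleCat.ofHom (x + y) : (F R T).obj X ⟶ (F R T).obj M) =
          ModuleCat.ofHom x + ModuleCat.ofHom y := rfl
        erw [this, Abelian.Ext.mk₀_add]; exact add_mem hx hy
      | smul t x _ hx =>
        have : (ModuleCat.ofHom (t • x) : (F R T).obj X ⟶ (F R T).obj M) =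
          t • ModuleCat.ofHom x := rfl
        erw [this, Abelian.Ext.mk₀_smul]; exact Submodule.smul_mem _ _ hx
    exact key f.hom hf
  | succ i ih =>
    intro X _ e
    obtain ⟨k, f, hf⟩ := Module.Finite.exists_fin' R X
    have hS : (ModuleCat.shortComplexOfCompEqZero (LinearMap.ker f).subtype f
      (by ext x; exact x.2)).ShortExact :=
      { exact := ModuleCat.shortComplex_exact _ (by
          rw [LinearMap.exact_iff]; simp)
        mono_f := by rw [ModuleCat.mono_iff_injective]; exact Subtype.val_injective
        epi_g := by rw [ModuleCat.epi_iff_surjective]; exact hf }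
    have hFS := hS.map_of_exact (F R T)
    have hproj : Projective (((ModuleCat.shortComplexOfCompEqZero (LinearMap.ker f).subtype f
      (by ext x; exact x.2)).map (F R T)).X₂) := by
      have : Module.Free T (T ⊗[R] (Fin k → R)) := inferInstance
      exact ModuleCat.projective_of_free (M := ModuleCat.of T (T ⊗[R] (Fin k → R)))
        (Module.Free.chooseBasis T _)
    obtain ⟨y, hy⟩ := Abelian.Ext.contravariant_sequence_exact₃ hFS _ e
      (Abelian.Ext.eq_zero_of_projective _) (n₀ := i) (by omega)
    have key : ∀ y : Abelian.Ext.{u} ((F R T).obj (ModuleCat.of R (LinearMap.ker f)))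
        ((F R T).obj M) i,
        y ∈ Submodule.span T (Set.range
          (fun x : Abelian.Ext.{u} (ModuleCat.of R (LinearMap.ker f)) M i =>
          x.mapExactFunctor (F R T))) →
        hFS.extClass.comp y (add_comm 1 i) ∈ Submodule.span T
          (Set.range (fun x : Abelian.Ext.{u} X M (i+1) => x.mapExactFunctor (F R T))) := by
      intro g hg
      induction hg using Submodule.span_induction with
      | mem g hg =>
        obtain ⟨y, rfl⟩ := hg
        refine Submodule.subset_span ⟨hS.extClass.comp y (add_comm 1 i), ?_⟩
        refine (Abelian.Ext.mapExactFunctor_comp (F R T) _ _ _).trans ?_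
        rw [Abelian.Ext.mapExactFunctor_extClass]
        rfl
      | zero =>
        have := Abelian.Ext.comp_zero hFS.extClass ((F R T).obj M) i (i+1) (add_comm 1 i)
        exact this ▸ zero_mem _
      | add x y _ _ hx hy =>
        have := Abelian.Ext.comp_add hFS.extClass x y (add_comm 1 i)
        exact this ▸ add_mem hx hy
      | smul t x _ hx =>
        have := Abelian.Ext.comp_smul hFS.extClass x (add_comm 1 i) t
        exact this ▸ Submodule.smul_mem _ _ hx
    rw [← hy]
    exact key y (ih _ y)

variable {T}
def phi (J : Ideal R) (I : Ideal T) (h : J.map (algebraMap R T) ≤ I) :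
    (F R T).obj (ModuleCat.of R (R ⧸ J)) ⟶ ModuleCat.of T (T ⧸ I) :=
  ModuleCat.ofHom (LinearMap.liftBaseChange T (Submodule.liftQ J
    ((Submodule.mkQ I).restrictScalars R ∘ₗ Algebra.linearMap R T) (by
      intro x hx
      simp only [LinearMap.mem_ker, LinearMap.comp_apply, LinearMap.coe_restrictScalars,
        Algebra.linearMap_apply, Submodule.mkQ_apply, Submodule.Quotient.mk_eq_zero]
      exact h (Ideal.mem_map_of_mem _ hx))))

lemma one_tmul_aux (J : Ideal R) (x : T) (hx : x ∈ J.map (algebraMap R T)) :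
    x ⊗ₜ[R] (Submodule.Quotient.mk 1 : R ⧸ J) = 0 := by
  induction hx using Submodule.span_induction with
  | mem x hx =>
    obtain ⟨y, hy, rfl⟩ := hx
    have : (Submodule.Quotient.mk (y • 1) : R ⧸ J) = 0 := by
      rw [Submodule.Quotient.mk_eq_zero]; simpa using hy
    rw [Algebra.algebraMap_eq_smul_one, TensorProduct.smul_tmul, ← Submodule.Quotient.mk_smul,
      this, TensorProduct.tmul_zero]
  | zero => simp
  | add x y _ _ hx hy => rw [TensorProduct.add_tmul, hx, hy, add_zero]
  | smul t x _ hx => rw [← TensorProduct.smul_tmul', hx, smul_zero]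

def psi (J : Ideal R) (I : Ideal T) (h : I ≤ J.map (algebraMap R T)) :
    ModuleCat.of T (T ⧸ I) ⟶ (F R T).obj (ModuleCat.of R (R ⧸ J)) :=
  ModuleCat.ofHom (Submodule.liftQ I (LinearMap.toSpanSingleton T (T ⊗[R] (R ⧸ J))
    ((1 : T) ⊗ₜ[R] (Submodule.Quotient.mk 1 : R ⧸ J))) (by
      intro x hx
      rw [LinearMap.mem_ker, LinearMap.toSpanSingleton_apply, TensorProduct.smul_tmul',
        smul_eq_mul, mul_one]
      exact one_tmul_aux J x (h hx)))

lemma phi_tmul (J : Ideal R) (I : Ideal T) (h : J.map (algebraMap R T) ≤ I) :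
    (phi J I h).hom ((1 : T) ⊗ₜ[R] (Submodule.Quotient.mk 1 : R ⧸ J)) =
      (Submodule.Quotient.mk 1 : T ⧸ I) := by
  have : (phi J I h).hom ((1 : T) ⊗ₜ[R] (Submodule.Quotient.mk 1 : R ⧸ J)) =
    (1 : T) • (Submodule.Quotient.mk (algebraMap R T 1) : T ⧸ I) := rfl
  rw [this, map_one, one_smul]

lemma psi_mk (J : Ideal R) (I : Ideal T) (h : I ≤ J.map (algebraMap R T)) :
    (psi J I h).hom (Submodule.Quotient.mk 1 : T ⧸ I) =
      (1 : T) ⊗ₜ[R] (Submodule.Quotient.mk 1 : R ⧸ J) := by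
  have : (psi J I h).hom (Submodule.Quotient.mk 1 : T ⧸ I) =
    (1 : T) • ((1 : T) ⊗ₜ[R] (Submodule.Quotient.mk 1 : R ⧸ J)) := rfl
  rw [this, one_smul]

lemma psi_phi (J : Ideal R) (I : Ideal T) (h : I = J.map (algebraMap R T)) :
    psi J I h.le ≫ phi J I h.ge = 𝟙 _ := by
  apply ModuleCat.hom_ext
  apply Submodule.linearMap_qext
  apply LinearMap.ext_ring
  exact (congrArg (phi J I h.ge).hom (psi_mk J I h.le)).trans (phi_tmul J I h.ge)

lemma psi_tr_phi (a : Ideal R) {n m : ℕ} (hnm : n ≤ m) :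
    psi (a ^ m) ((a.map (algebraMap R T)) ^ m) (Ideal.map_pow _ _ _).ge ≫
      (F R T).map (tr a hnm) ≫
      phi (a ^ n) ((a.map (algebraMap R T)) ^ n) (Ideal.map_pow _ _ _).le =
    tr (a.map (algebraMap R T)) hnm := by
  apply ModuleCat.hom_ext
  apply Submodule.linearMap_qext
  apply LinearMap.ext_ring
  refine (congrArg (fun x => (phi (a ^ n) ((a.map (algebraMap R T)) ^ n)
    (Ideal.map_pow _ _ _).le).hom (((F R T).map (tr a hnm)).hom x))
    (psi_mk (a ^ m) ((a.map (algebraMap R T)) ^ m) (Ideal.map_pow _ _ _).ge)).trans ?_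
  exact phi_tmul _ _ _

lemma G_base [Module.Flat R T] [IsNoetherianRing R] (a : Ideal R)
    (M : Type u) [AddCommGroup M] [Module R M] {i : ℕ} (h : G a M i) :
    G (a.map (algebraMap R T)) (T ⊗[R] M) i := by
  intro e
  have h1 : ∀ y : Abelian.Ext.{u} ((F R T).obj (ModuleCat.of R (R ⧸ a)))
      ((F R T).obj (ModuleCat.of R M)) i, y = 0 := by
    intro y
    have hy := F_span T (ModuleCat.of R M) i (ModuleCat.of R (R ⧸ a)) y
    have : Set.range (fun x : Abelian.Ext.{u} (ModuleCat.of R (R ⧸ a)) (ModuleCat.of R M) i =>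
        x.mapExactFunctor (F R T)) ⊆ {0} := by
      rintro _ ⟨x, rfl⟩
      simp only [h x, Set.mem_singleton_iff]
      exact Abelian.Ext.mapExactFunctor_zero _ _ _ _
    have := Submodule.span_mono (R := T) this hy
    simpa using this
  have h2 := h1 ((Abelian.Ext.mk₀ (phi a _ le_rfl)).comp e (zero_add _))
  have h3 := congrArg (fun y => (Abelian.Ext.mk₀ (psi a _ le_rfl)).comp y (zero_add _)) h2
  refine Eq.trans ?_ (h3.trans (Abelian.Ext.comp_zero _ _ _ _ _))
  simp only [Abelian.Ext.mk₀_comp_mk₀_assoc]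
  rw [psi_phi a _ rfl, Abelian.Ext.mk₀_id_comp]

lemma tr_tr {S : Type u} [CommRing S] (b : Ideal S) {n m k : ℕ} (h : n ≤ m) (h' : m ≤ k) :
    tr b h' ≫ tr b h = tr b (h.trans h') := by
  apply ModuleCat.hom_ext
  apply Submodule.linearMap_qext
  apply LinearMap.ext_ring
  rfl

lemma V_base [Module.Flat R T] [IsNoetherianRing R] (a : Ideal R)
    (M : Type u) [AddCommGroup M] [Module R M] {i : ℕ} (h : V a M i) :
    V (a.map (algebraMap R T)) (T ⊗[R] M) i := by
  suffices key : ∀ n (e : Abelian.Ext.{u} (Q (a.map (algebraMap R T)) n)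
      ((F R T).obj (ModuleCat.of R M)) i), ∃ m, ∃ h : n ≤ m,
      (Abelian.Ext.mk₀ (tr (a.map (algebraMap R T)) h)).comp e (zero_add _) = 0 from key
  intro n e
  have h1 : ∀ y : Abelian.Ext.{u} ((F R T).obj (Q a n))
      ((F R T).obj (ModuleCat.of R M)) i, ∃ m, ∀ k (hk : n ≤ k), m ≤ k →
      (Abelian.Ext.mk₀ ((F R T).map (tr a hk))).comp y (zero_add _) = 0 := by
    intro y
    have : Module.Finite R (Q a n) := inferInstanceAs (Module.Finite R (R ⧸ a ^ n))
    have hy := F_span T (ModuleCat.of R M) i (Q a n) y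
    induction hy using Submodule.span_induction with
    | mem y hy =>
      obtain ⟨x, rfl⟩ := hy
      obtain ⟨m, hm, h0⟩ := h n x
      refine ⟨m, fun k hk hmk => ?_⟩
      have h2 : (Abelian.Ext.mk₀ (tr a hk)).comp x (zero_add _) = 0 := by
        rw [← tr_tr a hm hmk, ← Abelian.Ext.mk₀_comp_mk₀_assoc, h0, Abelian.Ext.comp_zero]
      have h3 := congrArg (Abelian.Ext.mapExactFunctor (F R T)) h2
      rw [Abelian.Ext.mapExactFunctor_comp, Abelian.Ext.mapExactFunctor_mk₀,
        Abelian.Ext.mapExactFunctor_zero] at h3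
      exact h3
    | zero => exact ⟨0, fun k hk _ => Abelian.Ext.comp_zero _ _ _ _ _⟩
    | add x y _ _ hx hy =>
      obtain ⟨m, hm⟩ := hx
      obtain ⟨m', hm'⟩ := hy
      refine ⟨max m m', fun k hk hmk => ?_⟩
      rw [Abelian.Ext.comp_add, hm k hk (by omega), hm' k hk (by omega), add_zero]
    | smul t x _ hx =>
      obtain ⟨m, hm⟩ := hx
      refine ⟨m, fun k hk hmk => ?_⟩
      rw [Abelian.Ext.comp_smul, hm k hk hmk, smul_zero]
  obtain ⟨m, hm⟩ := h1 ((Abelian.Ext.mk₀ (phi (a ^ n) _ (Ideal.map_pow _ _ _).le)).comp e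
    (zero_add _))
  refine ⟨max n m, le_max_left _ _, ?_⟩
  have h2 := hm (max n m) (le_max_left _ _) (le_max_right _ _)
  have h3 := congrArg (fun y => (Abelian.Ext.mk₀ (psi (a ^ (max n m)) _
    (Ideal.map_pow _ _ _).ge)).comp y (zero_add _)) h2
  refine Eq.trans ?_ (h3.trans (Abelian.Ext.comp_zero _ _ _ _ _))
  rw [← psi_tr_phi]
  beta_reduce
  rw [← Abelian.Ext.mk₀_comp_mk₀_assoc, ← Abelian.Ext.mk₀_comp_mk₀_assoc]
end BC
end RelCM

namespace RelCM
lemma grade_eq {S : Type u} [CommRing S] {b : Ideal S} {N : Type u} [AddCommGroup N] [Module S N]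
    {c : ℕ} (h : ∀ j < c, G b N j) (hc : ¬ G b N c) : relGrade b N = c := by
  apply le_antisymm
  · exact sInf_le ⟨c, (G_iff b N c).2 hc, rfl⟩
  · refine le_sInf ?_
    rintro _ ⟨j, hj, rfl⟩
    have hj' := (G_iff b N j).1 hj
    by_contra hlt
    exact hj' (h j (by simpa using hlt))

lemma cd_eq {S : Type u} [CommRing S] {b : Ideal S} {N : Type u} [AddCommGroup N] [Module S N]
    {c : ℕ} (h : ∀ j > c, V b N j) (hc : ¬ V b N c) : cohDim b N = c := by
  apply le_antisymm
  · refine sSup_le ?_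
    rintro _ ⟨j, hj, rfl⟩
    have hj' := (V_iff b N j).1 hj
    by_contra hlt
    exact hj' (h j (by simpa using hlt))
  · exact le_sSup ⟨c, (V_iff b N c).2 hc, rfl⟩

lemma exists_c {S : Type u} [CommRing S] [IsNoetherianRing S] {b : Ideal S} {N : Type u}
    [AddCommGroup N] [Module S N] [Module.Finite S N] (hb : b • (⊤ : Submodule S N) ≠ ⊤)
    (h : relGrade b N = cohDim b N) : ∃ c : ℕ, (∀ j < c, G b N j) ∧ (∀ j > c, V b N j) := by
  classical
  have hex : ∃ i, ¬ G b N i := by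
    by_contra hh
    push Not at hh
    exact hb (smul_top_of_G hh)
  refine ⟨Nat.find hex, fun j hj => not_not.1 (Nat.find_min hex hj), fun j hj => ?_⟩
  have hg := grade_eq (fun j hj => not_not.1 (Nat.find_min hex hj)) (Nat.find_spec hex)
  by_contra hV
  have : (j : ℕ∞) ≤ cohDim b N := le_sSup ⟨j, (V_iff b N j).2 hV, rfl⟩
  rw [← h, hg] at this
  have : j ≤ Nat.find hex := by exact_mod_cast this
  omega

lemma relCM_of {S : Type u} [CommRing S] [IsNoetherianRing S] {b : Ideal S} {N : Type u}
    [AddCommGroup N] [Module S N] [Module.Finite S N] (c : ℕ) (h : ∀ j < c, G b N j)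
    (h' : ∀ j > c, V b N j) : IsRelCM b N := by
  by_cases hb : b • (⊤ : Submodule S N) = ⊤
  · exact Or.inl hb
  refine Or.inr ⟨hb, ?_⟩
  classical
  have hex : ∃ i, ¬ G b N i := by
    by_contra hh
    push Not at hh
    exact hb (smul_top_of_G hh)
  have hmin : ∀ j < Nat.find hex, G b N j := fun j hj => not_not.1 (Nat.find_min hex hj)
  have hV : ¬ V b N (Nat.find hex) := fun hv => Nat.find_spec hex (G_of_V hb hmin hv)
  have h1 : Nat.find hex = c := by
    apply le_antisymm
    · by_contra hlt
      exact hV (h' _ (by omega))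
    · by_contra hlt
      exact Nat.find_spec hex (h _ (by omega))
  rw [h1] at hV
  rw [grade_eq h (h1 ▸ Nat.find_spec hex), cd_eq h' hV]

lemma smul_top_base {R T : Type u} [CommRing R] [CommRing T] [Algebra R T] (a : Ideal R)
    (M : Type u) [AddCommGroup M] [Module R M] (h : a • (⊤ : Submodule R M) = ⊤) :
    a.map (algebraMap R T) • (⊤ : Submodule T (T ⊗[R] M)) = ⊤ := by
  rw [eq_top_iff]
  intro x _
  induction x using TensorProduct.induction_on with
  | zero => exact zero_mem _
  | add x y hx hy => exact add_mem (hx trivial) (hy trivial)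
  | tmul t m =>
    have hm : m ∈ a • (⊤ : Submodule R M) := by rw [h]; trivial
    induction hm using Submodule.smul_induction_on' with
    | smul r hr n hn =>
      rw [TensorProduct.tmul_smul, ← algebraMap_smul T r (t ⊗ₜ[R] n)]
      exact Submodule.smul_mem_smul (Ideal.mem_map_of_mem _ hr) trivial
    | add x _ y _ hx hy =>
      rw [TensorProduct.tmul_add]
      exact add_mem (hx trivial) (hy trivial)
end RelCM

theorem stmt13 {R T : Type u} [CommRing R] [CommRing T] [Algebra R T]
    [IsNoetherianRing R] [IsNoetherianRing T] [Module.Flat R T]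
    (a : Ideal R) (hT : a.map (algebraMap R T) ≠ ⊤)
    (M : Type u) [AddCommGroup M] [Module R M] [Module.Finite R M]
    (h : IsRelCM a M) :
    IsRelCM (a.map (algebraMap R T)) (T ⊗[R] M) := by
  rcases h with h | ⟨hb, h⟩
  · exact Or.inl (RelCM.smul_top_base a M h)
  · obtain ⟨c, h1, h2⟩ := RelCM.exists_c hb h
    exact RelCM.relCM_of c (fun j hj => RelCM.G_base a M (h1 j hj))
      (fun j hj => RelCM.V_base a M (h2 j hj))

end
end
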